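/- Let 𝔤 be a finite-dimensional complex semisimple Lie algebra and let e be a nilpotent element of 𝔤 (i.e. ad e is a nilpotent endomorphism). Then ind 𝔫(𝔤^e) = rk 𝔤 − dim 𝔷(𝔤^e), where 𝔤^e is the centralizer of e in 𝔤, 𝔫(𝔤^e) is the normalizer of 𝔤^e in 𝔤, and 𝔷(𝔤^e) is the centre of 𝔤^e. -/

import Mathlib

open scoped ComplexOrder

/-- The centralizer `𝔤^e = {x ∈ 𝔤 : ⁅x, e⁆ = 0}` of an element `e`, as a Lie subalgebra. -/
def centralizer (L : Type*) [LieRing L] [LieAlgebra ℂ L] (e : L) : LieSubalgebra ℂ L where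
  carrier := {x : L | ⁅x, e⁆ = 0}
  add_mem' := fun {a b} ha hb => by
    simp only [Set.mem_setOf_eq] at *
    rw [add_lie, ha, hb, add_zero]
  zero_mem' := by simp
  smul_mem' := fun c a ha => by
    simp only [Set.mem_setOf_eq] at *
    rw [smul_lie, ha, smul_zero]
  lie_mem' := fun {a b} ha hb => by
    simp only [Set.mem_setOf_eq] at *
    simp [lie_lie, ha, hb]

/-- Membership in the centre `𝔷(𝔤^e)` of the centralizer of `e`:
`v` centralizes `e` and commutes with every element of `𝔤^e`. -/
def InCenterOfCentralizer (L : Type*) [LieRing L] [LieAlgebra ℂ L] (e v : L) : Prop :=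
  ⁅v, e⁆ = 0 ∧ ∀ y : L, ⁅y, e⁆ = 0 → ⁅v, y⁆ = 0

/-- The centre `𝔷(𝔤^e)` of the centralizer of `e`, as a subspace of `L`. -/
def zCenter (L : Type*) [LieRing L] [LieAlgebra ℂ L] (e : L) : Submodule ℂ L where
  carrier := {v : L | ⁅v, e⁆ = 0 ∧ ∀ y : L, ⁅y, e⁆ = 0 → ⁅v, y⁆ = 0}
  add_mem' := fun {a b} ha hb => ⟨by rw [add_lie, ha.1, hb.1, add_zero],
    fun y hy => by rw [add_lie, ha.2 y hy, hb.2 y hy, add_zero]⟩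
  zero_mem' := ⟨zero_lie e, fun y _ => zero_lie y⟩
  smul_mem' := fun c a ha => ⟨by rw [smul_lie, ha.1, smul_zero],
    fun y hy => by rw [smul_lie, ha.2 y hy, smul_zero]⟩

/-- Property (P) for an `sl₂`-triple `(e, h, f)`: for every nonzero `v ∈ 𝔷(𝔤^e)`, the
eigenspace `𝔷_max` of the restriction of `ad h` to `𝔷(𝔤^e)` for its largest eigenvalue is
contained in `[[f, 𝔤^e], v] = {⁅⁅f, x⁆, v⁆ : x ∈ 𝔤^e}`. -/
def PropertyP (L : Type*) [LieRing L] [LieAlgebra ℂ L] (e h f : L) : Prop :=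
  ∀ m : ℂ,
    (∃ z : L, z ≠ 0 ∧ InCenterOfCentralizer L e z ∧ ⁅h, z⁆ = m • z) →
    (∀ m' : ℂ, (∃ z : L, z ≠ 0 ∧ InCenterOfCentralizer L e z ∧ ⁅h, z⁆ = m' • z) → m' ≤ m) →
    ∀ v : L, InCenterOfCentralizer L e v → v ≠ 0 →
      ∀ z : L, InCenterOfCentralizer L e z → ⁅h, z⁆ = m • z →
        ∃ x : L, ⁅x, e⁆ = 0 ∧ ⁅⁅f, x⁆, v⁆ = z

/-- The stabilizer `{x ∈ 𝔮 : ξ(⁅x, y⁆) = 0 for all y ∈ 𝔮}` of a linear functional `ξ`. -/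
def coadStab (Q : Type*) [LieRing Q] [LieAlgebra ℂ Q] (ξ : Module.Dual ℂ Q) : Submodule ℂ Q where
  carrier := {x : Q | ∀ y : Q, ξ ⁅x, y⁆ = 0}
  add_mem' := fun {a b} ha hb y => by rw [add_lie, map_add, ha y, hb y, add_zero]
  zero_mem' := fun y => by rw [zero_lie, map_zero]
  smul_mem' := fun c a ha y => by rw [smul_lie, map_smul, ha y, smul_zero]

/-- The index of a complex Lie algebra:
`ind 𝔮 = min_{ξ ∈ 𝔮*} dim {x ∈ 𝔮 : ξ(⁅x, y⁆) = 0 for all y ∈ 𝔮}`. -/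
noncomputable def lieIndex (Q : Type*) [LieRing Q] [LieAlgebra ℂ Q] : ℕ :=
  ⨅ ξ : Module.Dual ℂ Q, Module.finrank ℂ ↥(coadStab Q ξ)

/-- A nilpotent element `e` is distinguished if the only `x ∈ 𝔤^e` such that `ad x` is a
semisimple endomorphism of `𝔤` is `x = 0`. -/
def IsDistinguished (L : Type*) [LieRing L] [LieAlgebra ℂ L] (e : L) : Prop :=
  ∀ x : L, ⁅x, e⁆ = 0 → (LieAlgebra.ad ℂ L x).IsSemisimple → x = 0

namespace HahnQ
open Polynomial

variable {k : Type*} [Field k]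

/-- Hahn series with rational exponents supported in `[c, ∞)`. -/
def ge (k : Type*) [Field k] (c : ℚ) : AddSubgroup (HahnSeries ℚ k) where
  carrier := {f | ∀ q < c, f.coeff q = 0}
  add_mem' := fun {a b} ha hb q hq => by simp [ha q hq, hb q hq]
  zero_mem' := by simp
  neg_mem' := fun {a} ha q hq => by simp [ha q hq]

theorem mem_ge {c : ℚ} {f : HahnSeries ℚ k} : f ∈ ge k c ↔ ∀ q < c, f.coeff q = 0 := Iff.rfl

theorem mem_ge_iff {c : ℚ} {f : HahnSeries ℚ k} : f ∈ ge k c ↔ (c : WithTop ℚ) ≤ f.orderTop := by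
  rw [mem_ge, HahnSeries.le_orderTop_iff_forall]
  simp

theorem ge_anti {c d : ℚ} (h : c ≤ d) : ge k d ≤ ge k c :=
  fun _ hf q hq => hf q (hq.trans_le h)

theorem mul_mem_ge {c d : ℚ} {f g : HahnSeries ℚ k} (hf : f ∈ ge k c) (hg : g ∈ ge k d) :
    f * g ∈ ge k (c + d) := by
  rw [mem_ge_iff] at *
  rw [HahnSeries.orderTop_mul]
  push_cast
  exact add_le_add hf hg

theorem single_mem_ge (c : ℚ) (r : k) : HahnSeries.single c r ∈ ge k c := by
  intro q hq
  exact HahnSeries.coeff_single_of_ne hq.ne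

theorem C_mem_ge (r : k) : HahnSeries.C r ∈ ge k 0 := single_mem_ge 0 r

theorem one_mem_ge : (1 : HahnSeries ℚ k) ∈ ge k 0 := single_mem_ge 0 1

theorem eq_zero_of_forall_mem_ge {f : HahnSeries ℚ k} {ε : ℚ} (hε : 0 < ε)
    (h : ∀ n : ℕ, f ∈ ge k (n * ε)) : f = 0 := by
  ext q
  obtain ⟨n, hn⟩ := exists_nat_gt (q / ε)
  exact h n q ((div_lt_iff₀ hε).1 hn)

/-- Sequences of Hahn series whose consecutive differences have linearly growing order converge. -/
theorem exists_limit {ε : ℚ} (hε : 0 < ε) (a : ℕ → HahnSeries ℚ k)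
    (ha : ∀ n : ℕ, a (n + 1) - a n ∈ ge k (n * ε)) :
    ∃ l : HahnSeries ℚ k, ∀ n : ℕ, l - a n ∈ ge k (n * ε) := by
  have hmono : ∀ n m : ℕ, n ≤ m → a m - a n ∈ ge k (n * ε) := by
    intro n m hnm
    induction m, hnm using Nat.le_induction with
    | base => simp
    | succ m hm ih =>
      have h1 : a (m + 1) - a m ∈ ge k (n * ε) :=
        ge_anti (by gcongr) (ha m)
      have := add_mem h1 ih
      simpa using this
  let N : ℚ → ℕ := fun q => ⌈q / ε⌉₊ + 1
  have hN : ∀ q, q < N q * ε := by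
    intro q
    have : q / ε < N q := by
      have := Nat.le_ceil (q / ε)
      simp only [N]; push_cast; linarith
    exact (div_lt_iff₀ hε).1 this
  have key : ∀ (q : ℚ) (n : ℕ), q < n * ε → (a (N q)).coeff q = (a n).coeff q := by
    intro q n hq
    rcases le_total n (N q) with h | h
    · have := hmono _ _ h q hq
      simpa [sub_eq_zero] using this
    · have := hmono _ _ h q (hN q)
      exact (sub_eq_zero.1 (by simpa using this)).symm
  have hwf : (Function.support fun q => (a (N q)).coeff q).IsPWO := by
    rw [Set.isPWO_iff_isWF, Set.isWF_iff_no_descending_seq]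
    intro f hf hmem
    have h1 : ∀ i, (a (N (f 0))).coeff (f i) ≠ 0 := by
      intro i
      have hi := hmem i
      simp only [Function.mem_support] at hi
      rwa [key (f i) (N (f 0)) ((hf.antitone (Nat.zero_le i)).trans_lt (hN _))] at hi
    exact Set.isWF_iff_no_descending_seq.1 (a (N (f 0))).isWF_support f hf h1
  refine ⟨⟨_, hwf⟩, fun n q hq => ?_⟩
  simp [key q n hq]

/-- Polynomials whose coefficients are supported in `[c, ∞)`. -/
def pge (k : Type*) [Field k] (c : ℚ) : AddSubgroup (HahnSeries ℚ k)[X] where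
  carrier := {f | ∀ i, f.coeff i ∈ ge k c}
  add_mem' := fun {a b} ha hb i => by simpa using add_mem (ha i) (hb i)
  zero_mem' := by simp [zero_mem]
  neg_mem' := fun {a} ha i => by simpa using ha i

theorem pge_anti {c d : ℚ} (h : c ≤ d) : pge k d ≤ pge k c :=
  fun _ hf i => ge_anti h (hf i)

theorem mul_mem_pge {c d : ℚ} {f g : (HahnSeries ℚ k)[X]} (hf : f ∈ pge k c) (hg : g ∈ pge k d) :
    f * g ∈ pge k (c + d) := by
  intro i
  rw [coeff_mul]
  exact sum_mem fun p _ => mul_mem_ge (hf _) (hg _)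

theorem map_C_mem_pge (p : k[X]) : p.map HahnSeries.C ∈ pge k 0 := by
  intro i
  rw [coeff_map]
  exact C_mem_ge _

theorem modByMonic_mem_pge {c : ℚ} {f p : (HahnSeries ℚ k)[X]} (hf : f.Monic) (hf0 : f ∈ pge k 0)
    (hp : p ∈ pge k c) : p %ₘ f ∈ pge k c := by
  induction hn : p.natDegree using Nat.strong_induction_on generalizing p with
  | _ n ih =>
    by_cases hlt : p.degree < f.degree
    · rwa [(modByMonic_eq_self_iff hf).2 hlt]
    · by_cases hp0 : p = 0
      · simp [hp0, zero_mem]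
      have hle : f.degree ≤ p.degree := not_lt.1 hlt
      let r := C p.leadingCoeff * X ^ (p.natDegree - f.natDegree)
      have hr : r ∈ pge k c := by
        intro i
        simp only [r, coeff_C_mul, coeff_X_pow]
        split_ifs
        · rw [mul_one]; exact hp p.natDegree
        · simp [zero_mem]
      have hfr : f * r ∈ pge k c := by simpa using mul_mem_pge hf0 hr
      have hdeg : (p - f * r).degree < p.degree := by
        exact div_wf_lemma ⟨hle, hp0⟩ hf
      have hmod : p %ₘ f = (p - f * r) %ₘ f := by
        rw [sub_modByMonic, (modByMonic_eq_zero_iff_dvd hf).2 (dvd_mul_right f r), sub_zero]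
      rw [hmod]
      by_cases h0 : p - f * r = 0
      · rw [h0, zero_modByMonic]; exact zero_mem _
      exact ih _ (hn ▸ natDegree_lt_natDegree h0 hdeg) (sub_mem hp hfr) rfl

theorem eq_zero_of_forall_mem_pge {f : (HahnSeries ℚ k)[X]} {ε : ℚ} (hε : 0 < ε)
    (h : ∀ n : ℕ, f ∈ pge k (n * ε)) : f = 0 := by
  ext1 i
  exact eq_zero_of_forall_mem_ge hε fun n => h n i

theorem exists_limit_polynomial {ε : ℚ} (hε : 0 < ε) (a : ℕ → (HahnSeries ℚ k)[X]) {d : ℕ}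
    (hd : ∀ n, (a n).degree < d) (ha : ∀ n : ℕ, a (n + 1) - a n ∈ pge k (n * ε)) :
    ∃ l : (HahnSeries ℚ k)[X], l.degree < d ∧ ∀ n : ℕ, l - a n ∈ pge k (n * ε) := by
  choose l hl using fun i => exists_limit hε (fun n => (a n).coeff i)
    fun n => by simpa using ha n i
  refine ⟨∑ i ∈ Finset.range d, monomial i (l i), ?_, fun n i => ?_⟩
  · exact (degree_lt_iff_coeff_zero _ _).2 fun m hm => by
      simp [coeff_monomial, Nat.not_lt.2 hm]
  · by_cases hi : i < d
    · simpa [coeff_monomial, hi] using hl i n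
    · have : (a n).coeff i = 0 := (degree_lt_iff_coeff_zero _ _).1 (hd n) i (not_lt.1 hi)
      simp [coeff_monomial, hi, this, zero_mem]

/-- Polynomials whose remainder modulo `f` has coefficients supported in `[c, ∞)`. -/
noncomputable def remGe (f : (HahnSeries ℚ k)[X]) (c : ℚ) : AddSubgroup (HahnSeries ℚ k)[X] :=
  (pge k c).comap (modByMonicHom f).toAddMonoidHom

theorem mem_remGe {f x : (HahnSeries ℚ k)[X]} {c : ℚ} : x ∈ remGe f c ↔ x %ₘ f ∈ pge k c := Iff.rfl

theorem remGe_anti (f : (HahnSeries ℚ k)[X]) {c d : ℚ} (h : c ≤ d) : remGe f d ≤ remGe f c :=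
  fun _ hx => pge_anti h hx

theorem mul_mem_remGe {f x y : (HahnSeries ℚ k)[X]} {c d : ℚ} (hf : f.Monic) (hf0 : f ∈ pge k 0)
    (hx : x ∈ remGe f c) (hy : y ∈ remGe f d) : x * y ∈ remGe f (c + d) := by
  rw [mem_remGe] at *
  have : (x * y) %ₘ f = ((x %ₘ f) * (y %ₘ f)) %ₘ f := by
    rw [← sub_eq_zero, ← sub_modByMonic, modByMonic_eq_zero_iff_dvd hf]
    have e1 : f ∣ x %ₘ f - x := dvd_modByMonic_sub _ _
    have e2 : f ∣ y %ₘ f - y := dvd_modByMonic_sub _ _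
    have : x * y - (x %ₘ f) * (y %ₘ f)
        = -((x %ₘ f - x) * (y %ₘ f)) - x * (y %ₘ f - y) := by ring
    rw [this]
    exact dvd_sub (dvd_neg.2 (e1.mul_right _)) (e2.mul_left _)
  rw [this]
  exact modByMonic_mem_pge hf hf0 (mul_mem_pge hx hy)

/-- Idempotents modulo a monic irreducible polynomial lift along the valuation ring, hence an
approximate constant idempotent must be trivial. -/
theorem eq_zero_or_one_of_approx_idempotent {f : (HahnSeries ℚ k)[X]} (hf : f.Monic)
    (hirr : Irreducible f) (hf0 : f ∈ pge k 0) {ε : ℚ} (hε : 0 < ε) {p : k[X]}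
    (hdeg : p.degree < f.degree)
    (hp : (p.map (HahnSeries.C : k →+* HahnSeries ℚ k)) ^ 2 - p.map HahnSeries.C ∈ remGe f ε) :
    p = 0 ∨ p = 1 := by
  have hsub : ∀ {c : ℚ}, pge k c ≤ remGe f c := fun {c} _ hx => modByMonic_mem_pge hf hf0 hx
  let g : (HahnSeries ℚ k)[X] → (HahnSeries ℚ k)[X] := fun x => (3 * x ^ 2 - 2 * x ^ 3) %ₘ f
  let a : ℕ → (HahnSeries ℚ k)[X] := fun n => g^[n] (p.map HahnSeries.C)
  have ha0 : a 0 = p.map HahnSeries.C := rfl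
  have hsucc : ∀ n, a (n + 1) = g (a n) := fun n => Function.iterate_succ_apply' g n _
  have hadeg : ∀ n, (a n).degree < f.degree := by
    intro n
    cases n with
    | zero => exact degree_map_le.trans_lt hdeg
    | succ n => rw [hsucc]; exact degree_modByMonic_lt _ hf
  have hself : ∀ x : (HahnSeries ℚ k)[X], x.degree < f.degree → x %ₘ f = x := fun x hx =>
    (modByMonic_eq_self_iff hf).2 hx
  have one_mem : (1 : (HahnSeries ℚ k)[X]) ∈ remGe f 0 := by
    have := hsub (map_C_mem_pge (1 : k[X]))
    simpa using this
  have int_mem : ∀ (m : ℕ) {c : ℚ} {x : (HahnSeries ℚ k)[X]}, x ∈ remGe f c →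
      (m : (HahnSeries ℚ k)[X]) * x ∈ remGe f c := by
    intro m c x hx
    rw [← nsmul_eq_mul]
    exact nsmul_mem hx m
  have mul0 : ∀ {c : ℚ} {x y : (HahnSeries ℚ k)[X]}, x ∈ remGe f 0 → y ∈ remGe f c →
      x * y ∈ remGe f c := fun hx hy => by simpa using mul_mem_remGe hf hf0 hx hy
  have dvd_mem : ∀ {x : (HahnSeries ℚ k)[X]} {c : ℚ}, f ∣ x → x ∈ remGe f c := by
    intro x c hx
    rw [mem_remGe, (modByMonic_eq_zero_iff_dvd hf).2 hx]
    exact zero_mem _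
  have key : ∀ n : ℕ, a n ∈ remGe f 0 ∧ a n ^ 2 - a n ∈ remGe f ((n + 1 : ℕ) * ε) := by
    intro n
    induction n with
    | zero => exact ⟨hsub (map_C_mem_pge p), by simpa [ha0] using hp⟩
    | succ n ih =>
      obtain ⟨h0, h1⟩ := ih
      have h2 : a n ^ 2 ∈ remGe f 0 := by rw [sq]; exact mul0 h0 h0
      have h3 : a n ^ 3 ∈ remGe f 0 := by rw [pow_succ]; exact mul0 h2 h0
      have h4 : g (a n) - (3 * a n ^ 2 - 2 * a n ^ 3) ∈ remGe f 0 :=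
        dvd_mem (dvd_modByMonic_sub _ _)
      have h5 : a (n + 1) ∈ remGe f 0 := by
        have := add_mem h4 (sub_mem (int_mem 3 h2) (int_mem 2 h3))
        rw [hsucc]
        simpa using this
      refine ⟨h5, ?_⟩
      set δ := a n ^ 2 - a n with hδ
      have hδ0 : δ ∈ remGe f 0 := remGe_anti f (by positivity) h1
      have h6 : δ * (4 * δ - 3 * 1) ∈ remGe f ε := by
        have h4 : δ ∈ remGe f ε :=
          remGe_anti f (by push_cast; nlinarith [n.cast_nonneg (α := ℚ)]) h1
        rw [mul_comm]
        exact mul0 (sub_mem (int_mem 4 hδ0) (int_mem 3 one_mem)) h4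
      have h7 := mul_mem_remGe hf hf0 h1 h6
      have h8 : f ∣ (g (a n) ^ 2 - g (a n)) - δ * (δ * (4 * δ - 3 * 1)) := by
        have e1 : f ∣ g (a n) - (3 * a n ^ 2 - 2 * a n ^ 3) := dvd_modByMonic_sub _ _
        have : (g (a n) ^ 2 - g (a n)) - δ * (δ * (4 * δ - 3 * 1)) =
            (g (a n) - (3 * a n ^ 2 - 2 * a n ^ 3)) *
              (g (a n) + (3 * a n ^ 2 - 2 * a n ^ 3) - 1) := by
          rw [hδ]; ring
        rw [this]
        exact e1.mul_right _
      have := add_mem (dvd_mem h8) h7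
      rw [hsucc]
      convert this using 1
      · push_cast; ring_nf
      · ring
  have hstep : ∀ n : ℕ, a (n + 1) - a n ∈ pge k ((n + 1 : ℕ) * ε) := by
    intro n
    obtain ⟨h0, h1⟩ := key n
    have h2 := mul0 (sub_mem one_mem (int_mem 2 h0)) h1
    have h3 : f ∣ g (a n) - (3 * a n ^ 2 - 2 * a n ^ 3) := dvd_modByMonic_sub _ _
    have h4 := add_mem (dvd_mem h3) h2
    have h5 : a (n + 1) - a n ∈ remGe f ((n + 1 : ℕ) * ε) := by
      rw [hsucc]
      convert h4 using 1
      push_cast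
      ring
    rwa [mem_remGe, sub_modByMonic, hself _ (hadeg _), hself _ (hadeg _)] at h5
  obtain ⟨l, hldeg, hl⟩ := exists_limit_polynomial (d := f.natDegree) hε a
    (fun n => by rw [← degree_eq_natDegree hf.ne_zero]; exact hadeg n)
    (fun n => pge_anti (by push_cast; nlinarith) (hstep n))
  rw [← degree_eq_natDegree hf.ne_zero] at hldeg
  have hidem : f ∣ l ^ 2 - l := by
    rw [← modByMonic_eq_zero_iff_dvd hf]
    refine eq_zero_of_forall_mem_pge hε fun n => ?_
    rw [← mem_remGe]
    have h1 := hsub (hl n)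
    have h0 := (key n).1
    have h2 := remGe_anti f (c := n * ε) (by push_cast; nlinarith) (key n).2
    have hn0 : (0 : ℚ) ≤ n * ε := by positivity
    have h3 : l + a n - 1 ∈ remGe f 0 := by
      have := add_mem (remGe_anti f hn0 h1) (sub_mem (int_mem 2 h0) one_mem)
      convert this using 1
      push_cast; ring
    have := add_mem (mul0 h3 h1) h2
    convert this using 1
    ring
  have hcases : l = 0 ∨ l = 1 := by
    rw [show l ^ 2 - l = l * (l - 1) by ring] at hidem
    rcases hirr.prime.dvd_or_dvd hidem with h | h
    · exact Or.inl (eq_zero_of_dvd_of_degree_lt h hldeg)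
    · refine Or.inr (sub_eq_zero.1 (eq_zero_of_dvd_of_degree_lt h ?_))
      refine (degree_sub_le _ _).trans_lt (max_lt hldeg ?_)
      rw [degree_one]
      exact degree_pos_of_irreducible hirr
  have hclose : l - p.map HahnSeries.C ∈ pge k ε := by
    have h1 := hl 1
    have h2 := hstep 0
    have := add_mem h1 (by simpa using h2)
    simpa [ha0] using this
  have hconst : ∀ q : k[X], q.map (HahnSeries.C : k →+* HahnSeries ℚ k) ∈ pge k ε → q = 0 := by
    intro q hq
    ext i
    have := hq i 0 hε
    simpa [coeff_map, HahnSeries.C_apply] using this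
  rcases hcases with h | h
  · left
    refine hconst p ?_
    have := neg_mem hclose
    simpa [h] using this
  · right
    rw [← sub_eq_zero]
    refine hconst _ ?_
    have := neg_mem hclose
    simpa [h] using this

end HahnQ

namespace HahnQ
open Polynomial

variable {k : Type*} [Field k]

theorem exists_pos_mem_ge {x : HahnSeries ℚ k} (h : x ∈ ge k 0) (h0 : x.coeff 0 = 0) :
    ∃ ε : ℚ, 0 < ε ∧ x ∈ ge k ε := by
  by_cases hx : x = 0
  · exact ⟨1, one_pos, hx ▸ zero_mem _⟩
  · refine ⟨x.order, ?_, fun q hq => HahnSeries.coeff_eq_zero_of_lt_order hq⟩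
    by_contra! hle
    have hne : x.coeff x.order ≠ 0 := HahnSeries.coeff_order_eq_zero.not.2 hx
    rcases hle.lt_or_eq with hlt | heq
    · exact hne (h _ hlt)
    · exact hne (heq ▸ h0)

theorem exists_pos_forall_mem_ge {ι : Type*} (s : Finset ι) (x : ι → HahnSeries ℚ k)
    (h : ∀ i ∈ s, x i ∈ ge k 0) (h0 : ∀ i ∈ s, (x i).coeff 0 = 0) :
    ∃ ε : ℚ, 0 < ε ∧ ∀ i ∈ s, x i ∈ ge k ε := by
  classical
  induction s using Finset.induction_on with
  | empty => exact ⟨1, one_pos, by simp⟩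
  | insert a s ha ih =>
    obtain ⟨ε, hε, h1⟩ := ih (fun i hi => h i (by simp [hi])) (fun i hi => h0 i (by simp [hi]))
    obtain ⟨δ, hδ, h2⟩ := exists_pos_mem_ge (h a (by simp)) (h0 a (by simp))
    refine ⟨min ε δ, lt_min hε hδ, fun i hi => ?_⟩
    rcases Finset.mem_insert.1 hi with rfl | hi
    · exact ge_anti (min_le_right _ _) h2
    · exact ge_anti (min_le_left _ _) (h1 i hi)

/-- The reduction of a polynomial, taking constant terms of all coefficients. -/
noncomputable def red (f : (HahnSeries ℚ k)[X]) : k[X] :=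
  ∑ i ∈ Finset.range (f.natDegree + 1), monomial i ((f.coeff i).coeff 0)

theorem coeff_red (f : (HahnSeries ℚ k)[X]) (i : ℕ) : (red f).coeff i = (f.coeff i).coeff 0 := by
  by_cases hi : i < f.natDegree + 1
  · simp [red, coeff_monomial]
    intro h; omega
  · simp [red, coeff_monomial]
    intro h
    rw [coeff_eq_zero_of_natDegree_lt (by omega)]; simp

theorem red_monic {f : (HahnSeries ℚ k)[X]} (hf : f.Monic) : (red f).Monic := by
  apply monic_of_natDegree_le_of_coeff_eq_one f.natDegree
  · rw [natDegree_le_iff_coeff_eq_zero]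
    intro N hN
    rw [coeff_red, coeff_eq_zero_of_natDegree_lt hN]; simp
  · rw [coeff_red, hf.coeff_natDegree]; simp [HahnSeries.coeff_one]

theorem natDegree_red {f : (HahnSeries ℚ k)[X]} (hf : f.Monic) :
    (red f).natDegree = f.natDegree := by
  apply le_antisymm
  · rw [natDegree_le_iff_coeff_eq_zero]
    intro N hN
    rw [coeff_red, coeff_eq_zero_of_natDegree_lt hN]; simp
  · apply le_natDegree_of_ne_zero
    rw [coeff_red, hf.coeff_natDegree]; simp [HahnSeries.coeff_one]

theorem exists_sub_red_mem {f : (HahnSeries ℚ k)[X]} (hf0 : f ∈ pge k 0) :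
    ∃ ε : ℚ, 0 < ε ∧ (red f).map HahnSeries.C - f ∈ pge k ε := by
  obtain ⟨ε, hε, h⟩ := exists_pos_forall_mem_ge (Finset.range (f.natDegree + 1))
    (fun i => ((red f).map (HahnSeries.C : k →+* HahnSeries ℚ k) - f).coeff i)
    (fun i _ => sub_mem (map_C_mem_pge (red f)) hf0 i)
    (fun i _ => by simp [coeff_red, HahnSeries.C_apply])
  refine ⟨ε, hε, fun i => ?_⟩
  by_cases hi : i < f.natDegree + 1
  · exact h i (by simpa using hi)
  · have h1 : f.coeff i = 0 := coeff_eq_zero_of_natDegree_lt (by omega)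
    have : ((red f).map (HahnSeries.C : k →+* HahnSeries ℚ k) - f).coeff i = 0 := by
      simp [coeff_red, h1]
    rw [this]; exact zero_mem _

theorem not_coprime_factorization {f : (HahnSeries ℚ k)[X]} (hf : f.Monic)
    (hirr : Irreducible f) (hf0 : f ∈ pge k 0) {g h : k[X]} (hgh : red f = g * h)
    (hco : IsCoprime g h) : IsUnit g ∨ IsUnit h := by
  obtain ⟨u, v, huv⟩ := hco
  have hrm := red_monic hf
  obtain ⟨ε, hε, hmem⟩ := exists_sub_red_mem hf0
  have hg : (u * g) %ₘ (red f) = 0 ∨ (u * g) %ₘ (red f) = 1 := by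
    refine eq_zero_or_one_of_approx_idempotent hf hirr hf0 hε ?_ ?_
    · refine (degree_modByMonic_lt _ hrm).trans_le ?_
      rw [degree_eq_natDegree hf.ne_zero, degree_eq_natDegree hrm.ne_zero, natDegree_red hf]
    · have h1 : red f ∣ ((u * g) %ₘ (red f)) ^ 2 - (u * g) %ₘ (red f) := by
        have e : red f ∣ (u * g) %ₘ (red f) - u * g := dvd_modByMonic_sub _ _
        have e2 : (u * g) ^ 2 - u * g = - (u * v) * (g * h) := by
          linear_combination (u * g) * huv
        have : ((u * g) %ₘ (red f)) ^ 2 - (u * g) %ₘ (red f) =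
          ((u * g) %ₘ (red f) - u * g) * ((u * g) %ₘ (red f) + u * g - 1) +
            ((u * g) ^ 2 - u * g) := by ring
        rw [this, e2, ← hgh]
        exact dvd_add (e.mul_right _) (Dvd.intro_left _ rfl)
      obtain ⟨w, hw⟩ := h1
      rw [← Polynomial.map_pow, ← Polynomial.map_sub, hw, Polynomial.map_mul]
      have h2 : f * w.map HahnSeries.C ∈ remGe f ε := by
        rw [mem_remGe, (modByMonic_eq_zero_iff_dvd hf).2 (dvd_mul_right _ _)]
        exact zero_mem _
      have h3 : ((red f).map HahnSeries.C - f) * w.map HahnSeries.C ∈ remGe f ε :=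
        modByMonic_mem_pge hf hf0 (by simpa using mul_mem_pge hmem (map_C_mem_pge w))
      have := add_mem h2 h3
      convert this using 1
      ring
  rcases hg with h0 | h0
  · right
    rw [modByMonic_eq_zero_iff_dvd hrm, hgh] at h0
    have : h ∣ 1 := by
      rw [← huv]
      exact dvd_add ((dvd_mul_left h g).trans h0) (dvd_mul_left _ _)
    exact isUnit_of_dvd_one this
  · left
    have e : red f ∣ (u * g) %ₘ (red f) - u * g := dvd_modByMonic_sub _ _
    rw [h0, hgh] at e
    have : g ∣ 1 := by
      have := dvd_add ((dvd_mul_right g h).trans e) (dvd_mul_left g u)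
      simpa using this
    exact isUnit_of_dvd_one this

/-- Over an algebraically closed residue field the reduction of an irreducible integral monic
polynomial is a power of a linear polynomial. -/
theorem red_eq_pow [IsAlgClosed k] {f : (HahnSeries ℚ k)[X]} (hf : f.Monic)
    (hirr : Irreducible f) (hf0 : f ∈ pge k 0) :
    ∃ c : k, red f = (X - C c) ^ f.natDegree := by
  have hrm := red_monic hf
  have hdeg : (red f).degree ≠ 0 := by
    rw [degree_eq_natDegree hrm.ne_zero, natDegree_red hf]
    have := hirr.natDegree_pos
    exact_mod_cast this.ne'
  obtain ⟨c, hc⟩ := IsAlgClosed.exists_root _ hdeg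
  refine ⟨c, ?_⟩
  obtain ⟨q, hq, hnd⟩ := exists_eq_pow_rootMultiplicity_mul_and_not_dvd (red f) hrm.ne_zero c
  have hm : (red f).rootMultiplicity c ≠ 0 := by
    rw [← Nat.pos_iff_ne_zero, rootMultiplicity_pos hrm.ne_zero]; exact hc
  have hco : IsCoprime ((X - C c) ^ (red f).rootMultiplicity c) q :=
    ((irreducible_X_sub_C c).coprime_iff_not_dvd.2 hnd).pow_left
  rcases not_coprime_factorization hf hirr hf0 hq hco with h | h
  · rw [isUnit_pow_iff hm] at h
    exact absurd h (not_isUnit_X_sub_C c)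
  · have hqm : q.Monic := by
      rw [hq] at hrm
      exact ((monic_X_sub_C c).pow _).of_mul_monic_left hrm
    have hq1 : q = 1 := hqm.eq_one_of_isUnit h
    rw [hq1, mul_one] at hq
    have := natDegree_red hf
    rw [hq, natDegree_pow, natDegree_X_sub_C, mul_one] at this
    rw [← this]; exact hq

theorem not_irreducible_of_depressed [IsAlgClosed k] [CharZero k] {f : (HahnSeries ℚ k)[X]}
    (hf : f.Monic) (hn : 2 ≤ f.natDegree) (hf0 : f ∈ pge k 0)
    (hdep : f.coeff (f.natDegree - 1) = 0) (hne : ∃ i < f.natDegree, (f.coeff i).coeff 0 ≠ 0) :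
    ¬ Irreducible f := by
  intro hirr
  obtain ⟨c, hc⟩ := red_eq_pow hf hirr hf0
  have h1 : (red f).coeff (f.natDegree - 1) = 0 := by rw [coeff_red, hdep]; simp
  have hc0 : c = 0 := by
    rw [hc, sub_eq_add_neg, ← C_neg, coeff_X_add_C_pow] at h1
    have e1 : f.natDegree - (f.natDegree - 1) = 1 := by omega
    have e2 : f.natDegree.choose (f.natDegree - 1) ≠ 0 := (Nat.choose_pos (by omega)).ne'
    rw [e1, pow_one] at h1
    have e3 : ((f.natDegree.choose (f.natDegree - 1) : ℕ) : k) ≠ 0 := by exact_mod_cast e2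
    simpa [e3] using h1
  obtain ⟨i, hi, hi0⟩ := hne
  rw [← coeff_red, hc, hc0] at hi0
  simp [coeff_X_pow] at hi0
  omega

theorem irreducible_scaleRoots {F : Type*} [Field F] {f : F[X]} (hirr : Irreducible f) {s : F}
    (hs : s ≠ 0) : Irreducible (scaleRoots f s) := by
  let _ : Invertible s⁻¹ := invertibleOfNonzero (inv_ne_zero hs)
  have h1 : Irreducible (algEquivCMulXAddC s⁻¹ 0 f) :=
    (MulEquiv.irreducible_iff (algEquivCMulXAddC s⁻¹ (0 : F))).2 hirr
  have h2 : scaleRoots f s = C (s ^ f.natDegree) * algEquivCMulXAddC s⁻¹ 0 f := by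
    ext i
    have : algEquivCMulXAddC s⁻¹ 0 f = f.comp (C s⁻¹ * X) := by
      simp [comp, aeval_def]
    rw [this, coeff_C_mul, comp_C_mul_X_coeff, coeff_scaleRoots]
    by_cases hi : i ≤ f.natDegree
    · have : s ^ f.natDegree * s⁻¹ ^ i = s ^ (f.natDegree - i) := by
        rw [inv_pow, ← pow_sub₀ _ hs hi]
      rw [← this]; ring
    · rw [coeff_eq_zero_of_natDegree_lt (by omega)]; simp
  rw [h2]
  have hu : IsUnit (C (s ^ f.natDegree)) := isUnit_C.2 (pow_ne_zero _ hs).isUnit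
  exact (irreducible_isUnit_mul hu).2 h1

theorem exists_depressed {F : Type*} [Field F] [CharZero F] {f : F[X]} (hf : f.Monic)
    (hirr : Irreducible f) (hn : 2 ≤ f.natDegree) :
    ∃ g : F[X], g.Monic ∧ Irreducible g ∧ g.natDegree = f.natDegree ∧
      g.coeff (g.natDegree - 1) = 0 := by
  set n := f.natDegree with hndef
  let b : F := - f.coeff (n - 1) / n
  have hn0 : (n : F) ≠ 0 := by exact_mod_cast (by omega : n ≠ 0)
  refine ⟨taylor b f, ?_, ?_, natDegree_taylor f b, ?_⟩
  · rw [Monic, leadingCoeff_taylor]; exact hf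
  · exact (MulEquiv.irreducible_iff (taylorEquiv b)).2 hirr
  · rw [natDegree_taylor, taylor_coeff, eval_eq_sum_range' (n := 2)
      ((natDegree_hasseDeriv_le _ _).trans_lt (by omega))]
    have e : 1 + (n - 1) = n := by omega
    have e' : n.choose (n - 1) = n := by
      rw [Nat.choose_symm (by omega : 1 ≤ n), Nat.choose_one_right]
    simp only [Finset.sum_range_succ, Finset.sum_range_zero, hasseDeriv_coeff, ← hndef, e, e',
      zero_add, Nat.choose_self]
    have : f.coeff n = 1 := hf.coeff_natDegree
    rw [this]
    simp only [b]
    field_simp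
    ring

/-- Hahn series with rational exponents over an algebraically closed field of characteristic
zero form an algebraically closed field. -/
instance [IsAlgClosed k] [CharZero k] : IsAlgClosed (HahnSeries ℚ k) := by
  classical
  have : CharZero (HahnSeries ℚ k) := charZero_of_injective_ringHom HahnSeries.C_injective
  refine IsAlgClosed.of_exists_root _ fun f hf hirr => ?_
  by_cases hn : f.natDegree ≤ 1
  · exact exists_root_of_degree_eq_one (by
      rw [degree_eq_natDegree hf.ne_zero]
      have := hirr.natDegree_pos
      exact_mod_cast (by omega : f.natDegree = 1))
  exfalso
  obtain ⟨g, hg, hgirr, hdeg, hdep⟩ := exists_depressed hf hirr (by omega)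
  have hn2 : 2 ≤ g.natDegree := by omega
  set n := g.natDegree with hndef
  let S := (Finset.range n).filter fun i => g.coeff i ≠ 0
  have hS : S.Nonempty := by
    by_contra! hS
    have h0 : ∀ i < n, g.coeff i = 0 := by
      intro i hi
      by_contra h
      have : i ∈ S := by simp [S, hi, h]
      simp [hS] at this
    have hX : g = X ^ n := by
      ext1 i
      rw [coeff_X_pow]
      rcases lt_trichotomy i n with h | h | h
      · rw [h0 i h, if_neg h.ne]
      · rw [h, if_pos rfl]; exact hg.coeff_natDegree
      · rw [if_neg h.ne', coeff_eq_zero_of_natDegree_lt h]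
    have hgirr' := hgirr
    rw [hX] at hgirr'
    have := hgirr'.isUnit_or_isUnit (a := X) (b := X ^ (n - 1)) (by
      rw [← pow_succ', Nat.sub_add_cancel (by omega)])
    rcases this with h | h
    · exact not_isUnit_X h
    · rw [isUnit_pow_iff (by omega)] at h
      exact not_isUnit_X h
  obtain ⟨i, hi, hmin⟩ := S.exists_min_image
    (fun i => (g.coeff i).order / ((n - i : ℕ) : ℚ)) hS
  simp only [S, Finset.mem_filter, Finset.mem_range] at hi hmin
  set q := (g.coeff i).order / ((n - i : ℕ) : ℚ) with hq
  let s : HahnSeries ℚ k := HahnSeries.single (-q) 1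
  have hs : s ≠ 0 := HahnSeries.single_ne_zero one_ne_zero
  have hsp : ∀ j : ℕ, s ^ j = HahnSeries.single (-(j * q)) 1 := by
    intro j
    simp [s, HahnSeries.single_pow]
  have hcoef : ∀ (j : ℕ) (r : ℚ),
      ((scaleRoots g s).coeff j).coeff r = (g.coeff j).coeff (r + (n - j : ℕ) * q) := by
    intro j r
    rw [coeff_scaleRoots, hsp, HahnSeries.coeff_mul_single]
    simp [hndef]
  refine not_irreducible_of_depressed (f := scaleRoots g s) ((monic_scaleRoots_iff s).2 hg) ?_ ?_ ?_
    ?_ (irreducible_scaleRoots hgirr hs)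
  · rwa [natDegree_scaleRoots]
  · intro j r hr
    rw [hcoef]
    by_cases hj : j < n
    · by_cases hj0 : g.coeff j = 0
      · simp [hj0]
      apply HahnSeries.coeff_eq_zero_of_lt_order
      have hpos : (0 : ℚ) < (n - j : ℕ) := by exact_mod_cast (by omega : 0 < n - j)
      have := hmin j ⟨hj, hj0⟩
      rw [le_div_iff₀ hpos] at this
      linarith
    · rcases (not_lt.1 hj).lt_or_eq with h | h
      · rw [coeff_eq_zero_of_natDegree_lt h]; simp
      · have hl : g.coeff j = 1 := by rw [← h]; exact hg.coeff_natDegree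
        rw [hl, ← h]
        simp [HahnSeries.coeff_one, hr.ne]
  · rw [natDegree_scaleRoots, coeff_scaleRoots, hdep, zero_mul]
  · refine ⟨i, by rw [natDegree_scaleRoots]; exact hi.1, ?_⟩
    rw [hcoef]
    have hpos : (0 : ℚ) < (n - i : ℕ) := by exact_mod_cast (by omega : 0 < n - i)
    have : 0 + (n - i : ℕ) * q = (g.coeff i).order := by
      rw [hq]; field_simp; ring
    rw [this]
    exact HahnSeries.coeff_order_eq_zero.not.2 hi.2

end HahnQ

namespace HahnQ
open Polynomial

variable {k : Type*} [Field k]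

/-- Hahn series with rational exponents and strictly positive support. -/
def pos (k : Type*) [Field k] : AddSubgroup (HahnSeries ℚ k) where
  carrier := {f | ∀ q ≤ 0, f.coeff q = 0}
  add_mem' := fun {a b} ha hb q hq => by simp [ha q hq, hb q hq]
  zero_mem' := by simp
  neg_mem' := fun {a} ha q hq => by simp [ha q hq]

theorem mem_pos_iff {f : HahnSeries ℚ k} : f ∈ pos k ↔ ∃ ε : ℚ, 0 < ε ∧ f ∈ ge k ε := by
  refine ⟨fun h => exists_pos_mem_ge (fun q hq => h q hq.le) (h 0 le_rfl), ?_⟩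
  rintro ⟨ε, hε, h⟩ q hq
  exact h q (hq.trans_lt hε)

theorem mem_pos_of_mem_ge {f : HahnSeries ℚ k} {ε : ℚ} (hε : 0 < ε) (h : f ∈ ge k ε) : f ∈ pos k :=
  mem_pos_iff.2 ⟨ε, hε, h⟩

theorem pos_le_ge : pos k ≤ ge k 0 := fun _ h q hq => h q hq.le

theorem mul_mem_ge_zero {f g : HahnSeries ℚ k} (hf : f ∈ ge k 0) (hg : g ∈ ge k 0) :
    f * g ∈ ge k 0 := by simpa using mul_mem_ge hf hg

theorem mul_mem_pos_left {f g : HahnSeries ℚ k} (hf : f ∈ pos k) (hg : g ∈ ge k 0) :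
    f * g ∈ pos k := by
  obtain ⟨ε, hε, h⟩ := mem_pos_iff.1 hf
  exact mem_pos_of_mem_ge hε (by simpa using mul_mem_ge h hg)

theorem mul_mem_pos_right {f g : HahnSeries ℚ k} (hf : f ∈ ge k 0) (hg : g ∈ pos k) :
    f * g ∈ pos k := mul_comm g f ▸ mul_mem_pos_left hg hf

theorem mem_ge_order (f : HahnSeries ℚ k) : f ∈ ge k f.order :=
  fun _ hq => HahnSeries.coeff_eq_zero_of_lt_order hq

theorem order_inv' {f : HahnSeries ℚ k} (hf : f ≠ 0) : f⁻¹.order = -f.order := by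
  have h := HahnSeries.order_mul hf (inv_ne_zero hf)
  rw [mul_inv_cancel₀ hf, HahnSeries.order_one] at h
  linarith

theorem div_mem_ge_zero {f g : HahnSeries ℚ k} (hg : g ≠ 0) (h : f ∈ ge k g.order) :
    f / g ∈ ge k 0 := by
  have := mul_mem_ge h (mem_ge_order g⁻¹)
  rw [order_inv' hg] at this
  simpa [div_eq_mul_inv] using this

/-- Matrices with integral entries. -/
def mge (k : Type*) [Field k] (n : ℕ) : Subring (Matrix (Fin n) (Fin n) (HahnSeries ℚ k)) where
  carrier := {M | ∀ i j, M i j ∈ ge k 0}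
  add_mem' := fun {a b} ha hb i j => add_mem (ha i j) (hb i j)
  zero_mem' := fun _ _ => zero_mem _
  neg_mem' := fun {a} ha i j => neg_mem (ha i j)
  mul_mem' := fun {a b} ha hb i j => by
    rw [Matrix.mul_apply]
    exact sum_mem fun l _ => mul_mem_ge_zero (ha _ _) (hb _ _)
  one_mem' := fun i j => by
    rw [Matrix.one_apply]
    split_ifs
    · exact one_mem_ge
    · exact zero_mem _

/-- Matrices with topologically nilpotent entries. -/
def mpos (k : Type*) [Field k] (n : ℕ) : AddSubgroup (Matrix (Fin n) (Fin n) (HahnSeries ℚ k)) where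
  carrier := {M | ∀ i j, M i j ∈ pos k}
  add_mem' := fun ha hb i j => add_mem (ha i j) (hb i j)
  zero_mem' := fun _ _ => zero_mem _
  neg_mem' := fun ha i j => neg_mem (ha i j)

section matrices
variable {n : ℕ}

local notation "Mat" => Matrix (Fin n) (Fin n) (HahnSeries ℚ k)

theorem mul_mem_mpos_left {A B : Mat} (hA : A ∈ mpos k n) (hB : B ∈ mge k n) : A * B ∈ mpos k n := by
  intro i j
  rw [Matrix.mul_apply]
  exact sum_mem fun l _ => mul_mem_pos_left (hA _ _) (hB _ _)

theorem mul_mem_mpos_right {A B : Mat} (hA : A ∈ mge k n) (hB : B ∈ mpos k n) :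
    A * B ∈ mpos k n := by
  intro i j
  rw [Matrix.mul_apply]
  exact sum_mem fun l _ => mul_mem_pos_right (hA _ _) (hB _ _)

theorem trace_mem_pos {A : Mat} (hA : A ∈ mpos k n) : A.trace ∈ pos k :=
  sum_mem fun i _ => hA i i

theorem toMatrix_perm_mem_mge (σ : Equiv.Perm (Fin n)) : (σ.toPEquiv.toMatrix : Mat) ∈ mge k n := by
  intro i j
  rw [PEquiv.toMatrix_apply]
  split_ifs
  · exact one_mem_ge
  · exact zero_mem _

theorem exists_elimination_step (M : Mat) (j : Fin n)
    (hM : ∀ a b : Fin n, b < j → b < a → M a b = 0) :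
    ∃ P Q : Mat, P ∈ mge k n ∧ Q ∈ mge k n ∧ P * Q = 1 ∧
      ∀ a b : Fin n, b ≤ j → b < a → (P * M) a b = 0 := by
  by_cases hz : ∀ a, j ≤ a → M a j = 0
  · refine ⟨1, 1, one_mem _, one_mem _, one_mul _, fun a b hb hab => ?_⟩
    rw [one_mul]
    rcases hb.lt_or_eq with h | rfl
    · exact hM a b h hab
    · exact hz a hab.le
  push Not at hz
  classical
  obtain ⟨p, hp, hmin⟩ := (Finset.univ.filter fun a => j ≤ a ∧ M a j ≠ 0).exists_min_image
    (fun a => (M a j).order) (by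
      obtain ⟨a, ha⟩ := hz
      exact ⟨a, by simpa using ha⟩)
  simp only [Finset.mem_filter, Finset.mem_univ, true_and] at hp hmin
  let σ : Equiv.Perm (Fin n) := Equiv.swap j p
  let N : Mat := M.submatrix σ id
  have hNj : N j j = M p j := by simp [N, σ]
  have hNz : ∀ a b : Fin n, b < j → b < a → N a b = 0 := by
    intro a b hb hab
    refine hM _ _ hb ?_
    simp only [σ, Equiv.swap_apply_def]
    split_ifs with h1 h2
    · exact hb.trans_le hp.1
    · exact hb
    · exact hab
  let l : Fin n → HahnSeries ℚ k := fun a => if j < a then N a j / N j j else 0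
  have hl : ∀ a, l a ∈ ge k 0 := by
    intro a
    simp only [l]
    split_ifs with h
    · refine div_mem_ge_zero (by rw [hNj]; exact hp.2) ?_
      by_cases h0 : N a j = 0
      · rw [h0]; exact zero_mem _
      · refine ge_anti ?_ (mem_ge_order (N a j))
        rw [hNj]
        refine hmin _ ⟨?_, h0⟩
        simp only [σ, Equiv.swap_apply_def]
        split_ifs
        · exact hp.1
        · exact le_rfl
        · exact h.le
    · exact zero_mem _
  let T : Mat := Matrix.vecMulVec l (Pi.single j 1)
  have hT : T ∈ mge k n := by
    intro a b
    simp only [T, Matrix.vecMulVec_apply, Pi.single_apply]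
    split_ifs
    · simpa using hl a
    · simp [zero_mem]
  have hTT : T * T = 0 := by
    simp only [T, Matrix.vecMulVec_mul_vecMulVec]
    have : (Pi.single j (1 : HahnSeries ℚ k) : Fin n → HahnSeries ℚ k) ⬝ᵥ l = 0 := by
      simp [l]
    simp [this]
  let S : Mat := σ.toPEquiv.toMatrix
  have hS : S * M = N := by
    simp [S, N, PEquiv.toMatrix_toPEquiv_mul]
  have hSS : S * S = 1 := by
    ext a b
    simp only [S, PEquiv.toMatrix_toPEquiv_mul, Matrix.submatrix_apply, id, σ,
      PEquiv.toMatrix_apply, Equiv.toPEquiv_apply, Matrix.one_apply]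
    simp [Equiv.swap_apply_self]
  refine ⟨(1 - T) * S, S * (1 + T), mul_mem (sub_mem (one_mem _) hT) (toMatrix_perm_mem_mge σ),
    mul_mem (toMatrix_perm_mem_mge σ) (add_mem (one_mem _) hT), ?_, fun a b hb hab => ?_⟩
  · calc (1 - T) * S * (S * (1 + T)) = (1 - T) * (S * S) * (1 + T) := by noncomm_ring
      _ = 1 - T * T := by rw [hSS]; noncomm_ring
      _ = 1 := by rw [hTT, sub_zero]
  · rw [Matrix.mul_assoc, hS, Matrix.sub_mul, Matrix.one_mul, Matrix.sub_apply]
    have : (T * N) a b = l a * N j b := by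
      simp [T, Matrix.mul_apply, Matrix.vecMulVec_apply, Pi.single_apply]
    rw [this]
    rcases hb.lt_or_eq with h | rfl
    · rw [hNz a b h hab, hNz j b h h, mul_zero, sub_zero]
    · have : N b b ≠ 0 := by rw [hNj]; exact hp.2
      simp only [l, if_pos hab]
      field_simp
      ring

/-- Iwasawa-type decomposition over Hahn series. -/
theorem exists_integral_upperTriangular (M : Mat) :
    ∃ P Q : Mat, P ∈ mge k n ∧ Q ∈ mge k n ∧ P * Q = 1 ∧ (P * M).BlockTriangular id := by
  have key : ∀ j : ℕ, j ≤ n → ∃ P Q : Mat, P ∈ mge k n ∧ Q ∈ mge k n ∧ P * Q = 1 ∧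
      ∀ a b : Fin n, b.val < j → b < a → (P * M) a b = 0 := by
    intro j
    induction j with
    | zero => exact fun _ => ⟨1, 1, one_mem _, one_mem _, one_mul _, fun a b hb => by omega⟩
    | succ j ih =>
      intro hj
      obtain ⟨P, Q, hP, hQ, hPQ, h⟩ := ih (by omega)
      obtain ⟨P', Q', hP', hQ', hPQ', h'⟩ := exists_elimination_step (P * M) ⟨j, hj⟩
        (fun a b hb hab => h a b hb hab)
      refine ⟨P' * P, Q * Q', mul_mem hP' hP, mul_mem hQ hQ', ?_, fun a b hb hab => ?_⟩
      · rw [mul_assoc, ← mul_assoc P, hPQ, one_mul, hPQ']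
      · rw [mul_assoc]
        exact h' a b (Nat.le_of_lt_succ hb) hab
  obtain ⟨P, Q, hP, hQ, hPQ, h⟩ := key n le_rfl
  exact ⟨P, Q, hP, hQ, hPQ, fun a b hab => h a b b.2 hab⟩

end matrices

end HahnQ

namespace HahnQ
open Polynomial

section mapDeriv
variable {R F : Type*} [CommRing R] [Field F] [Algebra R F] {m n p : ℕ}

theorem map_mul_derivation (D : Derivation R F F) (A : Matrix (Fin m) (Fin n) F)
    (B : Matrix (Fin n) (Fin p) F) : (A * B).map D = A.map D * B + A * B.map D := by
  ext i j
  simp only [Matrix.map_apply, Matrix.mul_apply, map_sum, Derivation.leibniz, smul_eq_mul,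
    Matrix.add_apply, ← Finset.sum_add_distrib]
  exact Finset.sum_congr rfl fun l _ => by ring

theorem map_one_derivation (D : Derivation R F F) : (1 : Matrix (Fin n) (Fin n) F).map D = 0 := by
  ext i j
  simp only [Matrix.map_apply, Matrix.one_apply]
  split_ifs <;> simp

theorem trace_map_derivation (D : Derivation R F F) (A : Matrix (Fin n) (Fin n) F) :
    (A.map D).trace = D A.trace := by
  simp [Matrix.trace]

theorem map_inv_derivation (D : Derivation R F F) {A B : Matrix (Fin n) (Fin n) F}
    (h : A * B = 1) : B.map D = - (B * A.map D * B) := by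
  have h' : B * A = 1 := mul_eq_one_comm.1 h
  have h1 := congrArg (fun M => M.map D) h
  simp only [map_mul_derivation, map_one_derivation] at h1
  have h2 : B * (A.map D * B + A * B.map D) = 0 := by rw [h1, mul_zero]
  rw [mul_add, ← mul_assoc B A, h', one_mul, ← mul_assoc] at h2
  exact (neg_eq_of_add_eq_zero_right h2).symm

end mapDeriv

variable {k : Type*} [Field k] {R : Type*} [CommRing R] [Algebra R (HahnSeries ℚ k)] {n : ℕ}

local notation "Ω" => HahnSeries ℚ k
local notation "Mat" => Matrix (Fin n) (Fin n) (HahnSeries ℚ k)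

/-- Derivations of Hahn series that do not decrease the order. -/
def IsFiltered (D : Derivation R Ω Ω) : Prop := ∀ (c : ℚ) (f : Ω), f ∈ ge k c → D f ∈ ge k c

theorem IsFiltered.pos {D : Derivation R Ω Ω} (hD : IsFiltered D) {f : Ω} (hf : f ∈ pos k) :
    D f ∈ pos k := by
  obtain ⟨ε, hε, h⟩ := mem_pos_iff.1 hf
  exact mem_pos_of_mem_ge hε (hD _ _ h)

theorem IsFiltered.lie {D D' : Derivation R Ω Ω} (hD : IsFiltered D) (hD' : IsFiltered D') :
    IsFiltered ⁅D, D'⁆ := by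
  intro c f hf
  rw [Derivation.commutator_apply]
  exact sub_mem (hD _ _ (hD' _ _ hf)) (hD' _ _ (hD _ _ hf))

theorem IsFiltered.inv_mul {D : Derivation R Ω Ω} (hD : IsFiltered D) (f : Ω) :
    f⁻¹ * D f ∈ ge k 0 := by
  by_cases hf : f = 0
  · simp [hf, zero_mem]
  · have := div_mem_ge_zero hf (hD _ _ (mem_ge_order f))
    rwa [div_eq_inv_mul] at this

theorem blockTriangular_mul_diag {A B : Mat} (hA : A.BlockTriangular id)
    (hB : B.BlockTriangular id) (i : Fin n) : (A * B) i i = A i i * B i i := by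
  rw [Matrix.mul_apply]
  refine Finset.sum_eq_single i (fun j _ hj => ?_) (by simp)
  rcases lt_or_gt_of_ne hj with h | h
  · rw [hA h, zero_mul]
  · rw [hB h, mul_zero]

theorem trace_logDerivative_mem_pos {D : Derivation R Ω Ω} (hD : IsFiltered D)
    {K K' : Mat} (hK : K * K' = 1) {τ : Fin n → Ω}
    (hΓ : K * Matrix.diagonal τ * K' ∈ mpos k n) :
    (Matrix.diagonal τ * (K' * K.map D)).trace ∈ pos k := by
  have hK' : K' * K = 1 := mul_eq_one_comm.1 hK
  obtain ⟨P, Q, hP, hQ, hPQ, htri⟩ := exists_integral_upperTriangular K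
  have hQP : Q * P = 1 := mul_eq_one_comm.1 hPQ
  set b := P * K with hb
  set b' := K' * Q with hb'
  have hbb' : b * b' = 1 := by
    rw [hb, hb', mul_assoc, ← mul_assoc K, hK, one_mul, hPQ]
  have hb'b : b' * b = 1 := mul_eq_one_comm.1 hbb'
  have htri' : b'.BlockTriangular id := by
    let _ : Invertible b := invertibleOfRightInverse b b' hbb'
    have := Matrix.blockTriangular_inv_of_blockTriangular htri
    rwa [Matrix.inv_eq_right_inv hbb'] at this
  have hdiag : ∀ i, b i i * b' i i = 1 := by
    intro i
    rw [← blockTriangular_mul_diag htri htri' i, hbb', Matrix.one_apply_eq]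
  have hKb : K = Q * b := by rw [hb, ← mul_assoc, hQP, one_mul]
  have hK'b : K' = b' * P := by rw [hb', mul_assoc, hQP, mul_one]
  have hconj : b * Matrix.diagonal τ * b' ∈ mpos k n := by
    have : b * Matrix.diagonal τ * b' = P * (K * Matrix.diagonal τ * K') * Q := by
      rw [hb, hb']; simp only [mul_assoc]
    rw [this]
    exact mul_mem_mpos_left (mul_mem_mpos_right hP hΓ) hQ
  have hτ : ∀ i, τ i ∈ pos k := by
    intro i
    have h1 := hconj i i
    rw [blockTriangular_mul_diag (htri.mul (Matrix.blockTriangular_diagonal τ)) htri',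
      blockTriangular_mul_diag htri (Matrix.blockTriangular_diagonal τ),
      Matrix.diagonal_apply_eq, mul_right_comm, hdiag, one_mul] at h1
    exact h1
  have hexp : (Matrix.diagonal τ * (K' * K.map D)).trace =
      ((b * Matrix.diagonal τ * b') * (P * Q.map D)).trace +
        (Matrix.diagonal τ * (b' * b.map D)).trace := by
    have e1 : K' * K.map D = b' * (P * Q.map D) * b + b' * b.map D := by
      rw [hK'b, hKb, map_mul_derivation, mul_add]
      congr 1
      · simp only [mul_assoc]
      · rw [← mul_assoc, mul_assoc b', hPQ, mul_one]
    rw [e1, mul_add, Matrix.trace_add, ← mul_assoc, Matrix.trace_mul_comm]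
    simp only [mul_assoc]
  rw [hexp]
  refine add_mem (trace_mem_pos (mul_mem_mpos_left hconj (mul_mem hP fun i j => hD _ _ (hQ i j)))) ?_
  refine sum_mem fun i _ => ?_
  have hD0 : (b.map D).BlockTriangular id := by
    intro i j hij
    rw [Matrix.map_apply, htri hij, map_zero]
  rw [Matrix.diag_apply, blockTriangular_mul_diag (Matrix.blockTriangular_diagonal τ)
    (htri'.mul hD0), blockTriangular_mul_diag htri' hD0, Matrix.diagonal_apply_eq]
  refine mul_mem_pos_left (hτ i) ?_
  have : b' i i = (b i i)⁻¹ := eq_inv_of_mul_eq_one_right (hdiag i)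
  rw [this]
  exact hD.inv_mul _

theorem trace_mul_commutator_mem_pos {D D' : Derivation R Ω Ω} (hD : IsFiltered D)
    (hD' : IsFiltered D') {K K' : Mat} (hK : K * K' = 1) {τ : Fin n → Ω} {Γ Y Y' : Mat}
    (hΓ : Γ ∈ mpos k n) (hΓK : Γ = K * Matrix.diagonal τ * K')
    (hY : Γ.map D = Y * Γ - Γ * Y) (hY' : Γ.map D' = Y' * Γ - Γ * Y') :
    (Γ * (Y * Y' - Y' * Y)).trace ∈ pos k := by
  have hK' : K' * K = 1 := mul_eq_one_comm.1 hK
  set T : Mat := Matrix.diagonal τ with hT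
  have hconj : ∀ (E : Derivation R Ω Ω) (Z : Mat), Γ.map E = Z * Γ - Γ * Z →
      T.map E = 0 ∧ K' * Z * K * T - T * (K' * Z * K) = K' * K.map E * T - T * (K' * K.map E) := by
    intro E Z hZ
    have hTE : T.map E = Matrix.diagonal fun i => E (τ i) := by
      rw [hT, Matrix.diagonal_map (map_zero E)]
    have h0 : K' * Γ.map E * K = K' * Z * K * T - T * (K' * Z * K) := by
      rw [hZ, hΓK]
      calc K' * (Z * (K * T * K') - K * T * K' * Z) * K
          = K' * Z * K * T * (K' * K) - (K' * K) * T * (K' * Z * K) := by noncomm_ring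
        _ = _ := by rw [hK', mul_one, one_mul]
    have h1 : K' * Γ.map E * K = K' * K.map E * T - T * (K' * K.map E) + T.map E := by
      rw [hΓK, map_mul_derivation, map_mul_derivation, map_inv_derivation E hK]
      calc K' * ((K.map E * T + K * T.map E) * K' + K * T * -(K' * K.map E * K')) * K
          = K' * K.map E * T * (K' * K) + (K' * K) * T.map E * (K' * K)
            - (K' * K) * T * (K' * K.map E) * (K' * K) := by noncomm_ring
        _ = _ := by rw [hK', mul_one, mul_one, mul_one, one_mul, one_mul]; abel
    have h2 : T.map E = 0 := by
      rw [h0] at h1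
      have hd : ∀ i, E (τ i) = 0 := by
        intro i
        have := congrFun (congrFun h1 i) i
        rw [hTE] at this
        simp only [hT, Matrix.sub_apply, Matrix.add_apply, Matrix.mul_diagonal,
          Matrix.diagonal_mul, Matrix.diagonal_apply_eq] at this
        linear_combination -this
      rw [hTE]
      simp [hd]
    exact ⟨h2, by rw [← h0, h1, h2, add_zero]⟩
  obtain ⟨hT1, hc1⟩ := hconj D Y hY
  obtain ⟨hT2, hc2⟩ := hconj D' Y' hY'
  set Z := K' * Y * K with hZ
  set Z' := K' * Y' * K with hZ'
  set A := K' * K.map D with hA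
  set A' := K' * K.map D' with hA'
  have e1 : (Γ * (Y * Y' - Y' * Y)).trace = (T * (Z * Z' - Z' * Z)).trace := by
    have : Γ * (Y * Y' - Y' * Y) = K * (T * (Z * Z' - Z' * Z)) * K' := by
      rw [hΓK, hZ, hZ']
      have : K * (T * (K' * Y * K * (K' * Y' * K) - K' * Y' * K * (K' * Y * K))) * K' =
        K * T * K' * (Y * (K * K') * Y' - Y' * (K * K') * Y) * (K * K') := by noncomm_ring
      rw [this, hK, mul_one, mul_one, mul_one]
    rw [this, Matrix.trace_mul_comm, ← mul_assoc, hK', one_mul]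
  have cyc : ∀ U V : Mat, (T * (U * V - V * U)).trace = -((U * T - T * U) * V).trace := by
    intro U V
    have : (T * V * U).trace = (U * T * V).trace := by
      rw [Matrix.trace_mul_comm, ← mul_assoc]
    simp only [mul_sub, sub_mul, Matrix.trace_sub, ← mul_assoc, this]
    ring
  have cyc' : ∀ U V : Mat, (T * (U * V - V * U)).trace = ((V * T - T * V) * U).trace := by
    intro U V
    have : (T * U * V).trace = (V * T * U).trace := by
      rw [Matrix.trace_mul_comm, ← mul_assoc]
    simp only [mul_sub, sub_mul, Matrix.trace_sub, ← mul_assoc, this]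
  have e2 : (T * (Z * Z' - Z' * Z)).trace = (T * (A * A' - A' * A)).trace := by
    rw [cyc, hc1, ← cyc, cyc', hc2, ← cyc']
  have flat : A * A' - A' * A = K' * K.map (⁅D, D'⁆ : Derivation R Ω Ω) - A'.map D + A.map D' := by
    have e3 : K.map (⁅D, D'⁆ : Derivation R Ω Ω) = (K.map D').map D - (K.map D).map D' := by
      ext1 i j
      simp [Derivation.commutator_apply]
    rw [e3, hA, hA', map_mul_derivation, map_mul_derivation, map_inv_derivation D hK,
      map_inv_derivation D' hK]
    noncomm_ring
  have e4 : (T * A'.map D).trace = D (T * A').trace := by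
    rw [← trace_map_derivation, map_mul_derivation D T A', hT1, zero_mul, zero_add]
  have e5 : (T * A.map D').trace = D' (T * A).trace := by
    rw [← trace_map_derivation, map_mul_derivation D' T A, hT2, zero_mul, zero_add]
  rw [e1, e2, flat, mul_add, mul_sub, Matrix.trace_add, Matrix.trace_sub, e4, e5]
  have hΓ' : K * Matrix.diagonal τ * K' ∈ mpos k n := hΓK ▸ hΓ
  exact add_mem (sub_mem (trace_logDerivative_mem_pos (hD.lie hD') hK hΓ')
    (hD.pos (trace_logDerivative_mem_pos hD' hK hΓ')))
    (hD'.pos (trace_logDerivative_mem_pos hD hK hΓ'))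

end HahnQ

namespace HahnQ
open Polynomial

open scoped TensorProduct in
theorem exists_derivation_extension {S T : Type*} [CommRing S] [CommRing T] [Algebra ℂ S]
    [Algebra ℂ T] [Algebra S T] [IsScalarTower ℂ S T] [Algebra.FormallyEtale S T]
    (d : Derivation ℂ S T) :
    ∃ D : Derivation ℂ T T, ∀ s, D (algebraMap S T s) = d s := by
  let l : T ⊗[S] (Ω[S⁄ℂ]) →ₗ[T] T := LinearMap.liftBaseChange T d.liftKaehlerDifferential
  refine ⟨(l ∘ₗ (KaehlerDifferential.tensorKaehlerEquivOfFormallyEtale ℂ S T).symm.toLinearMap).compDer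
    (KaehlerDifferential.D ℂ T), fun s => ?_⟩
  have := KaehlerDifferential.tensorKaehlerEquivOfFormallyEtale_symm_D_algebraMap ℂ S T s
  change l _ = _
  erw [this]
  simp [l]

theorem exists_generic_field (n : ℕ) :
    ∃ (F : Type) (_ : Field F) (_ : Algebra ℂ F) (_ : IsAlgClosed F) (x : Fin n → F)
      (D : Fin n → Derivation ℂ F F), AlgebraicIndependent ℂ x ∧
        ∀ i j, D j (x i) = if i = j then 1 else 0 := by
  let P := MvPolynomial (Fin n) ℂ
  let K := FractionRing P
  let F := AlgebraicClosure K
  have h1 : Algebra.FormallyEtale P K := Algebra.FormallyEtale.of_isLocalization (nonZeroDivisors P)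
  have h2 : Algebra.FormallyEtale K F := Algebra.FormallyEtale.of_isSeparable K F
  have h3 : Algebra.FormallyEtale P F := Algebra.FormallyEtale.comp P K F
  have hinj : Function.Injective (algebraMap P F) := by
    rw [IsScalarTower.algebraMap_eq P K F]
    exact (algebraMap K F).injective.comp (IsFractionRing.injective P K)
  let x : Fin n → F := fun i => algebraMap P F (MvPolynomial.X i)
  have hx : AlgebraicIndependent ℂ x := by
    have : MvPolynomial.aeval x = IsScalarTower.toAlgHom ℂ P F := by
      ext i
      rw [MvPolynomial.aeval_X]
      rfl
    rw [AlgebraicIndependent, this]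
    exact hinj
  have hD : ∀ j : Fin n, ∃ D : Derivation ℂ F F, ∀ i, D (x i) = if i = j then 1 else 0 := by
    intro j
    obtain ⟨D, hD⟩ := exists_derivation_extension (S := P) (T := F)
      (MvPolynomial.mkDerivation ℂ fun i => if i = j then 1 else 0)
    exact ⟨D, fun i => by rw [hD, MvPolynomial.mkDerivation_X]⟩
  choose D hD using hD
  exact ⟨F, inferInstance, inferInstance, inferInstance, x, D, hx, fun i j => hD j i⟩

variable {F : Type*} [Field F] [Algebra ℂ F]

noncomputable instance : Algebra ℂ (HahnSeries ℚ F) := HahnSeries.instAlgebra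

noncomputable instance : Module ℂ (HahnSeries ℚ F) := Algebra.toModule

/-- The action on Hahn series of a family of linear maps of the coefficients. -/
noncomputable def coeffwise (φ : ℚ → F →ₗ[ℂ] F) : HahnSeries ℚ F →ₗ[ℂ] HahnSeries ℚ F where
  toFun f := ⟨fun q => φ q (f.coeff q), f.isPWO_support.mono fun q hq hq' =>
    hq (by simp only [show f.coeff q = 0 from hq', map_zero])⟩
  map_add' f g := by ext q; simp
  map_smul' c f := by ext q; simp

@[simp]
theorem coeff_coeffwise (φ : ℚ → F →ₗ[ℂ] F) (f : HahnSeries ℚ F) (q : ℚ) :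
    (coeffwise φ f).coeff q = φ q (f.coeff q) := rfl

theorem support_coeffwise (φ : ℚ → F →ₗ[ℂ] F) (f : HahnSeries ℚ F) :
    (coeffwise φ f).support ⊆ f.support := fun q hq hq' =>
  hq (by rw [coeff_coeffwise, show f.coeff q = 0 from hq', map_zero])

theorem coeff_coeffwise_mul (φ : ℚ → F →ₗ[ℂ] F) (f g : HahnSeries ℚ F) (q : ℚ) :
    (coeffwise φ f * g).coeff q =
      ∑ i ∈ Finset.antidiagonal f.isPWO_support g.isPWO_support q, φ i.1 (f.coeff i.1) * g.coeff i.2 :=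
  HahnSeries.coeff_mul_left' f.isPWO_support (support_coeffwise φ f)

theorem coeff_mul_coeffwise (φ : ℚ → F →ₗ[ℂ] F) (f g : HahnSeries ℚ F) (q : ℚ) :
    (f * coeffwise φ g).coeff q =
      ∑ i ∈ Finset.antidiagonal f.isPWO_support g.isPWO_support q, f.coeff i.1 * φ i.2 (g.coeff i.2) :=
  HahnSeries.coeff_mul_right' g.isPWO_support (support_coeffwise φ g)

theorem coeffwise_mem_ge (φ : ℚ → F →ₗ[ℂ] F) {f : HahnSeries ℚ F} {c : ℚ} (hf : f ∈ ge F c) :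
    coeffwise φ f ∈ ge F c :=
  fun q hq => by rw [coeff_coeffwise, hf q hq, map_zero]

/-- Coefficientwise extension of a derivation to Hahn series. -/
noncomputable def coeffDerivation (d : Derivation ℂ F F) :
    Derivation ℂ (HahnSeries ℚ F) (HahnSeries ℚ F) where
  toLinearMap := coeffwise fun _ => d
  map_one_eq_zero' := by
    ext q
    simp only [coeff_coeffwise, HahnSeries.coeff_one]
    split_ifs <;> simp
  leibniz' f g := by
    ext q
    rw [smul_eq_mul, smul_eq_mul, HahnSeries.coeff_add, mul_comm g, coeff_mul_coeffwise,
      coeff_coeffwise_mul, coeff_coeffwise, HahnSeries.coeff_mul, map_sum, ← Finset.sum_add_distrib]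
    exact Finset.sum_congr rfl fun i _ => by
      simp only [Derivation.coeFn_coe, Derivation.leibniz, smul_eq_mul]; ring

@[simp]
theorem coeff_coeffDerivation (d : Derivation ℂ F F) (f : HahnSeries ℚ F) (q : ℚ) :
    (coeffDerivation d f).coeff q = d (f.coeff q) := rfl

theorem isFiltered_coeffDerivation (d : Derivation ℂ F F) : IsFiltered (coeffDerivation d) :=
  fun _ _ hf => coeffwise_mem_ge _ hf

/-- The Euler derivation `s d/ds` on Hahn series in `s`. -/
noncomputable def euler : Derivation ℂ (HahnSeries ℚ F) (HahnSeries ℚ F) where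
  toLinearMap := coeffwise fun q => LinearMap.mulLeft ℂ (algebraMap ℂ F (q : ℂ))
  map_one_eq_zero' := by
    ext q
    simp only [coeff_coeffwise, HahnSeries.coeff_one]
    split_ifs with h <;> simp [h]
  leibniz' f g := by
    ext q
    rw [smul_eq_mul, smul_eq_mul, HahnSeries.coeff_add, mul_comm g, coeff_mul_coeffwise,
      coeff_coeffwise_mul, coeff_coeffwise, HahnSeries.coeff_mul, map_sum, ← Finset.sum_add_distrib]
    refine Finset.sum_congr rfl fun i hi => ?_
    rw [← (Finset.mem_antidiagonal.1 hi).2.2]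
    simp only [LinearMap.mulLeft_apply, Rat.cast_add, map_add]
    ring

@[simp]
theorem coeff_euler (f : HahnSeries ℚ F) (q : ℚ) :
    (euler f).coeff q = algebraMap ℂ F q * f.coeff q := rfl

theorem isFiltered_euler : IsFiltered (euler (F := F)) :=
  fun _ _ hf => coeffwise_mem_ge _ hf

/-- Truncation of a Hahn series to its integral exponents. -/
noncomputable def intPart : HahnSeries ℚ F →ₗ[ℂ] HahnSeries ℚ F :=
  coeffwise fun q => if q.isInt then LinearMap.id else 0

theorem coeff_intPart (f : HahnSeries ℚ F) (q : ℚ) :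
    (intPart f).coeff q = if q.isInt then f.coeff q else 0 := by
  rw [intPart, coeff_coeffwise]
  split_ifs <;> rfl

/-- Hahn series whose exponents are integers. -/
def HasIntSupport (f : HahnSeries ℚ F) : Prop := ∀ q : ℚ, ¬ q.isInt → f.coeff q = 0

theorem hasIntSupport_intPart (f : HahnSeries ℚ F) : HasIntSupport (intPart f) :=
  fun q hq => by rw [coeff_intPart, if_neg hq]

theorem HasIntSupport.intPart_eq {f : HahnSeries ℚ F} (hf : HasIntSupport f) : intPart f = f := by
  ext q
  rw [coeff_intPart]
  split_ifs with h
  · rfl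
  · exact (hf q h).symm

theorem isInt_iff {q : ℚ} : q.isInt ↔ ∃ m : ℤ, (m : ℚ) = q := by
  constructor
  · intro h
    exact ⟨q.num, by simpa [Rat.isInt, Rat.den_eq_one_iff] using h⟩
  · rintro ⟨m, rfl⟩
    simp [Rat.isInt]

theorem HasIntSupport.intPart_mul {f : HahnSeries ℚ F} (hf : HasIntSupport f)
    (g : HahnSeries ℚ F) : intPart (f * g) = f * intPart g := by
  ext q
  rw [coeff_intPart, HahnSeries.coeff_mul, intPart, coeff_mul_coeffwise]
  have key : ∀ i ∈ Finset.antidiagonal f.isPWO_support g.isPWO_support q, i.2.isInt ↔ q.isInt := by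
    intro i hi
    obtain ⟨h1, -, h2⟩ := Finset.mem_antidiagonal.1 hi
    obtain ⟨m, hm⟩ := isInt_iff.1 (not_not.1 fun h => h1 (hf _ h))
    rw [isInt_iff, isInt_iff, ← h2, ← hm]
    constructor
    · rintro ⟨l, hl⟩
      exact ⟨m + l, by push_cast; rw [hl]⟩
    · rintro ⟨l, hl⟩
      exact ⟨l - m, by push_cast; rw [hl]; ring⟩
  split_ifs with h
  · refine Finset.sum_congr rfl fun i hi => ?_
    rw [if_pos ((key i hi).2 h), LinearMap.id_apply]
  · refine (Finset.sum_eq_zero fun i hi => ?_).symm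
    rw [if_neg (fun h' => h ((key i hi).1 h')), LinearMap.zero_apply, mul_zero]

theorem intPart_euler (f : HahnSeries ℚ F) : intPart (euler f) = euler (intPart f) := by
  ext q
  simp only [coeff_intPart, coeff_euler]
  split_ifs <;> simp

end HahnQ

namespace HahnQ
open Polynomial
open scoped TensorProduct
open Module

section baseChange
variable {A B C : Type*} [CommRing A] [Algebra ℂ A] [CommRing B] [Algebra ℂ B]
  [CommRing C] [Algebra ℂ C]
  {L : Type*} [LieRing L] [LieAlgebra ℂ L] {n : ℕ} (b : Basis (Fin n) ℂ L)

/-- Coordinates of an element of `A ⊗ L` with respect to a basis of `L`. -/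
noncomputable def co : A ⊗[ℂ] L ≃ₗ[A] (Fin n → A) := (Algebra.TensorProduct.basis A b).equivFun

theorem co_tmul (c : A) (v : L) (i : Fin n) : co b (c ⊗ₜ v) i = b.repr v i • c := by
  simp [co, Algebra.TensorProduct.basis_repr_tmul, Algebra.smul_def, mul_comm]

theorem co_rTensor (φ : A →ₗ[ℂ] B) (y : A ⊗[ℂ] L) (i : Fin n) :
    co b (φ.rTensor L y) i = φ (co b y i) := by
  induction y with
  | zero => simp
  | add y z hy hz => simp [hy, hz]
  | tmul c v => simp [co_tmul]

theorem sum_co (y : A ⊗[ℂ] L) : y = ∑ i, co b y i • (1 : A) ⊗ₜ[ℂ] b i := by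
  have := (Algebra.TensorProduct.basis A b).sum_equivFun y
  simp only [Algebra.TensorProduct.basis_apply] at this
  exact this.symm

theorem derivation_lie (d : Derivation ℂ A A) (y z : A ⊗[ℂ] L) :
    (d : A →ₗ[ℂ] A).rTensor L ⁅y, z⁆ =
      ⁅(d : A →ₗ[ℂ] A).rTensor L y, z⁆ + ⁅y, (d : A →ₗ[ℂ] A).rTensor L z⁆ := by
  induction y with
  | zero => simp
  | add y y' hy hz => simp only [map_add, add_lie, hy, hz]; abel
  | tmul c w =>
    induction z with
    | zero => simp
    | add y y' hy hz => simp only [map_add, lie_add, hy, hz]; abel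
    | tmul c' w' =>
      simp only [LinearMap.rTensor_tmul, LieAlgebra.ExtendScalars.bracket_tmul, Derivation.coeFn_coe, Derivation.leibniz,
        smul_eq_mul]
      rw [← TensorProduct.add_tmul]
      congr 1; ring

theorem derivation_smul (d : Derivation ℂ A A) (c : A) (y : A ⊗[ℂ] L) :
    (d : A →ₗ[ℂ] A).rTensor L (c • y) = d c • y + c • (d : A →ₗ[ℂ] A).rTensor L y := by
  induction y with
  | zero => simp
  | add y y' hy hz => simp only [map_add, smul_add, hy, hz]; abel
  | tmul c' w =>
    simp only [TensorProduct.smul_tmul', LinearMap.rTensor_tmul, Derivation.coeFn_coe, Derivation.leibniz,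
        smul_eq_mul]
    rw [← TensorProduct.add_tmul]
    congr 1; ring

/-- Compatibility of brackets with maps that are multiplicative on given elements. -/
theorem rTensor_lie (φ : A →ₗ[ℂ] B) (ψ : A →ₗ[ℂ] B) (χ : C →ₗ[ℂ] A) (χ' : C →ₗ[ℂ] B)
    (h : ∀ c a, φ (χ c * a) = χ' c * ψ a) (y : C ⊗[ℂ] L) (z : A ⊗[ℂ] L) :
    φ.rTensor L ⁅χ.rTensor L y, z⁆ = ⁅χ'.rTensor L y, ψ.rTensor L z⁆ := by
  induction y with
  | zero => simp
  | add y y' hy hz => simp only [map_add, add_lie, hy, hz]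
  | tmul c w =>
    induction z with
    | zero => simp
    | add y y' hy hz => simp only [map_add, lie_add, hy, hz]
    | tmul c' w' => simp [h]

variable [FiniteDimensional ℂ L]

theorem killingForm_tmul (c d : A) (u v : L) :
    killingForm A (A ⊗[ℂ] L) (c ⊗ₜ u) (d ⊗ₜ v) = c * d * algebraMap ℂ A (killingForm ℂ L u v) := by
  rw [killingForm, LieModule.traceForm_baseChange, LinearMap.BilinForm.baseChange_tmul]
  rw [Algebra.algebraMap_eq_smul_one, mul_comm c d]
  simp

theorem killingForm_co (y z : A ⊗[ℂ] L) : killingForm A (A ⊗[ℂ] L) y z =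
    ∑ i, ∑ j, co b y i * co b z j * algebraMap ℂ A (killingForm ℂ L (b i) (b j)) := by
  conv_lhs => rw [sum_co b y, sum_co b z]
  simp only [map_sum, map_smul, LinearMap.sum_apply, LinearMap.smul_apply, killingForm_tmul, smul_eq_mul,
    mul_one, one_mul, Finset.mul_sum]
  rw [Finset.sum_comm]
  exact Finset.sum_congr rfl fun i _ => Finset.sum_congr rfl fun j _ => by ring

theorem derivation_killingForm (d : Derivation ℂ A A) (y z : A ⊗[ℂ] L) :
    d (killingForm A (A ⊗[ℂ] L) y z) =
      killingForm A (A ⊗[ℂ] L) ((d : A →ₗ[ℂ] A).rTensor L y) z +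
        killingForm A (A ⊗[ℂ] L) y ((d : A →ₗ[ℂ] A).rTensor L z) := by
  induction y with
  | zero => simp
  | add y y' hy hz => simp only [map_add, LinearMap.add_apply, hy, hz]; abel
  | tmul c w =>
    induction z with
    | zero => simp
    | add y y' hy hz => simp only [map_add, hy, hz]; abel
    | tmul c' w' =>
      simp only [LinearMap.rTensor_tmul, killingForm_tmul, Derivation.coeFn_coe, Derivation.leibniz,
        Derivation.map_algebraMap, smul_eq_mul, mul_zero]
      ring

variable [LieAlgebra.IsKilling ℂ L]

/-- The basis dual to `b` with respect to the Killing form. -/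
noncomputable def dualB : Basis (Fin n) ℂ L :=
  (killingForm ℂ L).dualBasis (LieAlgebra.IsKilling.killingForm_nondegenerate ℂ L) b

theorem killingForm_dualB (i j : Fin n) :
    killingForm ℂ L (b j) (dualB b i) = if j = i then 1 else 0 := by
  rw [LieModule.traceForm_comm]
  exact LinearMap.BilinForm.apply_dualBasis_left _ _ _ _

theorem killingForm_tmul_dualB (y : A ⊗[ℂ] L) (i : Fin n) :
    killingForm A (A ⊗[ℂ] L) y (1 ⊗ₜ dualB b i) = co b y i := by
  conv_lhs => rw [sum_co b y]
  simp only [map_sum, map_smul, LinearMap.sum_apply, LinearMap.smul_apply, killingForm_tmul, smul_eq_mul,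
    mul_one, killingForm_dualB, apply_ite (algebraMap ℂ A), map_one, map_zero, mul_ite, mul_zero,
    Finset.sum_ite_eq', Finset.mem_univ, if_true]

instance : LieAlgebra.IsKilling A (A ⊗[ℂ] L) where
  killingCompl_top_eq_bot := by
    refine (LieSubmodule.eq_bot_iff _).2 fun y hy => ?_
    rw [LieIdeal.mem_killingCompl] at hy
    let b := Module.finBasis ℂ L
    apply (co b).injective
    rw [map_zero]
    funext i
    rw [← killingForm_tmul_dualB b, LieModule.traceForm_comm, hy _ (LieSubmodule.mem_top _)]
    rfl

end baseChange

end HahnQ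

namespace HahnQ
open Polynomial
open scoped TensorProduct
open Module

section general
variable {K g : Type*} [Field K] [LieRing g] [LieAlgebra K g] [FiniteDimensional K g]
  [LieAlgebra.IsKilling K g]

theorem mem_range_ad_iff (γ w : g) :
    (∃ y, ⁅γ, y⁆ = w) ↔ ∀ u, ⁅γ, u⁆ = 0 → killingForm K g u w = 0 := by
  have hs : (killingForm K g).IsRefl := (LieModule.traceForm_isSymm K g g).isRefl
  have hnd := LieAlgebra.IsKilling.killingForm_nondegenerate K g
  constructor
  · rintro ⟨y, rfl⟩ u hu
    rw [← LieModule.traceForm_apply_lie_apply, ← lie_skew, hu, neg_zero, map_zero,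
      LinearMap.zero_apply]
  · intro h
    have h1 := LinearMap.BilinForm.orthogonal_orthogonal hnd hs (LinearMap.range (LieAlgebra.ad K g γ))
    have h2 : w ∈ LinearMap.range (LieAlgebra.ad K g γ) := by
      rw [← h1, LinearMap.BilinForm.mem_orthogonal_iff]
      intro u hu
      rw [LinearMap.BilinForm.mem_orthogonal_iff] at hu
      refine h u ?_
      refine hnd.1 _ fun y => ?_
      have : killingForm K g ⁅γ, y⁆ u = 0 := hu ⁅γ, y⁆ ⟨y, rfl⟩
      rw [LieModule.traceForm_comm, ← LieModule.traceForm_apply_lie_apply] at this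
      rw [← lie_skew, map_neg, LinearMap.neg_apply, this, neg_zero]
    exact h2

variable [CharZero K] [IsAlgClosed K]

theorem exists_eigenbasis (H : LieSubalgebra K g) [H.IsCartanSubalgebra] {n : ℕ}
    (hn : finrank K g = n) :
    ∃ (e : Basis (Fin n) K g) (α : Fin n → LieModule.Weight K H g),
      (∀ (u : H) i, ⁅(u : g), e i⁆ = α i u • e i) ∧ ∀ β, ∃ i, α i = β := by
  classical
  have hind := LieModule.iSupIndep_genWeightSpace' K H g
  have htop := LieModule.iSup_genWeightSpace_eq_top' K H g
  have hI : DirectSum.IsInternal fun χ : LieModule.Weight K H g =>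
      (LieModule.genWeightSpace g χ).toSubmodule := by
    rw [DirectSum.isInternal_submodule_iff_iSupIndep_and_iSup_eq_top]
    refine ⟨LieSubmodule.iSupIndep_toSubmodule.2 hind, ?_⟩
    rw [← LieSubmodule.iSup_toSubmodule, htop]
    rfl
  let v := fun χ : LieModule.Weight K H g => finBasis K (LieModule.genWeightSpace g χ).toSubmodule
  let e0 := hI.collectedBasis v
  have hcard : Fintype.card (Σ χ : LieModule.Weight K H g,
      Fin (finrank K (LieModule.genWeightSpace g χ).toSubmodule)) = n := by
    rw [← hn, finrank_eq_card_basis e0]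
  let eqv := Fintype.equivFinOfCardEq hcard
  refine ⟨e0.reindex eqv, fun i => (eqv.symm i).1, fun u i => ?_, fun β => ?_⟩
  · rw [Basis.reindex_apply]
    exact LieAlgebra.IsKilling.lie_eq_smul_of_mem_rootSpace (hI.collectedBasis_mem v _) u
  · have : Nontrivial (LieModule.genWeightSpace g β) := by
      rw [LieSubmodule.nontrivial_iff_ne_bot]
      exact β.genWeightSpace_ne_bot
    have hpos : 0 < finrank K (LieModule.genWeightSpace g β).toSubmodule := finrank_pos
    exact ⟨eqv ⟨β, ⟨0, hpos⟩⟩, by simp⟩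

end general

section regular
attribute [local instance] LieRing.ofAssociativeRing

theorem isCartanSubalgebra_engel {K g : Type*} [Field K] [LieRing g] [LieAlgebra K g]
    [FiniteDimensional K g] [Infinite K] {x : g} (hx : LieAlgebra.IsRegular K x) :
    (LieSubalgebra.engel K x).IsCartanSubalgebra := by
  refine ⟨?_, LieSubalgebra.normalizer_engel _ _⟩
  apply LieSubalgebra.isNilpotent_of_forall_le_engel
  intro y hy
  set Ex : {LieSubalgebra.engel K z | z ∈ LieSubalgebra.engel K x} :=
    ⟨LieSubalgebra.engel K x, x, LieSubalgebra.self_mem_engel _ _, rfl⟩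
  suffices IsBot Ex from @this ⟨LieSubalgebra.engel K y, y, hy, rfl⟩
  apply LieAlgebra.engel_isBot_of_isMin
    (Cardinal.natCast_le_aleph0.trans <| Cardinal.infinite_iff.mp ‹Infinite K›)
    (LieSubalgebra.engel K x) Ex le_rfl
  rintro ⟨_, y, hy, rfl⟩ hyx
  suffices finrank K (LieSubalgebra.engel K x) ≤ finrank K (LieSubalgebra.engel K y) by
    suffices LieSubalgebra.engel K y = LieSubalgebra.engel K x from this.ge
    apply LieSubalgebra.toSubmodule_injective
    exact Submodule.eq_of_le_of_finrank_le hyx this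
  rw [(LieAlgebra.isRegular_iff_finrank_engel_eq_rank K x).mp hx]
  apply LieAlgebra.rank_le_finrank_engel

theorem exists_cartan_of_isRegular {K g : Type*} [Field K] [LieRing g] [LieAlgebra K g]
    [FiniteDimensional K g] [CharZero K] [IsAlgClosed K] [LieAlgebra.IsKilling K g] {γ : g}
    (hγ : LieAlgebra.IsRegular K γ) :
    ∃ H : LieSubalgebra K g, H.IsCartanSubalgebra ∧ (∀ y, y ∈ H ↔ ⁅γ, y⁆ = 0) ∧
      finrank K H = LieAlgebra.rank K g := by
  have hC := isCartanSubalgebra_engel hγ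
  refine ⟨LieSubalgebra.engel K γ, hC, fun y => ⟨fun hy => ?_, fun hy => ?_⟩,
    (LieAlgebra.isRegular_iff_finrank_engel_eq_rank K γ).1 hγ⟩
  · have := trivial_lie_zero (LieSubalgebra.engel K γ) (LieSubalgebra.engel K γ)
      ⟨γ, LieSubalgebra.self_mem_engel K γ⟩ ⟨y, hy⟩
    exact congrArg Subtype.val this
  · rw [LieSubalgebra.mem_engel_iff]
    exact ⟨1, by simpa using hy⟩

variable {A : Type*} [Field A] [Algebra ℂ A] {L : Type*} [LieRing L] [LieAlgebra ℂ L]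
  [FiniteDimensional ℂ L]

theorem polyCharpoly_ad_baseChange {n : ℕ} (b : Basis (Fin n) ℂ L) :
    LinearMap.polyCharpoly (LieAlgebra.ad A (A ⊗[ℂ] L)).toLinearMap (Algebra.TensorProduct.basis A b) =
      (LinearMap.polyCharpoly (LieAlgebra.ad ℂ L).toLinearMap b).map
        (MvPolynomial.map (algebraMap ℂ A)) := by
  rw [← LinearMap.polyCharpoly_baseChange]
  congr 1
  refine TensorProduct.AlgebraTensorModule.ext fun c x => ?_
  refine TensorProduct.AlgebraTensorModule.ext fun d y => ?_
  change ⁅c ⊗ₜ[ℂ] x, d ⊗ₜ[ℂ] y⁆ =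
    (c • (LieAlgebra.ad ℂ L x).baseChange A) (d ⊗ₜ[ℂ] y)
  simp [TensorProduct.smul_tmul']

theorem rank_baseChange : LieAlgebra.rank A (A ⊗[ℂ] L) = LieAlgebra.rank ℂ L := by
  let b := finBasis ℂ L
  rw [LieAlgebra.rank_eq_natTrailingDegree A _ (Algebra.TensorProduct.basis A b),
    LieAlgebra.rank_eq_natTrailingDegree ℂ _ b, polyCharpoly_ad_baseChange]
  set p := LinearMap.polyCharpoly (LieAlgebra.ad ℂ L).toLinearMap b
  have hi : Function.Injective (MvPolynomial.map (σ := Fin (finrank ℂ L)) (algebraMap ℂ A)) :=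
    MvPolynomial.map_injective _ (algebraMap ℂ A).injective
  rw [Polynomial.natTrailingDegree_eq_support_min', Polynomial.natTrailingDegree_eq_support_min']
  · simp only [Polynomial.support_map_of_injective _ hi]
  · intro h0
    have := (LinearMap.polyCharpoly_monic (LieAlgebra.ad ℂ L).toLinearMap b).ne_zero
    exact this h0
  · intro h0
    have := (LinearMap.polyCharpoly_monic (LieAlgebra.ad ℂ L).toLinearMap b).map
      (MvPolynomial.map (algebraMap ℂ A))
    exact this.ne_zero h0

theorem isRegular_of_aeval_ne_zero {n : ℕ} (b : Basis (Fin n) ℂ L) (y : A ⊗[ℂ] L)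
    (h : ∀ P : MvPolynomial (Fin n) ℂ, P ≠ 0 → MvPolynomial.aeval (co b y) P ≠ 0) :
    LieAlgebra.IsRegular A y := by
  rw [LieAlgebra.isRegular_iff_coeff_polyCharpoly_rank_ne_zero A (Algebra.TensorProduct.basis A b),
    rank_baseChange, polyCharpoly_ad_baseChange, Polynomial.coeff_map]
  have := h _ (LieAlgebra.polyCharpoly_coeff_rank_ne_zero ℂ L b)
  rw [MvPolynomial.eval_map]
  exact this

end regular

end HahnQ

namespace HahnQ
open Polynomial
open scoped TensorProduct
open Module

section independence
variable {F : Type*} [Field F] [Algebra ℂ F] {σ : Type*}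

theorem aeval_single_one_monomial (x : σ → F) (m : σ →₀ ℕ) (c : ℂ) :
    MvPolynomial.aeval (fun i => (HahnSeries.single (1 : ℚ) (x i) : HahnSeries ℚ F))
      (MvPolynomial.monomial m c) =
      HahnSeries.single (m.degree : ℚ) (MvPolynomial.aeval x (MvPolynomial.monomial m c)) := by
  induction m using Finsupp.induction generalizing c with
  | zero =>
    simp
    rfl
  | single_add i k m hi hk ih =>
    have h1 : MvPolynomial.monomial (Finsupp.single i k + m) c =
        MvPolynomial.X i ^ k * MvPolynomial.monomial m c := by
      rw [MvPolynomial.X_pow_eq_monomial, MvPolynomial.monomial_mul, one_mul]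
    rw [h1, map_mul, map_mul, ih, map_pow, map_pow, MvPolynomial.aeval_X, MvPolynomial.aeval_X,
      HahnSeries.single_pow, HahnSeries.single_mul_single]
    congr 2
    simp

theorem coeff_aeval_single_one (x : σ → F) (P : MvPolynomial σ ℂ) (d : ℕ) :
    (MvPolynomial.aeval (fun i => (HahnSeries.single (1 : ℚ) (x i) : HahnSeries ℚ F)) P).coeff d =
      MvPolynomial.aeval x (MvPolynomial.homogeneousComponent d P) := by
  induction P using MvPolynomial.induction_on' with
  | add p q hp hq => simp only [map_add, HahnSeries.coeff_add, hp, hq]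
  | monomial m c =>
    rw [aeval_single_one_monomial, MvPolynomial.homogeneousComponent_of_mem
      (MvPolynomial.isHomogeneous_monomial c rfl), HahnSeries.coeff_single]
    by_cases h : d = m.degree
    · simp [h]
    · have h' : (d : ℚ) ≠ m.degree := by exact_mod_cast h
      simp [h, h']

theorem aeval_algebraMap_add_ne_zero {x : σ → F} (hx : AlgebraicIndependent ℂ x) (c : σ → ℂ)
    {P : MvPolynomial σ ℂ} (hP : P ≠ 0) :
    MvPolynomial.aeval (fun i => algebraMap ℂ (HahnSeries ℚ F) (c i) +
      HahnSeries.single (1 : ℚ) (x i)) P ≠ 0 := by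
  let T := MvPolynomial.aeval (R := ℂ) (fun i => (MvPolynomial.C (c i) + MvPolynomial.X i : MvPolynomial σ ℂ))
  let T' := MvPolynomial.aeval (R := ℂ) (fun i => (MvPolynomial.X i - MvPolynomial.C (c i) : MvPolynomial σ ℂ))
  have hT : T P ≠ 0 := by
    intro h0
    apply hP
    have h1 : T'.comp T = AlgHom.id ℂ _ := by
      ext i : 1
      simp [T, T']
    have h2 := DFunLike.congr_fun h1 P
    rw [AlgHom.comp_apply, h0, map_zero] at h2
    exact h2.symm
  have h3 : MvPolynomial.aeval (fun i => algebraMap ℂ (HahnSeries ℚ F) (c i) +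
      HahnSeries.single (1 : ℚ) (x i)) =
      (MvPolynomial.aeval (fun i => (HahnSeries.single (1 : ℚ) (x i) : HahnSeries ℚ F))).comp T := by
    ext i : 1
    simp [T]
  rw [h3, AlgHom.comp_apply]
  intro h0
  obtain ⟨d, hd⟩ : ∃ d, MvPolynomial.homogeneousComponent d (T P) ≠ 0 := by
    by_contra! h
    apply hT
    rw [← MvPolynomial.sum_homogeneousComponent (T P)]
    exact Finset.sum_eq_zero fun i _ => h i
  apply hd
  have h4 := coeff_aeval_single_one x (T P) d
  rw [h0, HahnSeries.coeff_zero] at h4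
  exact (injective_iff_map_eq_zero _).1 hx _ h4.symm

end independence

end HahnQ

namespace HahnQ
open Polynomial
open scoped TensorProduct
open Module

section coefficients
variable {F : Type*} [Field F] [Algebra ℂ F]
  {L : Type*} [LieRing L] [LieAlgebra ℂ L] {n : ℕ} (b : Basis (Fin n) ℂ L)

noncomputable instance : LieRing (HahnSeries ℚ F ⊗[ℂ] L) := LieAlgebra.ExtendScalars.instLieRing ..

noncomputable instance : Bracket (HahnSeries ℚ F ⊗[ℂ] L) (HahnSeries ℚ F ⊗[ℂ] L) := LieRing.toBracket

/-- Constant Hahn series. -/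
noncomputable def constLin (F : Type*) [Field F] [Algebra ℂ F] : F →ₗ[ℂ] HahnSeries ℚ F where
  toFun := HahnSeries.C
  map_add' := map_add _
  map_smul' c f := by
    ext q
    by_cases h : q = 0 <;> simp [HahnSeries.C_apply, h]

theorem constLin_apply (c : F) : constLin F c = HahnSeries.C c := rfl

/-- A coefficient of a Hahn series. -/
def coeffLin (F : Type*) [Field F] [Algebra ℂ F] (q : ℚ) : HahnSeries ℚ F →ₗ[ℂ] F where
  toFun f := f.coeff q
  map_add' _ _ := rfl
  map_smul' _ _ := rfl

theorem coeffLin_apply (q : ℚ) (f : HahnSeries ℚ F) : coeffLin F q f = f.coeff q := rfl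

/-- Constant elements of `L` over Hahn series. -/
noncomputable def cst : F ⊗[ℂ] L →ₗ[ℂ] HahnSeries ℚ F ⊗[ℂ] L := (constLin F).rTensor L

/-- Coefficients of elements of `L` over Hahn series. -/
noncomputable def cof (q : ℚ) : HahnSeries ℚ F ⊗[ℂ] L →ₗ[ℂ] F ⊗[ℂ] L := (coeffLin F q).rTensor L

theorem co_cst (u : F ⊗[ℂ] L) (i : Fin n) : co b (cst u) i = HahnSeries.C (co b u i) :=
  co_rTensor b _ u i

theorem co_cof (q : ℚ) (y : HahnSeries ℚ F ⊗[ℂ] L) (i : Fin n) :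
    co b (cof q y) i = (co b y i).coeff q :=
  co_rTensor b _ y i

theorem cst_lie (u v : F ⊗[ℂ] L) : cst ⁅u, v⁆ = ⁅cst u, cst v⁆ := by
  have := rTensor_lie (L := L) (constLin F) (constLin F) LinearMap.id (constLin F)
    (fun c a => map_mul HahnSeries.C c a) u v
  simpa [cst] using this

theorem cof_cst_lie (q : ℚ) (u : F ⊗[ℂ] L) (z : HahnSeries ℚ F ⊗[ℂ] L) :
    cof q ⁅cst u, z⁆ = ⁅u, cof q z⁆ := by
  have := rTensor_lie (L := L) (coeffLin F q) (coeffLin F q) (constLin F) LinearMap.id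
    (fun c a => by simp [constLin_apply, coeffLin_apply]) u z
  simpa [cof, cst] using this

theorem cof_single_smul (q p : ℚ) (y : HahnSeries ℚ F ⊗[ℂ] L) :
    cof q (HahnSeries.single p (1 : F) • y) = cof (q - p) y := by
  induction y with
  | zero => simp
  | add u v hu hv => simp only [smul_add, map_add, hu, hv]
  | tmul d w =>
    simp only [TensorProduct.smul_tmul', cof, LinearMap.rTensor_tmul, coeffLin_apply, smul_eq_mul]
    congr 1
    have := HahnSeries.coeff_single_mul_add (r := (1 : F)) (x := d) (a := q - p) (b := p)
    simpa using this

theorem cof_cst (u : F ⊗[ℂ] L) (q : ℚ) : cof q (cst u) = if q = 0 then u else 0 := by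
  induction u with
  | zero => simp
  | add u v hu hv => simp only [map_add, hu, hv]; split_ifs <;> simp
  | tmul d w =>
    simp only [cof, cst, LinearMap.rTensor_tmul, coeffLin_apply, constLin_apply,
      HahnSeries.C_apply, HahnSeries.coeff_single]
    split_ifs <;> simp

/-- The lattice of elements with coordinates of order at least `c`. -/
def lat (c : ℚ) : AddSubgroup (HahnSeries ℚ F ⊗[ℂ] L) where
  carrier := {y | ∀ i, co b y i ∈ ge F c}
  add_mem' hx hy i := by rw [map_add]; exact add_mem (hx i) (hy i)
  zero_mem' i := by rw [map_zero]; exact zero_mem _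
  neg_mem' hx i := by rw [map_neg]; exact neg_mem (hx i)

/-- The lattice of elements with coordinates of positive order. -/
def latp : AddSubgroup (HahnSeries ℚ F ⊗[ℂ] L) where
  carrier := {y | ∀ i, co b y i ∈ pos F}
  add_mem' hx hy i := by rw [map_add]; exact add_mem (hx i) (hy i)
  zero_mem' i := by rw [map_zero]; exact zero_mem _
  neg_mem' hx i := by rw [map_neg]; exact neg_mem (hx i)

variable {b}

theorem cst_mem_lat (u : F ⊗[ℂ] L) : cst u ∈ lat b 0 := fun i => by
  rw [co_cst]; exact C_mem_ge _

theorem smul_mem_lat {c d : ℚ} {f : HahnSeries ℚ F} (hf : f ∈ ge F c) {y : HahnSeries ℚ F ⊗[ℂ] L}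
    (hy : y ∈ lat b d) : f • y ∈ lat b (c + d) := fun i => by
  rw [map_smul]; exact mul_mem_ge hf (hy i)

theorem latp_le_lat : latp (F := F) b ≤ lat b 0 := fun _ hy i => pos_le_ge (hy i)

theorem lat_anti {c d : ℚ} (h : c ≤ d) : lat (F := F) b d ≤ lat b c := fun _ hy i => ge_anti h (hy i)

theorem cof_eq_zero_of_mem_lat {c q : ℚ} (h : q < c) {y : HahnSeries ℚ F ⊗[ℂ] L} (hy : y ∈ lat b c) :
    cof q y = 0 := by
  apply (co b).injective
  funext i
  rw [co_cof, hy i q h, map_zero, Pi.zero_apply]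

theorem cof_zero_of_mem_latp {y : HahnSeries ℚ F ⊗[ℂ] L} (hy : y ∈ latp b) :
    cof 0 y = 0 := by
  apply (co b).injective
  funext i
  rw [co_cof, hy i 0 le_rfl, map_zero, Pi.zero_apply]

variable [FiniteDimensional ℂ L]

theorem killingForm_mem_ge {c d : ℚ} {y z : HahnSeries ℚ F ⊗[ℂ] L} (hy : y ∈ lat b c)
    (hz : z ∈ lat b d) : killingForm (HahnSeries ℚ F) _ y z ∈ ge F (c + d) := by
  rw [killingForm_co b]
  refine sum_mem fun i _ => sum_mem fun j _ => ?_
  have h := mul_mem_ge (mul_mem_ge (hy i) (hz j))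
    (C_mem_ge (algebraMap ℂ F (killingForm ℂ L (b i) (b j))))
  rw [add_zero] at h
  exact h

end coefficients

end HahnQ

namespace HahnQ
open Polynomial
open scoped TensorProduct
open Module

section powers
variable {F : Type*} [Field F]

/-- Powers of the variable of Hahn series. -/
noncomputable def sp (F : Type*) [Field F] (q : ℚ) : HahnSeries ℚ F := HahnSeries.single q 1

theorem sp_mul (p q : ℚ) : sp F p * sp F q = sp F (p + q) := by
  simp [sp, HahnSeries.single_mul_single]

theorem sp_zero : sp F 0 = 1 := rfl

theorem sp_mem_ge (q : ℚ) : sp F q ∈ ge F q := single_mem_ge q 1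

theorem coeffDerivation_sp [Algebra ℂ F] (d : Derivation ℂ F F) (q : ℚ) :
    coeffDerivation d (sp F q) = 0 := by
  ext p
  rw [coeff_coeffDerivation, sp, HahnSeries.coeff_single]
  split_ifs <;> simp

end powers

section adMatrix
variable {A : Type*} [Field A] [Algebra ℂ A]
  {L : Type*} [LieRing L] [LieAlgebra ℂ L] {n : ℕ} (b : Basis (Fin n) ℂ L)

/-- The matrix of the adjoint action. -/
noncomputable def adM (y : A ⊗[ℂ] L) : Matrix (Fin n) (Fin n) A :=
  LinearMap.toMatrix (Algebra.TensorProduct.basis A b) (Algebra.TensorProduct.basis A b)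
    (LieAlgebra.ad A (A ⊗[ℂ] L) y : A ⊗[ℂ] L →ₗ[A] A ⊗[ℂ] L)

theorem adM_apply (y : A ⊗[ℂ] L) (i j : Fin n) : adM b y i j = co b ⁅y, (1 : A) ⊗ₜ[ℂ] b j⁆ i := by
  simp [adM, LinearMap.toMatrix_apply, co]

theorem adM_lie (y z : A ⊗[ℂ] L) : adM b ⁅y, z⁆ = adM b y * adM b z - adM b z * adM b y := by
  simp only [adM, ← LinearMap.toMatrix_mul, ← map_sub]
  congr 1
  ext u
  simp

theorem killingForm_eq_trace (y z : A ⊗[ℂ] L) :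
    killingForm A (A ⊗[ℂ] L) y z = (adM b y * adM b z).trace := by
  rw [adM, adM, ← LinearMap.toMatrix_mul, ← LinearMap.trace_eq_matrix_trace]
  rfl

theorem adM_map (d : Derivation ℂ A A) (y : A ⊗[ℂ] L) :
    (adM b y).map d = adM b ((d : A →ₗ[ℂ] A).rTensor L y) := by
  ext i j
  rw [Matrix.map_apply, adM_apply, adM_apply]
  have := co_rTensor b (d : A →ₗ[ℂ] A) ⁅y, (1 : A) ⊗ₜ[ℂ] b j⁆ i
  rw [Derivation.coeFn_coe] at this
  rw [← this, derivation_lie]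
  simp

end adMatrix

/-- A Lie algebra with a nilpotent element, triangular with respect to a basis, together
with generic scalars and derivations dual to them. -/
structure Setup (F L : Type*) [Field F] [Algebra ℂ F] [LieRing L] [LieAlgebra ℂ L] (n : ℕ) where
  /-- The basis. -/
  b : Basis (Fin n) ℂ L
  /-- The nilpotent element. -/
  a : L
  tri : ∀ i j, j ≤ i → b.repr ⁅a, b j⁆ i = 0
  /-- The generic scalars. -/
  x : Fin n → F
  /-- The derivations. -/
  D : Fin n → Derivation ℂ F F
  indep : AlgebraicIndependent ℂ x
  D_x : ∀ i j, D j (x i) = if i = j then 1 else 0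

namespace Setup
variable {F L : Type*} [Field F] [Algebra ℂ F] [LieRing L] [LieAlgebra ℂ L] {n : ℕ}
  (S : Setup F L n)

/-- The generic element. -/
noncomputable def X : F ⊗[ℂ] L := ∑ i, S.x i ⊗ₜ S.b i

/-- The generic perturbation of the nilpotent element. -/
noncomputable def γ : HahnSeries ℚ F ⊗[ℂ] L := cst (1 ⊗ₜ S.a) + sp F 1 • cst S.X

theorem co_X (i : Fin n) : co S.b S.X i = S.x i := by
  simp [X, co_tmul, Finsupp.single_apply, ite_smul]

theorem co_γ (i : Fin n) : co S.b S.γ i =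
    algebraMap ℂ (HahnSeries ℚ F) (S.b.repr S.a i) + HahnSeries.single (1 : ℚ) (S.x i) := by
  rw [γ, map_add, map_smul, Pi.add_apply, Pi.smul_apply, co_cst, co_cst, co_X, co_tmul]
  congr 1
  · rw [Algebra.smul_def, mul_one]; rfl
  · simp [sp, HahnSeries.C_apply, HahnSeries.single_mul_single]

/-- The derivation in the direction `W`. -/
noncomputable def dir (W : HahnSeries ℚ F ⊗[ℂ] L) : Derivation ℂ (HahnSeries ℚ F) (HahnSeries ℚ F) :=
  ∑ i, co S.b W i • coeffDerivation (S.D i)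

theorem dir_apply (W : HahnSeries ℚ F ⊗[ℂ] L) (f : HahnSeries ℚ F) :
    S.dir W f = ∑ i, co S.b W i * coeffDerivation (S.D i) f := by
  rw [dir, ← Derivation.coeFnAddMonoidHom_apply, map_sum, Finset.sum_apply]
  rfl

theorem isFiltered_dir {W : HahnSeries ℚ F ⊗[ℂ] L} (hW : W ∈ lat S.b 0) : IsFiltered (S.dir W) := by
  intro c f hf
  rw [dir_apply]
  refine sum_mem fun i _ => ?_
  have := mul_mem_ge (hW i) (isFiltered_coeffDerivation (S.D i) c f hf)
  rwa [zero_add] at this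

theorem dir_sp (W : HahnSeries ℚ F ⊗[ℂ] L) (q : ℚ) : S.dir W (sp F q) = 0 := by
  simp [dir_apply, coeffDerivation_sp]

theorem dir_γ (W : HahnSeries ℚ F ⊗[ℂ] L) :
    (S.dir W : HahnSeries ℚ F →ₗ[ℂ] HahnSeries ℚ F).rTensor L S.γ = sp F 1 • W := by
  apply (co S.b).injective
  funext i
  rw [co_rTensor, co_γ, map_add, Derivation.coeFn_coe, Derivation.map_algebraMap, zero_add, map_smul,
    dir_apply, Pi.smul_apply, smul_eq_mul]
  have h : ∀ j, coeffDerivation (S.D j) (HahnSeries.single (1 : ℚ) (S.x i)) =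
      if i = j then sp F 1 else 0 := by
    intro j
    ext q
    rw [coeff_coeffDerivation, HahnSeries.coeff_single]
    by_cases hq : q = 1 <;> by_cases hij : i = j <;> simp [hq, hij, S.D_x, sp]
  simp [h, mul_comm]

variable [FiniteDimensional ℂ L]

theorem isRegular_γ : LieAlgebra.IsRegular (HahnSeries ℚ F) S.γ := by
  refine isRegular_of_aeval_ne_zero S.b _ fun P hP => ?_
  have h : co S.b S.γ = fun i => algebraMap ℂ (HahnSeries ℚ F) (S.b.repr S.a i) +
    HahnSeries.single (1 : ℚ) (S.x i) := funext S.co_γ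
  rw [h]
  exact aeval_algebraMap_add_ne_zero S.indep _ hP

end Setup

section conj
variable {F : Type*} [Field F] {n : ℕ}

/-- Conjugation by a diagonal matrix of small powers. -/
noncomputable def cj (M : Matrix (Fin n) (Fin n) (HahnSeries ℚ F)) :
    Matrix (Fin n) (Fin n) (HahnSeries ℚ F) :=
  Matrix.diagonal (fun i : Fin n => sp F (-(i / (n + 1)))) * M *
    Matrix.diagonal (fun i : Fin n => sp F (i / (n + 1)))

theorem cj_mul_inv : Matrix.diagonal (fun i : Fin n => sp F (i / (n + 1))) *
    Matrix.diagonal (fun i : Fin n => sp F (-(i / (n + 1)))) = 1 := by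
  simp [sp_mul, sp_zero]

theorem cj_inv_mul : Matrix.diagonal (fun i : Fin n => sp F (-(i / (n + 1)))) *
    Matrix.diagonal (fun i : Fin n => sp F (i / (n + 1))) = 1 := by
  simp [sp_mul, sp_zero]

theorem cj_mul (M N : Matrix (Fin n) (Fin n) (HahnSeries ℚ F)) : cj (M * N) = cj M * cj N := by
  simp only [cj]
  calc _ = Matrix.diagonal (fun i : Fin n => sp F (-(i / (n + 1)))) * M *
      (Matrix.diagonal (fun i : Fin n => sp F (i / (n + 1))) *
        Matrix.diagonal (fun i : Fin n => sp F (-(i / (n + 1))))) * N *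
      Matrix.diagonal (fun i : Fin n => sp F (i / (n + 1))) := by
        rw [cj_mul_inv]; simp only [Matrix.mul_assoc, Matrix.one_mul]
    _ = _ := by simp only [Matrix.mul_assoc]

theorem cj_sub (M N : Matrix (Fin n) (Fin n) (HahnSeries ℚ F)) : cj (M - N) = cj M - cj N := by
  simp only [cj, Matrix.mul_sub, Matrix.sub_mul]

theorem trace_cj (M : Matrix (Fin n) (Fin n) (HahnSeries ℚ F)) : (cj M).trace = M.trace := by
  rw [cj, Matrix.trace_mul_comm, ← Matrix.mul_assoc, cj_mul_inv, Matrix.one_mul]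

theorem cj_apply (M : Matrix (Fin n) (Fin n) (HahnSeries ℚ F)) (i j : Fin n) :
    cj M i j = sp F ((j - i) / (n + 1)) * M i j := by
  rw [cj, Matrix.mul_diagonal, Matrix.diagonal_mul, mul_right_comm, sp_mul]
  congr 2
  ring

variable [Algebra ℂ F] {L : Type*} [LieRing L] [LieAlgebra ℂ L] (S : Setup F L n)

theorem cj_map_dir (W : HahnSeries ℚ F ⊗[ℂ] L) (M : Matrix (Fin n) (Fin n) (HahnSeries ℚ F)) :
    (cj M).map (S.dir W) = cj (M.map (S.dir W)) := by
  ext1 i j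
  rw [Matrix.map_apply, cj_apply, cj_apply, Derivation.leibniz, S.dir_sp, smul_zero, add_zero,
    smul_eq_mul, Matrix.map_apply]

theorem cj_adM_γ_mem_mpos : cj (adM S.b S.γ) ∈ mpos F n := by
  intro i j
  rw [cj_apply, adM_apply]
  have h1 : ⁅S.γ, (1 : HahnSeries ℚ F) ⊗ₜ[ℂ] S.b j⁆ =
      cst (1 ⊗ₜ ⁅S.a, S.b j⁆) + sp F 1 • cst ⁅S.X, 1 ⊗ₜ S.b j⁆ := by
    have : (1 : HahnSeries ℚ F) ⊗ₜ[ℂ] S.b j = cst (1 ⊗ₜ S.b j) := by simp [cst, constLin_apply]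
    rw [this, Setup.γ, add_lie, smul_lie, ← cst_lie, ← cst_lie]
    simp
  rw [h1, map_add, map_smul, Pi.add_apply, Pi.smul_apply, co_cst, co_cst, co_tmul, mul_add]
  have hn : (0 : ℚ) < n + 1 := by positivity
  have hi : ((i : ℕ) : ℚ) < n + 1 := by have := i.2; norm_cast; omega
  refine add_mem ?_ ?_
  · rcases lt_or_ge i j with hij | hij
    · have hij' : ((i : ℕ) : ℚ) < (j : ℕ) := by exact_mod_cast hij
      refine mul_mem_pos_left (mem_pos_of_mem_ge ?_ (sp_mem_ge _)) (C_mem_ge _)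
      exact div_pos (by linarith) hn
    · rw [S.tri i j hij]; simp
  · rw [smul_eq_mul, ← mul_assoc, sp_mul]
    refine mul_mem_pos_left (mem_pos_of_mem_ge ?_ (sp_mem_ge _)) (C_mem_ge _)
    have h0 : (0 : ℚ) ≤ (j : ℕ) := by positivity
    rw [div_add' _ _ _ hn.ne']
    exact div_pos (by linarith) hn

end conj

end HahnQ

namespace HahnQ
open Polynomial
open scoped TensorProduct
open Module

section eigenbasis
variable {A : Type*} [Field A] [Algebra ℂ A]
  {L : Type*} [LieRing L] [LieAlgebra ℂ L] {n : ℕ}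

theorem killingForm_eq_sum (e : Basis (Fin n) A (A ⊗[ℂ] L)) {v : A ⊗[ℂ] L} {β : Fin n → A}
    (hβ : ∀ i, ⁅v, e i⁆ = β i • e i) (z : A ⊗[ℂ] L) :
    killingForm A (A ⊗[ℂ] L) z v = ∑ i, β i * e.repr ⁅z, e i⁆ i := by
  rw [killingForm_apply_apply, LinearMap.trace_eq_matrix_trace A e, Matrix.trace]
  refine Finset.sum_congr rfl fun i _ => ?_
  rw [Matrix.diag_apply, LinearMap.toMatrix_apply]
  simp [hβ]

theorem repr_lie_eigenbasis (e : Basis (Fin n) A (A ⊗[ℂ] L)) {v : A ⊗[ℂ] L} {β : Fin n → A}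
    (hβ : ∀ i, ⁅v, e i⁆ = β i • e i) (w : A ⊗[ℂ] L) (i : Fin n) :
    e.repr ⁅v, w⁆ i = β i * e.repr w i := by
  conv_lhs => rw [← e.sum_repr w]
  simp only [lie_sum, lie_smul, hβ, map_sum, map_smul, Finsupp.coe_finsetSum, Finset.sum_apply,
    Finsupp.smul_apply, Basis.repr_self, smul_eq_mul, Finsupp.single_apply]
  simp [mul_comm]

theorem killingForm_derivation_eq_sum (e : Basis (Fin n) A (A ⊗[ℂ] L)) {u v : A ⊗[ℂ] L}
    {α β : Fin n → A} (hα : ∀ i, ⁅u, e i⁆ = α i • e i) (hβ : ∀ i, ⁅v, e i⁆ = β i • e i)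
    (d : Derivation ℂ A A) :
    killingForm A (A ⊗[ℂ] L) ((d : A →ₗ[ℂ] A).rTensor L u) v = ∑ i, β i * d (α i) := by
  rw [killingForm_eq_sum e hβ]
  refine Finset.sum_congr rfl fun i _ => ?_
  have h := derivation_lie d u (e i)
  rw [hα, derivation_smul] at h
  rw [eq_sub_of_add_eq h.symm, map_sub, map_add, map_smul, map_smul, Finsupp.sub_apply,
    Finsupp.add_apply, repr_lie_eigenbasis e hα]
  simp

end eigenbasis

section eigenvalue
variable {k : Type*} [Field k] {n : ℕ}

theorem eigenvalue_mem_pos {Γ : Matrix (Fin n) (Fin n) (HahnSeries ℚ k)} (hΓ : Γ ∈ mpos k n)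
    {v : Fin n → HahnSeries ℚ k} (hv : v ≠ 0) {μ : HahnSeries ℚ k} (h : Γ.mulVec v = μ • v) :
    μ ∈ pos k := by
  classical
  obtain ⟨j0, hj0⟩ := Function.ne_iff.1 hv
  obtain ⟨j, hj, hmin⟩ := Finset.exists_min_image (Finset.univ.filter fun i => v i ≠ 0)
    (fun i => (v i).order) ⟨j0, by simpa using hj0⟩
  have hj' : v j ≠ 0 := by simpa using hj
  have h1 : μ = ∑ i, Γ j i * (v i / v j) := by
    have := congrFun h j
    rw [Pi.smul_apply, smul_eq_mul, Matrix.mulVec, dotProduct] at this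
    rw [← mul_div_cancel_right₀ μ hj', ← this, Finset.sum_div]
    exact Finset.sum_congr rfl fun i _ => by rw [mul_div_assoc]
  rw [h1]
  refine sum_mem fun i _ => mul_mem_pos_left (hΓ j i) ?_
  by_cases hi : v i = 0
  · rw [hi, zero_div]; exact zero_mem _
  · exact div_mem_ge_zero hj' (ge_anti (hmin i (by simpa using hi)) (mem_ge_order _))

end eigenvalue

section adapted
variable {F : Type*} [Field F] [Algebra ℂ F]
  {L : Type*} [LieRing L] [LieAlgebra ℂ L] {n : ℕ} (b : Basis (Fin n) ℂ L)

theorem exists_adapted_basis (T : Submodule (HahnSeries ℚ F) (HahnSeries ℚ F ⊗[ℂ] L)) :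
    ∃ f : Basis (Fin n) (HahnSeries ℚ F) (HahnSeries ℚ F ⊗[ℂ] L), (∀ i, f i ∈ lat b 0) ∧
      (∀ y ∈ lat b 0, ∀ i, f.repr y i ∈ ge F 0) ∧
      ∀ y, y ∈ T ↔ ∀ i : Fin n, finrank (HahnSeries ℚ F) T ≤ i → f.repr y i = 0 := by
  have : Module.Finite (HahnSeries ℚ F) (HahnSeries ℚ F ⊗[ℂ] L) :=
    Module.Finite.of_basis (Algebra.TensorProduct.basis _ b)
  set r := finrank (HahnSeries ℚ F) T with hr
  have hrn : r ≤ n := by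
    have := Submodule.finrank_le T
    rwa [finrank_eq_card_basis (Algebra.TensorProduct.basis (HahnSeries ℚ F) b),
      Fintype.card_fin] at this
  let t := finBasis (HahnSeries ℚ F) T
  let M : Matrix (Fin n) (Fin n) (HahnSeries ℚ F) := Matrix.of fun i j =>
    if h : (j : ℕ) < r then co b (t ⟨j, h⟩ : HahnSeries ℚ F ⊗[ℂ] L) i else 0
  obtain ⟨P, Q, hP, hQ, hPQ, hM⟩ := exists_integral_upperTriangular M
  let E : (Fin n → HahnSeries ℚ F) ≃ₗ[HahnSeries ℚ F] (Fin n → HahnSeries ℚ F) :=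
    LinearEquiv.ofLinearMap P.mulVecLin Q.mulVecLin
      (by rw [← Matrix.mulVecLin_mul, hPQ, Matrix.mulVecLin_one])
      (by rw [← Matrix.mulVecLin_mul, mul_eq_one_comm.1 hPQ, Matrix.mulVecLin_one])
  let f := Basis.ofEquivFun ((co (A := HahnSeries ℚ F) b).trans E)
  have hrepr : ∀ y i, f.repr y i = P.mulVec (co b y) i := fun y i => by
    rw [← Basis.equivFun_apply, Basis.equivFun_ofEquivFun]
    rfl
  refine ⟨f, fun i j => ?_, fun y hy i => ?_, fun y => ?_⟩
  · have : co b (f i) = Q.mulVec (Pi.single i 1) := by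
      simp only [f, Basis.coe_ofEquivFun, LinearEquiv.trans_symm, LinearEquiv.trans_apply,
        LinearEquiv.apply_symm_apply]
      rfl
    rw [this, Matrix.mulVec_single_one]
    exact hQ j i
  · rw [hrepr]
    exact sum_mem fun j _ => mul_mem_ge_zero (hP i j) (hy j)
  · have hspan : T = Submodule.span (HahnSeries ℚ F) (f '' {i | (i : ℕ) < r}) := by
      refine Submodule.eq_of_le_of_finrank_le ?_ ?_
      · intro y hy
        have : (⟨y, hy⟩ : T) ∈ (⊤ : Submodule (HahnSeries ℚ F) T) := trivial
        rw [← t.span_eq] at this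
        have h2 : y ∈ Submodule.span (HahnSeries ℚ F) (Set.range fun j => (t j : HahnSeries ℚ F ⊗[ℂ] L)) := by
          have := Submodule.mem_map_of_mem (f := T.subtype) this
          rw [Submodule.map_span, ← Set.range_comp] at this
          exact this
        refine Submodule.span_le.2 ?_ h2
        rintro _ ⟨j, rfl⟩
        rw [SetLike.mem_coe, Basis.mem_span_image]
        intro i hi
        by_contra hir
        rw [Finset.mem_coe, Finsupp.mem_support_iff, hrepr] at hi
        apply hi
        have hji : (j : ℕ) < i := lt_of_lt_of_le j.2 (not_lt.1 hir)
        have := hM (i := i) (j := ⟨j, hji.trans i.2⟩) (Fin.mk_lt_of_lt_val hji)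
        rw [Matrix.mul_apply] at this
        rw [← this, Matrix.mulVec, dotProduct]
        refine Finset.sum_congr rfl fun l _ => ?_
        congr 1
        simp only [M, Matrix.of_apply]
        rw [dif_pos (show (j : ℕ) < r from j.2)]
      · have h1 : f '' {i | (i : ℕ) < r} = Set.range fun j : Fin r => f (Fin.castLE hrn j) := by
          ext y
          constructor
          · rintro ⟨i, hi, rfl⟩
            exact ⟨⟨i, hi⟩, rfl⟩
          · rintro ⟨j, rfl⟩
            exact ⟨_, j.2, rfl⟩
        rw [h1, ← hr]
        have := finrank_range_le_card (R := HahnSeries ℚ F) fun j : Fin r => f (Fin.castLE hrn j)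
        rwa [Fintype.card_fin] at this
    rw [hspan, Basis.mem_span_image]
    constructor
    · intro h i hi
      by_contra h0
      exact absurd (h (Finsupp.mem_support_iff.2 h0)) (not_lt.2 hi)
    · intro h i hi
      by_contra hir
      exact Finsupp.mem_support_iff.1 hi (h i (not_lt.1 hir))

end adapted

end HahnQ

namespace HahnQ
open Polynomial
open scoped TensorProduct
open Module

section adMatrix
variable {A : Type*} [Field A] [Algebra ℂ A]
  {L : Type*} [LieRing L] [LieAlgebra ℂ L] {n : ℕ} (b : Basis (Fin n) ℂ L)

theorem adM_mulVec (y z : A ⊗[ℂ] L) : (adM b y).mulVec (co b z) = co b ⁅y, z⁆ := by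
  have h := LinearMap.toMatrix_mulVec_repr (Algebra.TensorProduct.basis A b)
    (Algebra.TensorProduct.basis A b) (LieAlgebra.ad A (A ⊗[ℂ] L) y : A ⊗[ℂ] L →ₗ[A] A ⊗[ℂ] L) z
  exact h

/-- The eigenvalues of the adjoint action of an element on the vectors of a basis. -/
noncomputable def ev (e : Basis (Fin n) A (A ⊗[ℂ] L)) (u : A ⊗[ℂ] L) (i : Fin n) : A :=
  e.repr ⁅u, e i⁆ i

theorem adM_eq_conj_diagonal (e : Basis (Fin n) A (A ⊗[ℂ] L)) {u : A ⊗[ℂ] L}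
    (h : ∀ i, ⁅u, e i⁆ = ev e u i • e i) :
    adM b u = (Algebra.TensorProduct.basis A b).toMatrix e * Matrix.diagonal (ev e u) *
      e.toMatrix (Algebra.TensorProduct.basis A b) := by
  rw [adM, ← basis_toMatrix_mul_linearMap_toMatrix_mul_basis_toMatrix
    (Algebra.TensorProduct.basis A b) e (Algebra.TensorProduct.basis A b) e]
  congr 2
  ext i j
  have h1 : LinearMap.toMatrix e e (LieAlgebra.ad A (A ⊗[ℂ] L) u : A ⊗[ℂ] L →ₗ[A] A ⊗[ℂ] L) i j =
      e.repr ⁅u, e j⁆ i := LinearMap.toMatrix_apply _ _ _ _ _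
  rw [h1, h, map_smul, Basis.repr_self, Finsupp.smul_single, Finsupp.single_apply,
    Matrix.diagonal_apply]
  by_cases hij : i = j
  · subst hij; simp
  · simp [hij, Ne.symm hij]

end adMatrix

namespace Setup
variable {F L : Type*} [Field F] [Algebra ℂ F] [LieRing L] [LieAlgebra ℂ L] {n : ℕ}
  (S : Setup F L n) {e : Basis (Fin n) (HahnSeries ℚ F) (HahnSeries ℚ F ⊗[ℂ] L)}

theorem ev_γ_mem_pos {i : Fin n} (he : ⁅S.γ, e i⁆ = ev e S.γ i • e i) : ev e S.γ i ∈ pos F := by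
  refine eigenvalue_mem_pos (cj_adM_γ_mem_mpos S)
    (v := (Matrix.diagonal fun i : Fin n => sp F (-(i / (n + 1)))).mulVec (co S.b (e i))) ?_ ?_
  · intro h0
    apply e.ne_zero i
    apply (co S.b).injective
    have := congrArg (Matrix.mulVec (Matrix.diagonal fun i : Fin n => sp F (i / (n + 1)))) h0
    rwa [Matrix.mulVec_mulVec, cj_mul_inv, Matrix.one_mulVec, Matrix.mulVec_zero,
      ← map_zero (co S.b)] at this
  · rw [cj, Matrix.mulVec_mulVec, Matrix.mul_assoc, cj_mul_inv, Matrix.mul_one,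
      ← Matrix.mulVec_mulVec, adM_mulVec, he, map_smul, Matrix.mulVec_smul]

theorem killingForm_mem_pos_of_lie (he : ∀ i, ⁅S.γ, e i⁆ = ev e S.γ i • e i)
    {y y' W W' : HahnSeries ℚ F ⊗[ℂ] L} (hW : W ∈ lat S.b 0) (hW' : W' ∈ lat S.b 0)
    (hy : ⁅y, S.γ⁆ = sp F 1 • W) (hy' : ⁅y', S.γ⁆ = sp F 1 • W') :
    killingForm (HahnSeries ℚ F) _ y (sp F 1 • W') ∈ pos F := by
  have key : ∀ {y W}, ⁅y, S.γ⁆ = sp F 1 • W → (cj (adM S.b S.γ)).map (S.dir W) =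
      cj (adM S.b y) * cj (adM S.b S.γ) - cj (adM S.b S.γ) * cj (adM S.b y) := by
    intro y W h
    rw [cj_map_dir, adM_map, S.dir_γ, ← h, adM_lie, cj_sub, cj_mul, cj_mul]
  have h := trace_mul_commutator_mem_pos (S.isFiltered_dir hW) (S.isFiltered_dir hW')
    (K := Matrix.diagonal (fun i : Fin n => sp F (-(i / (n + 1)))) *
      (Algebra.TensorProduct.basis (HahnSeries ℚ F) S.b).toMatrix e)
    (K' := e.toMatrix (Algebra.TensorProduct.basis (HahnSeries ℚ F) S.b) *
      Matrix.diagonal (fun i : Fin n => sp F (i / (n + 1)))) (τ := ev e S.γ) ?_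
    (cj_adM_γ_mem_mpos S) ?_ (key hy) (key hy')
  · rw [← cj_mul, ← cj_mul, ← cj_sub, ← adM_lie, ← cj_mul, trace_cj, ← killingForm_eq_trace] at h
    rw [← hy', ← LieModule.traceForm_apply_lie_apply, LieModule.traceForm_comm]
    exact h
  · rw [Matrix.mul_assoc, ← Matrix.mul_assoc _ _ (Matrix.diagonal _), Basis.toMatrix_mul_toMatrix_flip,
      Matrix.one_mul, cj_inv_mul]
  · rw [cj, adM_eq_conj_diagonal S.b e he]
    simp only [Matrix.mul_assoc]

variable [FiniteDimensional ℂ L] [LieAlgebra.IsKilling ℂ L]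

theorem smul_mem_latp_of_ev (he : ∀ i, ⁅S.γ, e i⁆ = ev e S.γ i • e i) {u : HahnSeries ℚ F ⊗[ℂ] L}
    (heu : ∀ i, ⁅u, e i⁆ = ev e u i • e i) (hu : ∀ i, ev e u i ∈ ge F 0) :
    sp F 1 • u ∈ latp S.b := by
  intro i
  set W : HahnSeries ℚ F ⊗[ℂ] L := 1 ⊗ₜ dualB S.b i with hWdef
  have hW : W ∈ lat S.b 0 := by
    have : W = cst (1 ⊗ₜ dualB S.b i) := by simp [W, cst, constLin_apply]
    rw [this]; exact cst_mem_lat _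
  have h1 : co S.b (sp F 1 • u) i =
      killingForm (HahnSeries ℚ F) _ ((S.dir W : HahnSeries ℚ F →ₗ[ℂ] HahnSeries ℚ F).rTensor L S.γ) u := by
    rw [S.dir_γ, ← killingForm_tmul_dualB, LieModule.traceForm_comm, map_smul, map_smul,
      LinearMap.smul_apply]
  rw [h1, killingForm_derivation_eq_sum e he heu]
  exact sum_mem fun j _ => mul_mem_pos_right (hu j)
    ((S.isFiltered_dir hW).pos (S.ev_γ_mem_pos (he j)))

theorem exists_sub_mem_latp (he : ∀ i, ⁅S.γ, e i⁆ = ev e S.γ i • e i)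
    {y W : HahnSeries ℚ F ⊗[ℂ] L} (hW : W ∈ lat S.b 0) (hy : ⁅y, S.γ⁆ = sp F 1 • W) :
    ∃ t, ⁅S.γ, t⁆ = 0 ∧ sp F 1 • (y - t) ∈ latp S.b := by
  classical
  set T := LinearMap.ker (LieAlgebra.ad (HahnSeries ℚ F) (HahnSeries ℚ F ⊗[ℂ] L) S.γ :
    HahnSeries ℚ F ⊗[ℂ] L →ₗ[HahnSeries ℚ F] HahnSeries ℚ F ⊗[ℂ] L) with hTdef
  have hT : ∀ u, u ∈ T ↔ ⁅S.γ, u⁆ = 0 := fun u => LinearMap.mem_ker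
  obtain ⟨f, hf, hfr, hfT⟩ := exists_adapted_basis S.b T
  set r := finrank (HahnSeries ℚ F) T
  let f' := (killingForm (HahnSeries ℚ F) (HahnSeries ℚ F ⊗[ℂ] L)).dualBasis
    (LieAlgebra.IsKilling.killingForm_nondegenerate _ _) f
  have hff : ∀ z j, killingForm (HahnSeries ℚ F) _ (f' j) z = f.repr z j := by
    intro z j
    conv_lhs => rw [← f.sum_repr z]
    simp only [map_sum, map_smul, f', LinearMap.BilinForm.apply_dualBasis_left, smul_eq_mul]
    simp
  have hf' : ∀ j, f' j ∈ lat S.b 0 := by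
    intro j i
    rw [← killingForm_tmul_dualB, hff]
    refine hfr _ ?_ _
    have : (1 : HahnSeries ℚ F) ⊗ₜ[ℂ] dualB S.b i = cst (1 ⊗ₜ dualB S.b i) := by
      simp [cst, constLin_apply]
    rw [this]; exact cst_mem_lat _
  have hpos : ∀ j : Fin n, r ≤ j → sp F 1 * f.repr y j ∈ pos F := by
    intro j hj
    obtain ⟨y', hy'⟩ := (mem_range_ad_iff (K := HahnSeries ℚ F) S.γ (f' j)).2 fun u hu => by
      rw [LieModule.traceForm_comm, hff]
      exact (hfT u).1 ((hT u).2 hu) j hj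
    have := S.killingForm_mem_pos_of_lie he hW (hf' j) hy (y' := -(sp F 1 • y')) (by
      rw [neg_lie, ← lie_skew, neg_neg, lie_smul, hy'])
    rwa [map_smul, LieModule.traceForm_comm, hff, smul_eq_mul] at this
  refine ⟨∑ j : Fin n, (if r ≤ (j : ℕ) then 0 else f.repr y j) • f j, ?_, ?_⟩
  · rw [← hT, hfT]
    intro i hi
    rw [map_sum, Finsupp.finsetSum_apply]
    refine Finset.sum_eq_zero fun j _ => ?_
    rw [map_smul, Basis.repr_self, Finsupp.smul_single, Finsupp.single_apply]
    by_cases hij : j = i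
    · simp [hij, hi]
    · simp [hij]
  · have : y - ∑ j : Fin n, (if r ≤ (j : ℕ) then 0 else f.repr y j) • f j =
        ∑ j : Fin n, (if r ≤ (j : ℕ) then f.repr y j else 0) • f j := by
      conv_lhs => rw [← f.sum_repr y]
      rw [← Finset.sum_sub_distrib]
      refine Finset.sum_congr rfl fun j _ => ?_
      split_ifs <;> simp
    rw [this, Finset.smul_sum]
    refine sum_mem fun j _ => ?_
    rw [smul_smul]
    split_ifs with h
    · intro i
      rw [map_smul]
      exact mul_mem_pos_left (hpos j h) (hf j i)
    · rw [mul_zero, zero_smul]; exact zero_mem _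

end Setup

end HahnQ

namespace HahnQ
open Polynomial
open scoped TensorProduct
open Module

section coroots
variable {K g : Type*} [Field K] [LieRing g] [LieAlgebra K g]

theorem killingForm_eq_sum_sq {n : ℕ} (e : Basis (Fin n) K g) {v : g} {β : Fin n → K}
    (hβ : ∀ i, ⁅v, e i⁆ = β i • e i) : killingForm K g v v = ∑ i, β i * β i := by
  rw [killingForm_apply_apply, LinearMap.trace_eq_matrix_trace K e, Matrix.trace]
  refine Finset.sum_congr rfl fun i _ => ?_
  rw [Matrix.diag_apply, LinearMap.toMatrix_apply]
  simp [hβ]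

variable [FiniteDimensional K g] [CharZero K] [IsAlgClosed K] [LieAlgebra.IsKilling K g]

theorem exists_eigenbasis_coroots (H : LieSubalgebra K g) [H.IsCartanSubalgebra] {n : ℕ}
    (hn : finrank K g = n) :
    ∃ e : Basis (Fin n) K g, (∀ u ∈ H, ∀ i, ⁅u, e i⁆ = e.repr ⁅u, e i⁆ i • e i) ∧
      ∀ i, ∃ h ∈ H, ∃ (m : Fin n → ℤ) (N : ℤ), N ≠ 0 ∧ (∀ j, e.repr ⁅h, e j⁆ j = m j) ∧
        ∀ u ∈ H, N * e.repr ⁅u, e i⁆ i = 2 * killingForm K g h u := by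
  obtain ⟨e, α, he, hα⟩ := exists_eigenbasis H hn
  have hr : ∀ (u : H) i, e.repr ⁅(u : g), e i⁆ i = α i u := fun u i => by simp [he]
  refine ⟨e, fun u hu i => by rw [hr ⟨u, hu⟩]; exact he ⟨u, hu⟩ i, fun i => ?_⟩
  by_cases hz : (α i).IsZero
  · refine ⟨0, zero_mem _, 0, 1, one_ne_zero, fun j => by simp, fun u hu => ?_⟩
    rw [hr ⟨u, hu⟩, hz.eq]
    simp
  · have hc := LieAlgebra.IsKilling.root_apply_cartanEquivDual_symm_ne_zero hz
    set h := LieAlgebra.IsKilling.coroot (α i) with hh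
    set c : K := 2 * (α i ((LieAlgebra.IsKilling.cartanEquivDual H).symm (α i)))⁻¹ with hcdef
    have hc0 : c ≠ 0 := mul_ne_zero two_ne_zero (inv_ne_zero hc)
    have h2 : α i h = 2 := LieAlgebra.IsKilling.root_apply_coroot hz
    have htr : ∀ u : H, killingForm K g (h : g) u = c * α i u := fun u => by
      have := LieAlgebra.IsKilling.traceForm_coroot (α i) u
      rw [nsmul_eq_mul, smul_eq_mul, ← mul_assoc] at this
      exact_mod_cast this
    let m : Fin n → ℤ := fun j => LieModule.chainBotCoeff (α i) (α j) -
      LieModule.chainTopCoeff (α i) (α j)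
    have hm : ∀ j, α j h = m j := fun j =>
      LieAlgebra.IsKilling.apply_coroot_eq_cast (α i) (α j)
    have hN : (((∑ j, m j * m j : ℤ)) : K) = 2 * c := by
      have := killingForm_eq_sum_sq e (he h)
      rw [htr, h2, mul_comm] at this
      rw [this]
      push_cast
      exact Finset.sum_congr rfl fun j _ => by rw [hm]
    refine ⟨h, h.2, m, ∑ j, m j * m j, ?_, fun j => by rw [hr, hm], fun u hu => ?_⟩
    · intro h0
      rw [h0, Int.cast_zero] at hN
      exact mul_ne_zero two_ne_zero hc0 hN.symm
    · rw [hN, hr ⟨u, hu⟩, mul_assoc, ← htr ⟨u, hu⟩]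

end coroots
end HahnQ

namespace HahnQ
open Polynomial
open scoped TensorProduct
open Module

section residue
variable {F : Type*} [Field F] [Algebra ℂ F]
  {L : Type*} [LieRing L] [LieAlgebra ℂ L] {n : ℕ} {b : Basis (Fin n) ℂ L}

theorem cof_sp_smul (q p : ℚ) (y : HahnSeries ℚ F ⊗[ℂ] L) : cof q (sp F p • y) = cof (q - p) y :=
  cof_single_smul q p y

theorem cof_zero_smul {c : HahnSeries ℚ F} (hc : c ∈ ge F 0) {y : HahnSeries ℚ F ⊗[ℂ] L}
    (hy : y ∈ lat b 0) : cof 0 (c • y) = c.coeff 0 • cof 0 y := by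
  have h1 : c - HahnSeries.C (c.coeff 0) ∈ pos F := by
    intro q hq
    rw [HahnSeries.coeff_sub, HahnSeries.C_apply, HahnSeries.coeff_single]
    rcases hq.lt_or_eq with h | rfl
    · rw [if_neg h.ne, hc q h, sub_zero]
    · simp
  have h2 : (c - HahnSeries.C (c.coeff 0)) • y ∈ latp b := fun i => by
    rw [map_smul]; exact mul_mem_pos_left h1 (hy i)
  have h3 := cof_zero_of_mem_latp h2
  rw [sub_smul, map_sub, sub_eq_zero] at h3
  rw [h3]
  apply (co b).injective
  funext i
  rw [co_cof, map_smul, map_smul, Pi.smul_apply, Pi.smul_apply, co_cof, smul_eq_mul,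
    HahnSeries.C_mul_eq_smul]
  rfl

end residue

namespace Setup
variable {F L : Type*} [Field F] [Algebra ℂ F] [LieRing L] [LieAlgebra ℂ L] {n : ℕ}
  (S : Setup F L n)

/-- The initial terms of elements annihilated to second order by the generic perturbation. -/
noncomputable def jets : Submodule F (F ⊗[ℂ] L) where
  carrier := {u | ⁅(1 : F) ⊗ₜ[ℂ] S.a, u⁆ = 0 ∧ ∃ u', ⁅(1 : F) ⊗ₜ[ℂ] S.a, u'⁆ + ⁅S.X, u⁆ = 0}
  add_mem' := by
    rintro u v ⟨hu, u', hu'⟩ ⟨hv, v', hv'⟩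
    refine ⟨by rw [lie_add, hu, hv, add_zero], u' + v', ?_⟩
    rw [lie_add, lie_add, add_add_add_comm, hu', hv', add_zero]
  zero_mem' := ⟨lie_zero _, 0, by rw [lie_zero, lie_zero, add_zero]⟩
  smul_mem' := by
    rintro c u ⟨hu, u', hu'⟩
    exact ⟨by rw [lie_smul, hu, smul_zero], c • u', by rw [lie_smul, lie_smul, ← smul_add, hu', smul_zero]⟩

theorem lie_γ_jet (u u' : F ⊗[ℂ] L) : ⁅S.γ, cst u + sp F 1 • cst u'⁆ =
    cst ⁅(1 : F) ⊗ₜ[ℂ] S.a, u⁆ + sp F 1 • cst (⁅(1 : F) ⊗ₜ[ℂ] S.a, u'⁆ + ⁅S.X, u⁆) +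
      sp F 2 • cst ⁅S.X, u'⁆ := by
  have h : sp F 2 = sp F 1 * sp F 1 := by rw [sp_mul]; norm_num
  rw [γ, add_lie, lie_add, lie_add, lie_smul, smul_lie, smul_lie, lie_smul, ← cst_lie, ← cst_lie,
    ← cst_lie, ← cst_lie, map_add, smul_add, h, mul_smul]
  abel

theorem cof_lie_γ (q : ℚ) (t : HahnSeries ℚ F ⊗[ℂ] L) :
    cof q ⁅S.γ, t⁆ = ⁅(1 : F) ⊗ₜ[ℂ] S.a, cof q t⁆ + ⁅S.X, cof (q - 1) t⁆ := by
  rw [γ, add_lie, smul_lie, map_add, cof_cst_lie, cof_sp_smul, cof_cst_lie]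

theorem cof_zero_mem_jets {t : HahnSeries ℚ F ⊗[ℂ] L} (ht : t ∈ lat S.b 0) (h : ⁅S.γ, t⁆ = 0) :
    cof 0 t ∈ S.jets := by
  have h0 := S.cof_lie_γ 0 t
  have h1 := S.cof_lie_γ 1 t
  rw [h, map_zero, cof_eq_zero_of_mem_lat (c := 0) (q := 0 - 1) (by norm_num) ht, lie_zero, add_zero] at h0
  rw [h, map_zero, sub_self] at h1
  exact ⟨h0.symm, _, h1.symm⟩

variable [FiniteDimensional ℂ L] [LieAlgebra.IsKilling ℂ L]
  {e : Basis (Fin n) (HahnSeries ℚ F) (HahnSeries ℚ F ⊗[ℂ] L)}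

theorem exists_ker_of_jet (he : ∀ i, ⁅S.γ, e i⁆ = ev e S.γ i • e i) {u u' : F ⊗[ℂ] L}
    (hu : ⁅(1 : F) ⊗ₜ[ℂ] S.a, u⁆ = 0) (hu' : ⁅(1 : F) ⊗ₜ[ℂ] S.a, u'⁆ + ⁅S.X, u⁆ = 0) :
    ∃ t, ⁅S.γ, t⁆ = 0 ∧ cst u + sp F 1 • cst u' - t ∈ latp S.b := by
  have h2 : sp F (-1) * sp F 2 = sp F 1 := by rw [sp_mul]; norm_num
  have h3 : sp F 1 * sp F (-1) = 1 := by rw [sp_mul]; norm_num; rfl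
  obtain ⟨t, ht, h⟩ := S.exists_sub_mem_latp he (y := -(sp F (-1) • (cst u + sp F 1 • cst u')))
    (W := cst ⁅S.X, u'⁆) (cst_mem_lat _) (by
      rw [neg_lie, smul_lie, ← lie_skew, S.lie_γ_jet, hu, hu', map_zero, smul_zero, zero_add, zero_add,
        smul_neg, neg_neg, smul_smul, h2])
  refine ⟨-(sp F 1 • t), by rw [lie_neg, lie_smul, ht, smul_zero, neg_zero], ?_⟩
  rw [← neg_mem_iff]
  convert h using 1
  rw [smul_sub, smul_neg, smul_smul, h3, one_smul]
  abel

theorem finrank_jets (he : ∀ i, ⁅S.γ, e i⁆ = ev e S.γ i • e i) :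
    finrank F S.jets = finrank (HahnSeries ℚ F)
      (LinearMap.ker (LieAlgebra.ad (HahnSeries ℚ F) (HahnSeries ℚ F ⊗[ℂ] L) S.γ :
        HahnSeries ℚ F ⊗[ℂ] L →ₗ[HahnSeries ℚ F] HahnSeries ℚ F ⊗[ℂ] L)) := by
  set T := LinearMap.ker (LieAlgebra.ad (HahnSeries ℚ F) (HahnSeries ℚ F ⊗[ℂ] L) S.γ :
    HahnSeries ℚ F ⊗[ℂ] L →ₗ[HahnSeries ℚ F] HahnSeries ℚ F ⊗[ℂ] L) with hTdef
  have hT : ∀ u, u ∈ T ↔ ⁅S.γ, u⁆ = 0 := fun u => LinearMap.mem_ker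
  obtain ⟨f, hf, hfr, hfT⟩ := exists_adapted_basis S.b T
  set r := finrank (HahnSeries ℚ F) T
  have hrn : r ≤ n := by
    have := Submodule.finrank_le T
    rwa [finrank_eq_card_basis f, Fintype.card_fin] at this
  have hres : ∀ y ∈ lat S.b 0, cof 0 y = ∑ i, (f.repr y i).coeff 0 • cof 0 (f i) := by
    intro y hy
    conv_lhs => rw [← f.sum_repr y, map_sum]
    exact Finset.sum_congr rfl fun i _ => cof_zero_smul (hfr y hy i) (hf i)
  have hspan : ⊤ ≤ Submodule.span F (Set.range fun i => cof 0 (f i)) := by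
    intro u _
    have := hres (cst u) (cst_mem_lat _)
    rw [cof_cst, if_pos rfl] at this
    rw [this]
    exact sum_mem fun i _ => Submodule.smul_mem _ _ (Submodule.subset_span ⟨i, rfl⟩)
  have hli : LinearIndependent F fun i => cof 0 (f i) := by
    refine linearIndependent_of_top_le_span_of_card_eq_finrank hspan ?_
    rw [Fintype.card_fin, finrank_eq_card_basis (Algebra.TensorProduct.basis F S.b), Fintype.card_fin]
  have hjets : S.jets = Submodule.span F (Set.range fun i : Fin r => cof 0 (f (Fin.castLE hrn i))) := by
    refine le_antisymm ?_ ?_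
    · rintro u ⟨hu, u', hu'⟩
      obtain ⟨t, ht, h⟩ := S.exists_ker_of_jet he hu hu'
      have htl : t ∈ lat S.b 0 := by
        have h1 : cst u + sp F 1 • cst u' ∈ lat S.b 0 := by
          refine add_mem (cst_mem_lat _) (lat_anti (c := 0) (d := 1 + 0) (by norm_num) ?_)
          exact smul_mem_lat (sp_mem_ge 1) (cst_mem_lat _)
        have := sub_mem h1 (latp_le_lat h)
        rwa [sub_sub_cancel] at this
      have hu2 : u = cof 0 t := by
        have := cof_zero_of_mem_latp h
        rw [map_sub, map_add, cof_cst, if_pos rfl, cof_sp_smul, cof_cst, if_neg (by norm_num),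
          add_zero, sub_eq_zero] at this
        exact this
      rw [hu2, hres t htl]
      refine sum_mem fun i _ => ?_
      by_cases hi : (i : ℕ) < r
      · exact Submodule.smul_mem _ _ (Submodule.subset_span ⟨⟨i, hi⟩, rfl⟩)
      · rw [(hfT t).1 ((hT t).2 ht) i (not_lt.1 hi), HahnSeries.coeff_zero, zero_smul]
        exact zero_mem _
    · rw [Submodule.span_le]
      rintro _ ⟨i, rfl⟩
      refine S.cof_zero_mem_jets (hf _) ((hT _).1 ((hfT _).2 fun j hj => ?_))
      rw [Basis.repr_self, Finsupp.single_apply, if_neg]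
      intro h
      rw [← h] at hj
      exact absurd i.2 (not_lt.2 hj)
  have h := finrank_span_eq_card (hli.comp _ (Fin.castLE_injective hrn))
  rw [Fintype.card_fin] at h
  rw [hjets]
  exact h

end Setup
end HahnQ

namespace HahnQ
open Polynomial
open scoped TensorProduct
open Module

section integral
variable {F : Type*} [Field F]

theorem hasIntSupport_C (c : F) : HasIntSupport (HahnSeries.C c : HahnSeries ℚ F) := by
  intro q hq
  rw [HahnSeries.C_apply, HahnSeries.coeff_single, if_neg]
  rintro rfl
  exact hq (isInt_iff.2 ⟨0, by simp⟩)

theorem hasIntSupport_sp_one : HasIntSupport (sp F 1) := by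
  intro q hq
  rw [sp, HahnSeries.coeff_single, if_neg]
  rintro rfl
  exact hq (isInt_iff.2 ⟨1, by simp⟩)

variable [Algebra ℂ F]
  {L : Type*} [LieRing L] [LieAlgebra ℂ L] {n : ℕ} (b : Basis (Fin n) ℂ L)

/-- The part with integral exponents. -/
noncomputable def ipart : HahnSeries ℚ F ⊗[ℂ] L →ₗ[ℂ] HahnSeries ℚ F ⊗[ℂ] L :=
  (intPart : HahnSeries ℚ F →ₗ[ℂ] HahnSeries ℚ F).rTensor L

/-- The Euler derivation. -/
noncomputable def eul : HahnSeries ℚ F ⊗[ℂ] L →ₗ[ℂ] HahnSeries ℚ F ⊗[ℂ] L :=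
  ((euler : Derivation ℂ (HahnSeries ℚ F) (HahnSeries ℚ F)) :
    HahnSeries ℚ F →ₗ[ℂ] HahnSeries ℚ F).rTensor L

theorem co_ipart (y : HahnSeries ℚ F ⊗[ℂ] L) (i : Fin n) : co b (ipart y) i = intPart (co b y i) :=
  co_rTensor b _ y i

theorem co_eul (y : HahnSeries ℚ F ⊗[ℂ] L) (i : Fin n) : co b (eul y) i = euler (co b y i) :=
  co_rTensor b _ y i

theorem ipart_smul {c : HahnSeries ℚ F} (hc : HasIntSupport c) (y : HahnSeries ℚ F ⊗[ℂ] L) :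
    ipart (c • y) = c • ipart y := by
  induction y with
  | zero => simp
  | add u v hu hv => simp only [smul_add, map_add, hu, hv]
  | tmul d w =>
    simp only [TensorProduct.smul_tmul', ipart, LinearMap.rTensor_tmul, smul_eq_mul, hc.intPart_mul]

theorem ipart_ipart (y : HahnSeries ℚ F ⊗[ℂ] L) : ipart (ipart y) = ipart y := by
  induction y with
  | zero => simp
  | add u v hu hv => simp only [map_add, hu, hv]
  | tmul d w =>
    simp only [ipart, LinearMap.rTensor_tmul, (hasIntSupport_intPart d).intPart_eq]

theorem ipart_cst (u : F ⊗[ℂ] L) : ipart (cst u) = cst u := by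
  induction u with
  | zero => simp
  | add u v hu hv => simp only [map_add, hu, hv]
  | tmul d w =>
    simp only [ipart, cst, LinearMap.rTensor_tmul, constLin_apply, (hasIntSupport_C d).intPart_eq]

theorem ipart_cst_lie (u : F ⊗[ℂ] L) (z : HahnSeries ℚ F ⊗[ℂ] L) :
    ipart ⁅cst u, z⁆ = ⁅cst u, ipart z⁆ :=
  rTensor_lie (L := L) intPart intPart (constLin F) (constLin F)
    (fun c a => (hasIntSupport_C c).intPart_mul a) u z

theorem eul_cst (u : F ⊗[ℂ] L) : eul (cst u) = 0 := by
  induction u with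
  | zero => simp
  | add u v hu hv => simp only [map_add, hu, hv, add_zero]
  | tmul d w =>
    have : euler (HahnSeries.C d : HahnSeries ℚ F) = 0 := by
      ext q
      rw [coeff_euler, HahnSeries.C_apply, HahnSeries.coeff_single]
      split_ifs with h <;> simp [h]
    simp only [eul, cst, LinearMap.rTensor_tmul, constLin_apply, Derivation.coeFn_coe, this,
      TensorProduct.zero_tmul]

theorem eul_ipart (y : HahnSeries ℚ F ⊗[ℂ] L) : eul (ipart y) = ipart (eul y) := by
  induction y with
  | zero => simp
  | add u v hu hv => simp only [map_add, hu, hv]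
  | tmul d w =>
    simp only [eul, ipart, LinearMap.rTensor_tmul, Derivation.coeFn_coe, intPart_euler]

variable {b}

theorem ipart_mem_lat_one {y : HahnSeries ℚ F ⊗[ℂ] L} (hy : y ∈ latp b) : ipart y ∈ lat b 1 := by
  intro i q hq
  rw [co_ipart, coeff_intPart]
  split_ifs with h
  · obtain ⟨m, rfl⟩ := isInt_iff.1 h
    refine hy i _ ?_
    have : m < 1 := by exact_mod_cast hq
    exact_mod_cast Int.lt_add_one_iff.1 this
  · rfl

theorem eul_mem_latp {y : HahnSeries ℚ F ⊗[ℂ] L} (hy : y ∈ lat b 0) : eul y ∈ latp b := by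
  intro i q hq
  rw [co_eul, coeff_euler]
  rcases hq.lt_or_eq with h | rfl
  · rw [hy i q h, mul_zero]
  · simp

theorem ipart_mem_lat_zero {y : HahnSeries ℚ F ⊗[ℂ] L} (hy : sp F 1 • y ∈ latp b) :
    ipart y ∈ lat b 0 := by
  have h1 := ipart_mem_lat_one hy
  rw [ipart_smul hasIntSupport_sp_one] at h1
  have h2 := smul_mem_lat (sp_mem_ge (-1)) h1
  rwa [smul_smul, sp_mul, neg_add_cancel, sp_zero, one_smul] at h2

variable [FiniteDimensional ℂ L]

theorem killingForm_ipart (y z : HahnSeries ℚ F ⊗[ℂ] L) :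
    killingForm (HahnSeries ℚ F) _ (ipart y) (ipart z) =
      intPart (killingForm (HahnSeries ℚ F) _ y (ipart z)) := by
  rw [killingForm_co (finBasis ℂ L), killingForm_co (finBasis ℂ L)]
  simp only [map_sum]
  refine Finset.sum_congr rfl fun i _ => Finset.sum_congr rfl fun j _ => ?_
  have h : ∀ (f g : HahnSeries ℚ F) (c : ℂ),
      intPart (f * intPart g * algebraMap ℂ (HahnSeries ℚ F) c) =
        intPart f * intPart g * algebraMap ℂ (HahnSeries ℚ F) c := by
    intro f g c
    rw [mul_comm, ← Algebra.smul_def, map_smul, mul_comm f, (hasIntSupport_intPart g).intPart_mul,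
      Algebra.smul_def]
    ring
  rw [co_ipart, co_ipart, h]

end integral

namespace Setup
variable {F L : Type*} [Field F] [Algebra ℂ F] [LieRing L] [LieAlgebra ℂ L] {n : ℕ}
  (S : Setup F L n)

theorem ipart_lie_γ (y : HahnSeries ℚ F ⊗[ℂ] L) : ipart ⁅S.γ, y⁆ = ⁅S.γ, ipart y⁆ := by
  rw [γ, add_lie, smul_lie, map_add, ipart_smul hasIntSupport_sp_one, ipart_cst_lie, ipart_cst_lie,
    add_lie, smul_lie]

end Setup
end HahnQ

namespace HahnQ
open Polynomial
open scoped TensorProduct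
open Module

theorem intCast_mem_ge {F : Type*} [Field F] (m : ℤ) : (m : HahnSeries ℚ F) ∈ ge F 0 := by
  rw [← map_intCast (HahnSeries.C : F →+* HahnSeries ℚ F)]
  exact C_mem_ge _

namespace Setup
variable {F L : Type*} [Field F] [Algebra ℂ F] [LieRing L] [LieAlgebra ℂ L] {n : ℕ}

theorem euler_intCast (m : ℤ) : euler (m : HahnSeries ℚ F) = 0 :=
  Derivation.map_intCast _ m

theorem ev_smul (e : Basis (Fin n) (HahnSeries ℚ F) (HahnSeries ℚ F ⊗[ℂ] L)) (c : HahnSeries ℚ F)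
    (u : HahnSeries ℚ F ⊗[ℂ] L) (i : Fin n) : ev e (c • u) i = c * ev e u i := by
  rw [ev, smul_lie, map_smul]; rfl

variable (S : Setup F L n) [FiniteDimensional ℂ L] [LieAlgebra.IsKilling ℂ L]
  {e : Basis (Fin n) (HahnSeries ℚ F) (HahnSeries ℚ F ⊗[ℂ] L)}

theorem killingForm_coroot_mem_ge (he : ∀ u, ⁅S.γ, u⁆ = 0 → ∀ i, ⁅u, e i⁆ = ev e u i • e i)
    (hγγ : ⁅S.γ, S.γ⁆ = 0)
    {v w : F ⊗[ℂ] L} {z : HahnSeries ℚ F ⊗[ℂ] L} (hz : ⁅S.γ, ipart z⁆ = 0)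
    (hzv : ipart z - cst v ∈ lat S.b 1)
    (hvw : ∀ u, ⁅S.γ, u⁆ = 0 → killingForm (HahnSeries ℚ F) _ u (cst v) =
      -(sp F 2 * killingForm (HahnSeries ℚ F) _ u (cst w)))
    {h : HahnSeries ℚ F ⊗[ℂ] L} (hh : ⁅S.γ, h⁆ = 0) {m : Fin n → ℤ} (hm : ∀ j, ev e h j = m j) :
    killingForm (HahnSeries ℚ F) _ h (ipart z) ∈ ge F 1 := by
  intro q hq
  set f := sp F (1 - q) with hf
  have hfh : ⁅S.γ, f • h⁆ = 0 := by rw [lie_smul, hh, smul_zero]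
  have h1 : sp F 1 • (f • h) ∈ latp S.b := by
    refine S.smul_mem_latp_of_ev (he _ hγγ) (he _ hfh) fun i => ?_
    rw [ev_smul, hm]
    have := mul_mem_ge (sp_mem_ge (F := F) (1 - q)) (intCast_mem_ge (m i))
    exact ge_anti (by linarith) this
  set u := ipart (f • h) with hu
  have hul : u ∈ lat S.b 0 := ipart_mem_lat_zero h1
  have hu0 : ⁅S.γ, u⁆ = 0 := by rw [hu, ← S.ipart_lie_γ, hfh, map_zero]
  have h2 : killingForm (HahnSeries ℚ F) _ (eul u) (cst v) ∈ ge F 2 := by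
    have h3 := derivation_killingForm (euler : Derivation ℂ (HahnSeries ℚ F) (HahnSeries ℚ F)) u (cst v)
    have h4 : ((euler : Derivation ℂ (HahnSeries ℚ F) (HahnSeries ℚ F)) :
      HahnSeries ℚ F →ₗ[ℂ] HahnSeries ℚ F).rTensor L (cst v) = 0 := eul_cst v
    rw [h4, map_zero, add_zero, hvw u hu0] at h3
    have h5 : killingForm (HahnSeries ℚ F) _ (eul u) (cst v) = _ := h3.symm
    rw [h5]
    refine isFiltered_euler 2 _ (neg_mem ?_)
    have := mul_mem_ge (sp_mem_ge (F := F) 2) (killingForm_mem_ge hul (cst_mem_lat (b := S.b) w))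
    exact ge_anti (by norm_num) this
  have h3 : eul u ∈ lat S.b 1 := by
    have := ipart_mem_lat_one (eul_mem_latp hul)
    rwa [← eul_ipart, hu, ipart_ipart] at this
  have h4 : killingForm (HahnSeries ℚ F) _ (eul u) (ipart z) ∈ ge F 2 := by
    have := add_mem h2 (ge_anti (c := 2) (by norm_num) (killingForm_mem_ge h3 hzv))
    rwa [← map_add, add_sub_cancel] at this
  have h5 : killingForm (HahnSeries ℚ F) _ (eul h) (ipart z) = 0 := by
    have := killingForm_derivation_eq_sum e (he _ hh) (he _ hz)
      (euler : Derivation ℂ (HahnSeries ℚ F) (HahnSeries ℚ F))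
    refine Eq.trans this (Finset.sum_eq_zero fun i _ => ?_)
    rw [hm, euler_intCast, mul_zero]
  have h6 : eul (f • h) = euler f • h + f • eul h := derivation_smul _ f h
  rw [hu, eul_ipart, killingForm_ipart, h6, map_add, LinearMap.add_apply, map_smul, map_smul,
    LinearMap.smul_apply, LinearMap.smul_apply, h5, smul_zero, add_zero] at h4
  have h7 := h4 1 (by norm_num)
  have h8 : euler f = HahnSeries.single (1 - q) (algebraMap ℂ F ((1 - q : ℚ) : ℂ)) := by
    ext p
    rw [coeff_euler, hf, sp, HahnSeries.coeff_single, HahnSeries.coeff_single]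
    split_ifs with hp
    · rw [hp, mul_one]
    · simp
  rw [coeff_intPart, if_pos (isInt_iff.2 ⟨1, by simp⟩), h8, smul_eq_mul] at h7
  have h9 := HahnSeries.coeff_single_mul_add (r := algebraMap ℂ F ((1 - q : ℚ) : ℂ))
    (x := killingForm (HahnSeries ℚ F) _ h (ipart z)) (a := q) (b := 1 - q)
  rw [add_sub_cancel, h7] at h9
  refine (mul_eq_zero.1 h9.symm).resolve_left ?_
  rw [map_eq_zero]
  exact_mod_cast (sub_pos.2 hq).ne'

theorem eq_zero_of_mem_center [CharZero F] (he : ∀ u, ⁅S.γ, u⁆ = 0 → ∀ i, ⁅u, e i⁆ = ev e u i • e i)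
    (hC : ∀ i, ∃ h, ⁅S.γ, h⁆ = 0 ∧ ∃ (m : Fin n → ℤ) (N : ℤ), N ≠ 0 ∧ (∀ j, ev e h j = m j) ∧
      ∀ u, ⁅S.γ, u⁆ = 0 → N * ev e u i = 2 * killingForm (HahnSeries ℚ F) _ h u)
    {q₀ q₁ : F ⊗[ℂ] L}
    (hv : ∀ u : F ⊗[ℂ] L, ⁅(1 : F) ⊗ₜ[ℂ] S.a, u⁆ = 0 → ⁅⁅(1 : F) ⊗ₜ[ℂ] S.a, q₀⁆, u⁆ = 0)
    (hq : ⁅(1 : F) ⊗ₜ[ℂ] S.a, q₁⁆ + ⁅S.X, q₀⁆ = 0) : ⁅(1 : F) ⊗ₜ[ℂ] S.a, q₀⁆ = 0 := by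
  have hγγ : ⁅S.γ, S.γ⁆ = 0 := lie_self _
  set v := ⁅(1 : F) ⊗ₜ[ℂ] S.a, q₀⁆ with hvdef
  have hva : ⁅(1 : F) ⊗ₜ[ℂ] S.a, v⁆ = 0 := by
    rw [← lie_skew, hv _ (lie_self _), neg_zero]
  obtain ⟨v', hv'⟩ := (mem_range_ad_iff (K := F) ((1 : F) ⊗ₜ[ℂ] S.a) ⁅S.X, v⁆).2 fun u hu => by
    rw [← lie_skew, map_neg, ← LieModule.traceForm_apply_lie_apply, ← lie_skew, hv u hu]
    simp
  obtain ⟨t, ht, htv⟩ := S.exists_ker_of_jet (he _ hγγ) hva (u' := -v')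
    (by rw [lie_neg, hv', neg_add_cancel])
  have hz : ⁅S.γ, ipart t⁆ = 0 := by rw [← S.ipart_lie_γ, ht, map_zero]
  have hzv : ipart t - cst v ∈ lat S.b 1 := by
    have h1 := ipart_mem_lat_one htv
    rw [map_sub, map_add, ipart_smul hasIntSupport_sp_one, ipart_cst, ipart_cst] at h1
    have h2 : sp F 1 • cst (-v') ∈ lat S.b 1 := by
      have := smul_mem_lat (sp_mem_ge (F := F) 1) (cst_mem_lat (b := S.b) (-v'))
      rwa [add_zero] at this
    have h3 := sub_mem h2 h1
    convert h3 using 1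
    abel
  have hvw : ∀ u, ⁅S.γ, u⁆ = 0 → killingForm (HahnSeries ℚ F) _ u (cst v) =
      -(sp F 2 * killingForm (HahnSeries ℚ F) _ u (cst ⁅S.X, q₁⁆)) := by
    intro u hu
    have h1 := S.lie_γ_jet q₀ q₁
    rw [hq, map_zero, smul_zero, add_zero] at h1
    have h2 := (mem_range_ad_iff (K := HahnSeries ℚ F) S.γ _).1 ⟨_, h1⟩ u hu
    rw [map_add, map_smul, smul_eq_mul] at h2
    exact eq_neg_of_add_eq_zero_left h2
  have hev : ∀ i, ev e (ipart t) i ∈ ge F 1 := by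
    intro i
    obtain ⟨h, hh, m, N, hN, hm, hu⟩ := hC i
    have h1 := S.killingForm_coroot_mem_ge he hγγ hz hzv hvw hh hm
    have h2 : ev e (ipart t) i = HahnSeries.C (2 * (N : F)⁻¹) *
        killingForm (HahnSeries ℚ F) _ h (ipart t) := by
      have hN' : (N : F) ≠ 0 := by exact_mod_cast hN
      have h3 : (HahnSeries.C ((N : F)⁻¹) : HahnSeries ℚ F) * (N : HahnSeries ℚ F) = 1 := by
        rw [← map_intCast (HahnSeries.C : F →+* HahnSeries ℚ F), ← map_mul, inv_mul_cancel₀ hN',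
          map_one]
      rw [mul_comm 2, map_mul, mul_assoc, map_ofNat, ← hu _ hz, ← mul_assoc, h3, one_mul]
    rw [h2]
    have := mul_mem_ge (C_mem_ge (2 * (N : F)⁻¹)) h1
    rwa [zero_add] at this
  have hz' : ⁅S.γ, sp F (-1) • ipart t⁆ = 0 := by rw [lie_smul, hz, smul_zero]
  have h1 := S.smul_mem_latp_of_ev (he _ hγγ) (he _ hz') fun i => by
    rw [ev_smul]
    have := mul_mem_ge (sp_mem_ge (F := F) (-1)) (hev i)
    rwa [neg_add_cancel] at this
  rw [smul_smul, sp_mul, add_neg_cancel, sp_zero, one_smul] at h1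
  have h2 := cof_zero_of_mem_latp h1
  have h3 := cof_eq_zero_of_mem_lat (q := 0) one_pos hzv
  rw [map_sub, h2, cof_cst, if_pos rfl, zero_sub, neg_eq_zero] at h3
  exact h3

end Setup
end HahnQ

namespace HahnQ
open Polynomial
open scoped TensorProduct
open Module

theorem exists_basis_mem_span_lt {K V : Type*} [Field K] [AddCommGroup V] [Module K V]
    [FiniteDimensional K V] {n : ℕ} (hn : finrank K V = n) {T : V →ₗ[K] V} (hT : IsNilpotent T) :
    ∃ b : Basis (Fin n) K V, ∀ j, T (b j) ∈ Submodule.span K (b '' {i | i < j}) := by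
  induction n generalizing V with
  | zero => exact ⟨finBasisOfFinrankEq K V hn, fun j => j.elim0⟩
  | succ n ih =>
    have hlt : LinearMap.range T < ⊤ := by
      refine lt_top_iff_ne_top.2 fun h => ?_
      obtain ⟨k, hk⟩ := hT
      have h1 : LinearMap.range (T ^ k) = ⊤ := by
        rw [LinearMap.range_eq_top] at h ⊢
        rw [Module.End.coe_pow]
        exact h.iterate k
      rw [hk, LinearMap.range_zero] at h1
      have h2 := finrank_top K V
      rw [← h1, finrank_bot, hn] at h2
      omega
    obtain ⟨f, hf, hTf⟩ := Submodule.exists_le_ker_of_lt_top _ hlt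
    have hTN : ∀ v, T v ∈ LinearMap.ker f := fun v => hTf ⟨v, rfl⟩
    set N := LinearMap.ker f with hN
    obtain ⟨y, hy⟩ : ∃ y, f y ≠ 0 := by
      by_contra! h
      exact hf (LinearMap.ext h)
    have hfin : finrank K N = n := by
      have h1 : finrank K N + 1 = _ := Module.Dual.finrank_ker_add_one_of_ne_zero hf
      omega
    obtain ⟨b, hb⟩ := ih hfin (T := T.restrict fun v _ => hTN v)
      (by
        obtain ⟨k, hk⟩ := hT
        refine ⟨k, ?_⟩
        rw [Module.End.pow_restrict]
        ext v
        simp [hk])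
    refine ⟨Basis.mkFinSnoc b y ?_ ?_, ?_⟩
    · intro c x hx h
      have h1 := congrArg f h
      rw [map_add, map_smul, LinearMap.mem_ker.1 hx, add_zero, map_zero, smul_eq_mul] at h1
      exact (mul_eq_zero.1 h1).resolve_right hy
    · intro z
      refine ⟨-(f z / f y), ?_⟩
      rw [hN, LinearMap.mem_ker, map_add, map_smul, smul_eq_mul, neg_mul, div_mul_cancel₀ _ hy,
        add_neg_cancel]
    · have key : ∀ (s : Set (Fin n)) (v : N), v ∈ Submodule.span K (b '' s) → ∀ t : Set (Fin (n + 1)),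
          (∀ i ∈ s, i.castSucc ∈ t) → ∀ c : Fin (n + 1) → V, (∀ i : Fin n, c i.castSucc = b i) →
          (v : V) ∈ Submodule.span K (c '' t) := by
        intro s v hv t hst c hc
        have h1 := Submodule.mem_map_of_mem (f := N.subtype) hv
        rw [Submodule.map_span, ← Set.image_comp] at h1
        refine Submodule.span_mono ?_ h1
        rintro _ ⟨i, hi, rfl⟩
        exact ⟨i.castSucc, hst i hi, hc i⟩
      intro j
      rw [Basis.coe_mkFinSnoc]
      induction j using Fin.lastCases with
      | last =>
        rw [Fin.snoc_last]
        exact key Set.univ ⟨T y, hTN y⟩ (by rw [Set.image_univ, b.span_eq]; trivial) _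
          (fun i _ => Fin.castSucc_lt_last i) _ (fun i => by simp)
      | cast j =>
        rw [Fin.snoc_castSucc]
        exact key _ _ (hb j) _ (fun i hi => by simpa using hi) _ (fun i => by simp)

theorem exists_basis_repr_eq_zero {K V : Type*} [Field K] [AddCommGroup V] [Module K V]
    [FiniteDimensional K V] {T : V →ₗ[K] V} (hT : IsNilpotent T) :
    ∃ b : Basis (Fin (finrank K V)) K V, ∀ i j, j ≤ i → b.repr (T (b j)) i = 0 := by
  obtain ⟨b, hb⟩ := exists_basis_mem_span_lt rfl hT
  refine ⟨b, fun i j hij => ?_⟩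
  by_contra h
  exact absurd (b.mem_span_image.1 (hb j) (Finsupp.mem_support_iff.2 h)) (not_lt.2 hij)

theorem exists_submatrix_row_linearIndependent {K : Type*} [Field K] {m n : ℕ}
    (A : Matrix (Fin m) (Fin n) K) {r : ℕ} (hr : A.rank = r) :
    ∃ f : Fin r → Fin m, LinearIndependent K (A.submatrix f id).row := by
  subst hr
  rw [Matrix.rank_eq_finrank_span_row]
  obtain ⟨g, hg, hsp, hli⟩ := Submodule.exists_fun_fin_finrank_span_eq K (Set.range A.row)
  choose f hf using hg
  refine ⟨f, ?_⟩
  have : (A.submatrix f id).row = g := funext hf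
  rwa [this]

/-- A matrix has an invertible submatrix of the size of its rank. -/
theorem exists_submatrix_det_ne_zero {K : Type*} [Field K] {m n : ℕ}
    (A : Matrix (Fin m) (Fin n) K) {r : ℕ} (hr : A.rank = r) :
    ∃ (f : Fin r → Fin m) (g : Fin r → Fin n), (A.submatrix f g).det ≠ 0 := by
  obtain ⟨f, hf⟩ := exists_submatrix_row_linearIndependent A hr
  obtain ⟨g, hg⟩ := exists_submatrix_row_linearIndependent (A.submatrix f id).transpose
    ((Matrix.rank_transpose _).trans (by rw [hf.rank_matrix, Fintype.card_fin]))
  refine ⟨f, g, fun h => ?_⟩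
  have h1 : ((A.submatrix f id).transpose.submatrix g id) = (A.submatrix f g).transpose := rfl
  rw [h1, Matrix.linearIndependent_rows_iff_isUnit, Matrix.isUnit_iff_isUnit_det,
    Matrix.det_transpose, h] at hg
  exact not_isUnit_zero hg

/-- Specializing algebraically independent parameters can only decrease the rank of a matrix, and
generic specializations preserve it. -/
theorem rank_specialize {F : Type*} [Field F] [Algebra ℂ F] {n k : ℕ} {x : Fin n → F}
    (hx : AlgebraicIndependent ℂ x) (A : Matrix (Fin k) (Fin k) (MvPolynomial (Fin n) ℂ)) :
    (∀ c, (A.map (MvPolynomial.eval c)).rank ≤ (A.map (MvPolynomial.aeval x)).rank) ∧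
      ∃ c, (A.map (MvPolynomial.aeval x)).rank ≤ (A.map (MvPolynomial.eval c)).rank := by
  constructor
  · intro c
    obtain ⟨f, g, h⟩ := exists_submatrix_det_ne_zero (A.map (MvPolynomial.eval c)) rfl
    generalize (A.map (MvPolynomial.eval c)).rank = r at f g h ⊢
    rw [Matrix.submatrix_map, ← RingHom.mapMatrix_apply, ← RingHom.map_det] at h
    have h1 : (A.submatrix f g).det ≠ 0 := fun h0 => h (by rw [h0, map_zero])
    have h2 : ((A.map (MvPolynomial.aeval x)).submatrix f g).det ≠ 0 := by
      rw [Matrix.submatrix_map, ← AlgHom.mapMatrix_apply, ← AlgHom.map_det]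
      exact fun h0 => h1 (hx (by rw [h0, map_zero]))
    have h3 := Matrix.rank_submatrix_le (A.map (MvPolynomial.aeval x)) f g
    rwa [Matrix.rank_of_det_ne_zero h2, Fintype.card_fin] at h3
  · obtain ⟨f, g, h⟩ := exists_submatrix_det_ne_zero (A.map (MvPolynomial.aeval x)) rfl
    generalize (A.map (MvPolynomial.aeval x)).rank = r at f g h ⊢
    rw [Matrix.submatrix_map, ← AlgHom.mapMatrix_apply, ← AlgHom.map_det] at h
    have h1 : (A.submatrix f g).det ≠ 0 := fun h0 => h (by rw [h0, map_zero])
    obtain ⟨c, hc⟩ : ∃ c, MvPolynomial.eval c (A.submatrix f g).det ≠ 0 := by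
      by_contra! h0
      exact h1 (MvPolynomial.funext fun c => by rw [h0 c, map_zero])
    refine ⟨c, ?_⟩
    rw [RingHom.map_det, RingHom.mapMatrix_apply, ← Matrix.submatrix_map] at hc
    have h3 := Matrix.rank_submatrix_le (A.map (MvPolynomial.eval c)) f g
    rwa [Matrix.rank_of_det_ne_zero hc, Fintype.card_fin] at h3

namespace Setup
variable {F L : Type*} [Field F] [Algebra ℂ F] [LieRing L] [LieAlgebra ℂ L] {n : ℕ}
  (S : Setup F L n) [FiniteDimensional ℂ L] [LieAlgebra.IsKilling ℂ L]
  [CharZero F] [IsAlgClosed F]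

theorem exists_eigenbasis_γ : ∃ e : Basis (Fin n) (HahnSeries ℚ F) (HahnSeries ℚ F ⊗[ℂ] L),
    (∀ u, ⁅S.γ, u⁆ = 0 → ∀ i, ⁅u, e i⁆ = ev e u i • e i) ∧
    (∀ i, ∃ h, ⁅S.γ, h⁆ = 0 ∧ ∃ (m : Fin n → ℤ) (N : ℤ), N ≠ 0 ∧ (∀ j, ev e h j = m j) ∧
      ∀ u, ⁅S.γ, u⁆ = 0 → N * ev e u i = 2 * killingForm (HahnSeries ℚ F) _ h u) ∧
    finrank (HahnSeries ℚ F) (LinearMap.ker ((LieAlgebra.ad (HahnSeries ℚ F)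
      (HahnSeries ℚ F ⊗[ℂ] L)) S.γ)) = LieAlgebra.rank ℂ L := by
  have : CharZero (HahnSeries ℚ F) := charZero_of_injective_algebraMap
    (algebraMap ℂ (HahnSeries ℚ F)).injective
  obtain ⟨H, hH, hmem, hrk⟩ := exists_cartan_of_isRegular S.isRegular_γ
  have hn : finrank (HahnSeries ℚ F) (HahnSeries ℚ F ⊗[ℂ] L) = n := by
    rw [finrank_baseChange, finrank_eq_card_basis S.b, Fintype.card_fin]
  obtain ⟨e, he, hC⟩ := exists_eigenbasis_coroots H hn
  refine ⟨e, fun u hu => he u ((hmem u).2 hu), fun i => ?_, ?_⟩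
  · obtain ⟨h, hh, m, N, hN, hm, hu⟩ := hC i
    exact ⟨h, (hmem h).1 hh, m, N, hN, hm, fun u hu' => hu u ((hmem u).2 hu')⟩
  · rw [← rank_baseChange (A := HahnSeries ℚ F), ← hrk]
    have : LinearMap.ker ((LieAlgebra.ad (HahnSeries ℚ F) (HahnSeries ℚ F ⊗[ℂ] L)) S.γ) =
        H.toSubmodule := by
      ext y
      exact (hmem y).symm
    rw [this]
    rfl

theorem finrank_jets_eq_rank : finrank F S.jets = LieAlgebra.rank ℂ L := by
  obtain ⟨e, he, -, hr⟩ := S.exists_eigenbasis_γ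
  rw [S.finrank_jets (he _ (lie_self _)), hr]

theorem lie_eq_zero_of_mem_center {q₀ q₁ : F ⊗[ℂ] L}
    (hv : ∀ u : F ⊗[ℂ] L, ⁅(1 : F) ⊗ₜ[ℂ] S.a, u⁆ = 0 → ⁅⁅(1 : F) ⊗ₜ[ℂ] S.a, q₀⁆, u⁆ = 0)
    (hq : ⁅(1 : F) ⊗ₜ[ℂ] S.a, q₁⁆ + ⁅S.X, q₀⁆ = 0) : ⁅(1 : F) ⊗ₜ[ℂ] S.a, q₀⁆ = 0 := by
  obtain ⟨e, he, hC, -⟩ := S.exists_eigenbasis_γ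
  exact S.eq_zero_of_mem_center he hC hv hq

end Setup

end HahnQ

namespace HahnQ
open Polynomial
open scoped TensorProduct
open Module

theorem exists_baseChange_subtype_ker_eq {F M N : Type*} [Field F] [Algebra ℂ F] [AddCommGroup M]
    [Module ℂ M] [AddCommGroup N] [Module ℂ N] (f : M →ₗ[ℂ] N) {y : F ⊗[ℂ] M}
    (hy : f.baseChange F y = 0) : ∃ w, (LinearMap.ker f).subtype.baseChange F w = y := by
  have h := Module.Flat.ker_lTensor_eq (R := ℂ) F F f
  have h1 : y ∈ LinearMap.ker (TensorProduct.AlgebraTensorModule.lTensor F F f) := hy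
  rw [h] at h1
  exact h1

theorem finrank_ker_add_rank {K V : Type*} [Field K] [AddCommGroup V] [Module K V] {k : ℕ}
    (v : Basis (Fin k) K V) (B : V →ₗ[K] V →ₗ[K] K) :
    finrank K (LinearMap.ker B) + (Matrix.of fun i j => B (v j) (v i)).rank = k := by
  have : FiniteDimensional K V := v.finiteDimensional_of_finite
  have h : (Matrix.of fun i j => B (v j) (v i)) =
      LinearMap.toMatrix v v.dualBasis (B : V →ₗ[K] Dual K V) := by
    ext i j
    rw [LinearMap.toMatrix_apply, Basis.dualBasis_repr, Matrix.of_apply]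
  rw [h, Matrix.rank_eq_finrank_range_toLin _ v.dualBasis v, Matrix.toLin_toMatrix, add_comm]
  exact (LinearMap.finrank_range_add_finrank_ker B).trans
    ((finrank_eq_card_basis v).trans (Fintype.card_fin k))

theorem isNilpotent_of_ker_le {K V : Type*} [Field K] [AddCommGroup V] [Module K V]
    [FiniteDimensional K V] {A T : Module.End K V} (hA : IsNilpotent A) (hc : Commute A T)
    (h : LinearMap.ker A ≤ LinearMap.ker T) : IsNilpotent T := by
  obtain ⟨N, hN⟩ := Filter.eventually_atTop.1 (LinearMap.eventually_isCompl_ker_pow_range_pow T)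
  refine ⟨N + 1, ?_⟩
  have hd := (hN (N + 1) (by omega)).disjoint
  ext y
  by_contra hy
  have hex : ∃ k, (A ^ k) ((T ^ (N + 1)) y) = 0 := by
    obtain ⟨k, hk⟩ := hA
    exact ⟨k, by rw [hk]; rfl⟩
  classical
  obtain ⟨k, hk⟩ : ∃ k, Nat.find hex = k + 1 := by
    refine Nat.exists_eq_succ_of_ne_zero fun h0 => hy ?_
    have := Nat.find_spec hex
    rwa [h0, pow_zero] at this
  have h1 := Nat.find_spec hex
  have h2 := Nat.find_min hex (m := k) (by omega)
  rw [hk, pow_succ', Module.End.mul_apply] at h1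
  refine h2 (Submodule.disjoint_def.1 hd _ ?_ ?_)
  · have h3 : T ((A ^ k) ((T ^ (N + 1)) y)) = 0 := h h1
    rw [LinearMap.mem_ker, pow_succ (n := N), Module.End.mul_apply]
    exact (congrArg (T ^ N) h3).trans (map_zero _)
  · refine ⟨(A ^ k) y, ?_⟩
    rw [← Module.End.mul_apply, ← Module.End.mul_apply, (hc.pow_pow k (N + 1)).eq]

/-- Central elements of the centralizer of a nilpotent element lie in the image of its adjoint
action. -/
theorem exists_lie_eq_of_mem_center {K g : Type*} [Field K] [LieRing g] [LieAlgebra K g]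
    [FiniteDimensional K g] [LieAlgebra.IsKilling K g] {a v : g}
    (ha : IsNilpotent (LieAlgebra.ad K g a)) (hv : ∀ u : g, ⁅a, u⁆ = 0 → ⁅v, u⁆ = 0) :
    ∃ y, ⁅a, y⁆ = v := by
  have hva : ⁅v, a⁆ = 0 := hv a (lie_self a)
  have hnil : IsNilpotent (LieAlgebra.ad K g v) := by
    refine isNilpotent_of_ker_le ha ?_ fun u hu => hv u hu
    ext u
    have h : ⁅a, ⁅v, u⁆⁆ = ⁅v, ⁅a, u⁆⁆ := by
      rw [leibniz_lie, ← lie_skew a v, hva, neg_zero, zero_lie, zero_add]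
    exact h
  refine (mem_range_ad_iff (K := K) a v).2 fun u hu => ?_
  rw [LieModule.traceForm_apply_apply]
  refine (LinearMap.isNilpotent_trace_of_isNilpotent ?_).eq_zero
  refine Commute.isNilpotent_mul_left (R := Module.End K g) ?_ hnil
  ext w
  have h : ⁅u, ⁅v, w⁆⁆ = ⁅v, ⁅u, w⁆⁆ := by
    rw [leibniz_lie, ← lie_skew u v, hv u hu, neg_zero, zero_lie, zero_add]
  exact h

theorem killingForm_lie_swap {K g : Type*} [Field K] [LieRing g] [LieAlgebra K g] (x y z : g) :
    killingForm K g y ⁅x, z⁆ = -killingForm K g x ⁅y, z⁆ := by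
  rw [← LieModule.traceForm_apply_lie_apply, ← LieModule.traceForm_apply_lie_apply, ← lie_skew,
    map_neg, LinearMap.neg_apply]

theorem baseChange_ad_apply {F L : Type*} [Field F] [Algebra ℂ F] [LieRing L] [LieAlgebra ℂ L]
    (a : L) (y : F ⊗[ℂ] L) :
    (LieAlgebra.ad ℂ L a).baseChange F y = ⁅(1 : F) ⊗ₜ[ℂ] a, y⁆ := by
  induction y with
  | zero => simp
  | add y z hy hz => rw [map_add, lie_add, hy, hz]
  | tmul c w =>
    rw [LinearMap.baseChange_tmul, LieAlgebra.ExtendScalars.bracket_tmul, one_mul]; rfl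

namespace Setup
variable {F L : Type*} [Field F] [Algebra ℂ F] [LieRing L] [LieAlgebra ℂ L] {n : ℕ}
  (S : Setup F L n)

/-- The form `(p, q) ↦ κ(X, [p, q])` of the generic element `X`. -/
noncomputable def form (N : Submodule ℂ L) : LinearMap.BilinForm F (F ⊗[ℂ] N) :=
  LinearMap.mk₂ F (fun p q => killingForm F (F ⊗[ℂ] L) S.X
      ⁅N.subtype.baseChange F p, N.subtype.baseChange F q⁆)
    (fun p p' q => by rw [map_add, add_lie, map_add])
    (fun c p q => by rw [map_smul, smul_lie, map_smul])
    (fun p q q' => by rw [map_add, lie_add, map_add])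
    (fun c p q => by rw [map_smul, lie_smul, map_smul])

theorem form_apply (N : Submodule ℂ L) (p q : F ⊗[ℂ] N) : S.form N p q =
    killingForm F (F ⊗[ℂ] L) S.X ⁅N.subtype.baseChange F p, N.subtype.baseChange F q⁆ := rfl

variable [FiniteDimensional ℂ L] [LieAlgebra.IsKilling ℂ L] [CharZero F] [IsAlgClosed F]

theorem finrank_ker_form (N z : Submodule ℂ L)
    (hN : ∀ q, q ∈ N ↔ ⁅S.a, q⁆ ∈ z) (hz : ∀ v, v ∈ z ↔ ∀ u : L, ⁅S.a, u⁆ = 0 → ⁅v, u⁆ = 0)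
    (ha : IsNilpotent (LieAlgebra.ad ℂ L S.a)) :
    finrank F (LinearMap.ker (S.form N)) + finrank ℂ z = LieAlgebra.rank ℂ L := by
  set ι := N.subtype.baseChange F with hι
  have hinj : Function.Injective ι :=
    Module.Flat.lTensor_preserves_injective_linearMap N.subtype N.subtype_injective
  have hzinj : Function.Injective (z.subtype.baseChange F) :=
    Module.Flat.lTensor_preserves_injective_linearMap z.subtype z.subtype_injective
  let T : N →ₗ[ℂ] z := (LieAlgebra.ad ℂ L S.a).restrict fun q hq => (hN q).1 hq
  have hTs : Function.Surjective T := by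
    rintro ⟨v, hv⟩
    obtain ⟨y, hy⟩ := exists_lie_eq_of_mem_center ha ((hz v).1 hv)
    exact ⟨⟨y, (hN y).2 (hy ▸ hv)⟩, Subtype.ext hy⟩
  have hT : ∀ p, z.subtype.baseChange F (T.baseChange F p) = ⁅(1 : F) ⊗ₜ[ℂ] S.a, ι p⁆ := by
    intro p
    rw [← baseChange_ad_apply, ← LinearMap.comp_apply, ← LinearMap.comp_apply,
      ← LinearMap.baseChange_comp, ← LinearMap.baseChange_comp]
    rfl
  set M := LinearMap.ker (T.baseChange F) with hM
  have hMmem : ∀ p, p ∈ M ↔ ⁅(1 : F) ⊗ₜ[ℂ] S.a, ι p⁆ = 0 := by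
    intro p
    rw [hM, LinearMap.mem_ker, ← hT, map_eq_zero_iff _ hzinj]
  have hMdim : finrank F M + finrank ℂ z = finrank F (F ⊗[ℂ] N) := by
    have h1 := LinearMap.finrank_range_add_finrank_ker (T.baseChange F)
    rw [LinearMap.range_eq_top.2 (LinearMap.baseChange_surjective F hTs), finrank_top,
      finrank_baseChange] at h1
    rw [← h1, add_comm]
  have hker : ∀ u : F ⊗[ℂ] L, ⁅(1 : F) ⊗ₜ[ℂ] S.a, u⁆ = 0 →
      ∃ w, (LinearMap.ker (LieAlgebra.ad ℂ L S.a)).subtype.baseChange F w = u := by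
    intro u hu
    exact exists_baseChange_subtype_ker_eq _ (by rw [baseChange_ad_apply, hu])
  have hle : LinearMap.ker (LieAlgebra.ad ℂ L S.a) ≤ N := by
    intro u hu
    have hu' : ⁅S.a, u⁆ = 0 := hu
    rw [hN, hu']
    exact z.zero_mem
  have hkerM : ∀ u : F ⊗[ℂ] L, ⁅(1 : F) ⊗ₜ[ℂ] S.a, u⁆ = 0 → ∃ p ∈ M, ι p = u := by
    intro u hu
    obtain ⟨w, hw⟩ := hker u hu
    have h1 : ι ((Submodule.inclusion hle).baseChange F w) = u := by
      rw [← hw, ← LinearMap.comp_apply, ← LinearMap.baseChange_comp]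
      rfl
    exact ⟨_, (hMmem _).2 (by rw [h1, hu]), h1⟩
  have hcomm : ∀ (p : F ⊗[ℂ] N) (u : F ⊗[ℂ] L), ⁅(1 : F) ⊗ₜ[ℂ] S.a, u⁆ = 0 →
      ⁅⁅(1 : F) ⊗ₜ[ℂ] S.a, ι p⁆, u⁆ = 0 := by
    intro p u hu
    obtain ⟨w, rfl⟩ := hker u hu
    induction p with
    | zero => simp
    | add p q hp hq => rw [map_add, lie_add, add_lie, hp, hq, add_zero]
    | tmul c p =>
      clear hu
      induction w with
      | zero => simp
      | add w w' hw hw' => rw [map_add, lie_add, hw, hw', add_zero]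
      | tmul d w =>
        rw [hι, LinearMap.baseChange_tmul, LinearMap.baseChange_tmul,
          LieAlgebra.ExtendScalars.bracket_tmul, LieAlgebra.ExtendScalars.bracket_tmul]
        have h1 : ⁅⁅S.a, N.subtype p⁆, (LinearMap.ker (LieAlgebra.ad ℂ L S.a)).subtype w⁆ = 0 :=
          (hz _).1 ((hN _).1 p.2) _ w.2
        rw [h1, TensorProduct.tmul_zero]
  have halt : (S.form N).IsAlt := fun p => by rw [form_apply, lie_self, map_zero]
  have horth : Submodule.map ι ((S.form N).orthogonal M) = S.jets := by
    ext u
    constructor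
    · rintro ⟨p, hp, rfl⟩
      obtain ⟨q, hq⟩ := (mem_range_ad_iff (K := F) ((1 : F) ⊗ₜ[ℂ] S.a) ⁅S.X, ι p⁆).2 fun u hu => by
        obtain ⟨r, hr, rfl⟩ := hkerM u hu
        have h1 : killingForm F _ S.X ⁅ι r, ι p⁆ = 0 := hp r hr
        rw [killingForm_lie_swap, h1, neg_zero]
      have h2 : ⁅(1 : F) ⊗ₜ[ℂ] S.a, -q⁆ + ⁅S.X, ι p⁆ = 0 := by
        rw [lie_neg, hq, neg_add_cancel]
      exact ⟨S.lie_eq_zero_of_mem_center (hcomm p) h2, -q, h2⟩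
    · rintro ⟨hu, u', hu'⟩
      obtain ⟨p, hp, rfl⟩ := hkerM u hu
      refine ⟨p, fun r hr => ?_, rfl⟩
      have h1 := (mem_range_ad_iff (K := F) ((1 : F) ⊗ₜ[ℂ] S.a) ⁅S.X, ι p⁆).1
        ⟨-u', by rw [lie_neg]; exact neg_eq_of_add_eq_zero_right hu'⟩ _ ((hMmem r).1 hr)
      change killingForm F _ S.X ⁅ι r, ι p⁆ = 0
      rw [killingForm_lie_swap, h1, neg_zero]
  have hodim : finrank F ((S.form N).orthogonal M) = LieAlgebra.rank ℂ L := by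
    rw [← S.finrank_jets_eq_rank, ← horth]
    exact (Submodule.equivMapOfInjective ι hinj _).finrank_eq
  have hoM : (S.form N).orthogonal M ≤ M := by
    intro p hp
    rw [hMmem]
    exact (horth.le ⟨p, hp, rfl⟩ : ι p ∈ S.jets).1
  have h := LinearMap.BilinForm.finrank_add_finrank_orthogonal halt.isRefl M
  have hinf : M ⊓ (S.form N).orthogonal ⊤ = LinearMap.ker (S.form N) := by
    rw [← LinearMap.BilinForm.orthogonal_top_eq_ker halt.isRefl]
    exact inf_eq_right.2 ((LinearMap.BilinForm.orthogonal_le le_top).trans hoM)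
  rw [hinf, hodim] at h
  omega

end Setup

end HahnQ

namespace HahnQ
open scoped TensorProduct
open Module

/-- The alternating form `(p, q) ↦ ξ [p, q]`. -/
def coadForm {Q : Type*} [LieRing Q] [LieAlgebra ℂ Q] (ξ : Dual ℂ Q) : Q →ₗ[ℂ] Q →ₗ[ℂ] ℂ :=
  LinearMap.mk₂ ℂ (fun p q => ξ ⁅p, q⁆)
    (fun p p' q => by rw [add_lie, map_add])
    (fun c p q => by rw [smul_lie, map_smul])
    (fun p q q' => by rw [lie_add, map_add])
    (fun c p q => by rw [lie_smul, map_smul])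

theorem ker_coadForm {Q : Type*} [LieRing Q] [LieAlgebra ℂ Q] (ξ : Dual ℂ Q) :
    LinearMap.ker (coadForm ξ) = coadStab Q ξ := by
  ext p
  rw [LinearMap.mem_ker, LinearMap.ext_iff]
  rfl

theorem mem_normalizer_centralizer {L : Type*} [LieRing L] [LieAlgebra ℂ L] (e q : L) :
    q ∈ (centralizer L e).normalizer ↔ ⁅e, q⁆ ∈ zCenter L e := by
  have key : ∀ y : L, ⁅y, e⁆ = 0 → ⁅⁅q, y⁆, e⁆ = -⁅⁅e, q⁆, y⁆ := by
    intro y hy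
    rw [lie_lie, hy, lie_zero, zero_sub, ← lie_skew q e, lie_neg, neg_neg, ← lie_skew]
  rw [LieSubalgebra.mem_normalizer_iff]
  constructor
  · intro h
    have h1 : ∀ y : L, ⁅y, e⁆ = 0 → ⁅⁅e, q⁆, y⁆ = 0 := fun y hy => by
      have h2 : ⁅⁅q, y⁆, e⁆ = 0 := h y hy
      rwa [key y hy, neg_eq_zero] at h2
    exact ⟨h1 e (lie_self e), h1⟩
  · intro h y hy
    change ⁅⁅q, y⁆, e⁆ = 0
    rw [key y hy, h.2 y hy, neg_zero]

theorem mem_zCenter {L : Type*} [LieRing L] [LieAlgebra ℂ L] (e v : L) :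
    v ∈ zCenter L e ↔ ∀ u : L, ⁅e, u⁆ = 0 → ⁅v, u⁆ = 0 := by
  have h : ∀ u : L, ⁅e, u⁆ = 0 ↔ ⁅u, e⁆ = 0 := fun u => by rw [← lie_skew, neg_eq_zero]
  simp only [h]
  exact ⟨fun hv => hv.2, fun hv => ⟨hv e (lie_self e), hv⟩⟩

namespace Setup
variable {F L : Type*} [Field F] [Algebra ℂ F] [LieRing L] [LieAlgebra ℂ L] {n : ℕ}
  (S : Setup F L n) [FiniteDimensional ℂ L] [LieAlgebra.IsKilling ℂ L]

/-- The index of a subalgebra is the dimension of the kernel of its generic form. -/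
theorem lieIndex_eq_finrank_ker_form (N : LieSubalgebra ℂ L) :
    lieIndex N = finrank F (LinearMap.ker (S.form N.toSubmodule)) := by
  let nb := finBasis ℂ N.toSubmodule
  let A : Matrix (Fin _) (Fin _) (MvPolynomial (Fin n) ℂ) := Matrix.of fun i j =>
    ∑ l, MvPolynomial.C (killingForm ℂ L (S.b l) ⁅(nb j : L), (nb i : L)⁆) * MvPolynomial.X l
  let ξ : L → Dual ℂ N := fun x => (killingForm ℂ L x).comp N.toSubmodule.subtype
  have hev : ∀ c : Fin n → ℂ, A.map (MvPolynomial.eval c) =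
      Matrix.of fun i j => coadForm (ξ (∑ l, c l • S.b l)) (nb j) (nb i) := by
    intro c
    ext i j
    change MvPolynomial.eval c (∑ l, MvPolynomial.C (killingForm ℂ L (S.b l)
      ⁅(nb j : L), (nb i : L)⁆) * MvPolynomial.X l) =
      killingForm ℂ L (∑ l, c l • S.b l) ⁅(nb j : L), (nb i : L)⁆
    rw [map_sum, map_sum, LinearMap.sum_apply]
    refine Finset.sum_congr rfl fun l _ => ?_
    rw [map_mul, MvPolynomial.eval_C, MvPolynomial.eval_X, map_smul, LinearMap.smul_apply,
      smul_eq_mul, mul_comm]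
  have haev : A.map (MvPolynomial.aeval S.x) = Matrix.of fun i j =>
      S.form N.toSubmodule (nb.baseChange F j) (nb.baseChange F i) := by
    ext i j
    change MvPolynomial.aeval S.x (∑ l, MvPolynomial.C (killingForm ℂ L (S.b l)
      ⁅(nb j : L), (nb i : L)⁆) * MvPolynomial.X l) =
      S.form N.toSubmodule (nb.baseChange F j) (nb.baseChange F i)
    rw [form_apply, Basis.baseChange_apply,
      Basis.baseChange_apply, LinearMap.baseChange_tmul, LinearMap.baseChange_tmul,
      LieAlgebra.ExtendScalars.bracket_tmul, X, map_sum, map_sum, LinearMap.sum_apply]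
    refine Finset.sum_congr rfl fun l _ => ?_
    rw [map_mul, MvPolynomial.aeval_X, killingForm_tmul, mul_one, mul_one, mul_comm,
      MvPolynomial.aeval_C]
    rfl
  have hfin : ∀ c : Fin n → ℂ, finrank ℂ (coadStab N (ξ (∑ l, c l • S.b l))) +
      (A.map (MvPolynomial.eval c)).rank = finrank ℂ N.toSubmodule := by
    intro c
    rw [hev, ← ker_coadForm]
    exact finrank_ker_add_rank nb _
  have hgen : finrank F (LinearMap.ker (S.form N.toSubmodule)) +
      (A.map (MvPolynomial.aeval S.x)).rank = finrank ℂ N.toSubmodule := by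
    rw [haev]
    exact finrank_ker_add_rank (nb.baseChange F) _
  obtain ⟨hle, c, hc⟩ := rank_specialize S.indep A
  refine le_antisymm ((ciInf_le' _ (ξ (∑ l, c l • S.b l))).trans ?_) (le_ciInf fun η => ?_)
  · have := hfin c
    omega
  · obtain ⟨η', hη'⟩ := LinearMap.exists_extend (p := N.toSubmodule) η
    obtain ⟨x, hx⟩ := (LinearMap.BilinForm.toDual (killingForm ℂ L)
      (LieAlgebra.IsKilling.killingForm_nondegenerate ℂ L)).surjective η'
    have h1 : η = ξ (∑ l, S.b.repr x l • S.b l) := by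
      rw [S.b.sum_repr, ← hη', ← hx]
      rfl
    have := hfin (S.b.repr x)
    have h2 := hle (S.b.repr x)
    rw [h1]
    omega

end Setup

end HahnQ

/-- For a nilpotent element `e` of a finite-dimensional complex semisimple
Lie algebra `𝔤`, `ind 𝔫(𝔤^e) = rk 𝔤 − dim 𝔷(𝔤^e)`. -/
theorem index_normalizer_centralizer_eq
    (L : Type*) [LieRing L] [LieAlgebra ℂ L] [FiniteDimensional ℂ L]
    [LieAlgebra.IsSemisimple ℂ L] (e : L)
    (he : IsNilpotent (LieAlgebra.ad ℂ L e)) :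
    (lieIndex ↥((centralizer L e).normalizer) : ℤ) =
      (LieAlgebra.rank ℂ L : ℤ) - (Module.finrank ℂ ↥(zCenter L e) : ℤ) := by
  have : LieAlgebra.IsKilling ℂ L := LieAlgebra.HasTrivialRadical.instIsKilling ℂ L
  obtain ⟨b, hb⟩ := HahnQ.exists_basis_repr_eq_zero he
  obtain ⟨F, _, _, _, x, D, hx, hD⟩ := HahnQ.exists_generic_field (Module.finrank ℂ L)
  have : CharZero F := charZero_of_injective_algebraMap (algebraMap ℂ F).injective
  let S : HahnQ.Setup F L (Module.finrank ℂ L) := ⟨b, e, hb, x, D, hx, hD⟩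
  have h := S.finrank_ker_form (centralizer L e).normalizer.toSubmodule (zCenter L e)
    (HahnQ.mem_normalizer_centralizer e) (HahnQ.mem_zCenter e) he
  rw [S.lieIndex_eq_finrank_ker_form]
  omega
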